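/- Duality gap characterisation for puts (n marginals): Assume μ₁,…,μ_n satisfy Assumption A. Let G : ℝ₊^n → [−∞, ∞) be upper semi-continuous with G(s₁,…,s_n) ≤ K(1 + s₁ + … + s_n) for some constant K. Define β_i : ℝ₊^i → ℝ recursively by β_n ≡ 0 and, for i = n−1,…,0, β_i(s₁,…,s_i) = max(0, sup_{s_{i+2},…,s_n ∈ ℝ₊} limsup_{x→∞} [ (β_{i+1}(s₁,…,s_i,x) + G(s₁,…,s_i,x,s_{i+2},…,s_n)/x) · 1_𝔓(s₁,…,s_i,x,s_{i+2},…,s_n) ]). If G_β(S) := G(S) − β₀(S₁ − s₀) − Σ_{i=1}^{n−1} β_i(S₁,…,S_i)(S_{i+1} − S_i) is upper semi-continuous and bounded from above, then V^{(p)}_{μ,𝔓}(G) = sup_{ℙ ∈ M⁻_{μ,𝔓}} E_ℙ[G_β(S)]. More generally, the conclusion remains true if there exists a sequence of admissible dynamic strategies β^{(N)} = (β^{(N)}_i)_{i=0}^{n−1} with each β^{(N)}_i : ℝ₊^i → ℝ₊ bounded measurable, such that G_{β^{(N)}}(S) is upper semi-continuous and bounded from above on 𝔓 for every N and G_{β^{(N)}}(S)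 → G_β(S) pointwise as N → ∞. -/

import Mathlib

open MeasureTheory Set Filter Topology
open scoped ENNReal NNReal Classical

noncomputable section

namespace RobustFin

/-- Canonical path space: the values `S₀, S₁, …, S_n` of the asset. -/
abbrev Path (n : ℕ) := Fin (n + 1) → ℝ

/-- Paths starting at `s₀` with nonnegative coordinates: the canonical space `Ω`. -/
def Omega (n : ℕ) (s₀ : ℝ) : Set (Path n) := {ω | ω 0 = s₀ ∧ ∀ i, 0 ≤ ω i}

/-- The first `j` coordinates `S₁, …, S_j` of a path. -/
def restr {n : ℕ} (j : Fin n) (ω : Path n) : Fin j → ℝ :=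
  fun i => ω ⟨(i : ℕ) + 1, by have h1 := i.isLt; have h2 := j.isLt; omega⟩

/-- The coordinates `S₁, …, S_n` of a path. -/
def tailCoords {n : ℕ} (ω : Path n) : Fin n → ℝ := fun i => ω i.succ

/-- A dynamic trading strategy: bounded measurable positions `Δ_j(S₁,…,S_j)`. -/
structure Dyn (n : ℕ) where
  pos : (j : Fin n) → (Fin j → ℝ) → ℝ
  meas : ∀ j, Measurable (pos j)
  bdd : ∀ j, ∃ C, ∀ x, |pos j x| ≤ C

/-- No short selling: all dynamic positions are nonnegative. -/
def Dyn.Nonneg {n : ℕ} (D : Dyn n) : Prop := ∀ j x, 0 ≤ D.pos j x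

/-- Gains from dynamic trading: `Σ_j Δ_j(S₁,…,S_j)(S_{j+1} − S_j)`. -/
def Dyn.gains {n : ℕ} (D : Dyn n) (ω : Path n) : ℝ :=
  ∑ j : Fin n, D.pos j (restr j ω) * (ω j.succ - ω j.castSucc)

/-- A static option portfolio: a constant (cash) position plus a finite linear
combination of options with maturity indices `idx` and nonnegative strikes. -/
structure Static (n : ℕ) where
  const : ℝ
  m : ℕ
  coeff : Fin m → ℝ
  idx : Fin m → Fin n
  strike : Fin m → ℝ
  strike_nonneg : ∀ k, 0 ≤ strike k

/-- Payoff of the portfolio when the options are call options. -/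
def Static.callPayoff {n : ℕ} (X : Static n) (ω : Path n) : ℝ :=
  X.const + ∑ k, X.coeff k * max (ω (X.idx k).succ - X.strike k) 0

/-- Payoff of the portfolio when the options are put options. -/
def Static.putPayoff {n : ℕ} (X : Static n) (ω : Path n) : ℝ :=
  X.const + ∑ k, X.coeff k * max (X.strike k - ω (X.idx k).succ) 0

/-- Price of a static portfolio, given the unit option prices `c i K`;
this is the (unique) linear pricing functional determined by the prices. -/
def Static.price {n : ℕ} (X : Static n) (c : Fin n → ℝ → ℝ) : ℝ :=
  X.const + ∑ k, X.coeff k * c (X.idx k) (X.strike k)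

/-- Expectation of a real payoff, valued in `EReal`, with the convention
`∞ − ∞ = −∞` (in `EReal`, `⊤ - ⊤ = ⊥`). -/
def eexp {n : ℕ} (P : Measure (Path n)) (f : Path n → ℝ) : EReal :=
  ((∫⁻ ω, ENNReal.ofReal (f ω) ∂P : ℝ≥0∞) : EReal) -
    ((∫⁻ ω, ENNReal.ofReal (-(f ω)) ∂P : ℝ≥0∞) : EReal)

/-- The positive part of an extended real number, in `ℝ≥0∞`. -/
def posE (x : EReal) : ℝ≥0∞ := if x = ⊤ then ⊤ else ENNReal.ofReal x.toReal

/-- Expectation of an `EReal`-valued payoff, with the convention `∞ − ∞ = −∞`. -/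
def eexpE {n : ℕ} (P : Measure (Path n)) (f : Path n → EReal) : EReal :=
  ((∫⁻ ω, posE (f ω) ∂P : ℝ≥0∞) : EReal) - ((∫⁻ ω, posE (-(f ω)) ∂P : ℝ≥0∞) : EReal)

/-- A market calibrated model for the market with static payoffs `pay` (calls or puts),
prices `c` and prediction set `P`. -/
def Calibrated {n : ℕ} (pay : Static n → Path n → ℝ) (c : Fin n → ℝ → ℝ)
    (P : Set (Path n)) (Q : Measure (Path n)) : Prop :=
  IsProbabilityMeasure Q ∧ Q P = 1 ∧
    ∀ (X : Static n) (D : Dyn n), D.Nonneg →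
      eexp Q (fun ω => pay X ω + D.gains ω) ≤ (X.price c : EReal)

/-- A weak free lunch with vanishing risk. -/
def WFLVR {n : ℕ} (pay : Static n → Path n → ℝ) (c : Fin n → ℝ → ℝ)
    (P : Set (Path n)) : Prop :=
  ∃ (Xs : ℕ → Static n) (Ds : ℕ → Dyn n) (X : Static n) (D : Dyn n) (L : ℝ),
    (∀ k, (Ds k).Nonneg) ∧ D.Nonneg ∧
    (∀ ω ∈ P, Tendsto (fun k => pay (Xs k) ω + (Ds k).gains ω) atTop (nhds 0)) ∧
    (∀ k, ∀ ω ∈ P, pay X ω + D.gains ω ≤ pay (Xs k) ω + (Ds k).gains ω) ∧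
    Tendsto (fun k => (Xs k).price c) atTop (nhds L) ∧ L < 0

/-- A robust uniformly strong arbitrage. -/
def RobustArbitrage {n : ℕ} (pay : Static n → Path n → ℝ) (c : Fin n → ℝ → ℝ)
    (P : Set (Path n)) : Prop :=
  ∃ (X : Static n) (D : Dyn n), D.Nonneg ∧ X.price c < 0 ∧
    ∀ ω ∈ P, 0 ≤ pay X ω + D.gains ω

/-- The superhedging price of `G` over semi-static strategies (no short selling). -/
def V {n : ℕ} (pay : Static n → Path n → ℝ) (c : Fin n → ℝ → ℝ)
    (P : Set (Path n)) (G : Path n → EReal) : EReal :=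
  sInf {q : EReal | ∃ (X : Static n) (D : Dyn n), D.Nonneg ∧ q = (X.price c : EReal) ∧
    ∀ ω ∈ P, G ω ≤ ((pay X ω + D.gains ω : ℝ) : EReal)}

/-- The superhedging price of `G` when the dynamic positions may take both signs. -/
def Vsigned {n : ℕ} (pay : Static n → Path n → ℝ) (c : Fin n → ℝ → ℝ)
    (P : Set (Path n)) (G : Path n → EReal) : EReal :=
  sInf {q : EReal | ∃ (X : Static n) (D : Dyn n), q = (X.price c : EReal) ∧
    ∀ ω ∈ P, G ω ≤ ((pay X ω + D.gains ω : ℝ) : EReal)}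

/-- `Π_μ`: probability measures on the path space with marginals `δ_{s₀}, μ₁, …, μ_n`. -/
def PiMu {n : ℕ} (s₀ : ℝ) (μ : Fin n → Measure ℝ) : Set (Measure (Path n)) :=
  {π | IsProbabilityMeasure π ∧ π (Omega n s₀) = 1 ∧
       ∀ i : Fin n, π.map (fun ω => ω i.succ) = μ i}

/-- The coordinate process is a supermartingale in its natural filtration:
for every Borel `A ⊆ ℝ₊^j`, `∫ 1_A(S₁,…,S_j)(S_{j+1} − S_j) dπ ≤ 0`. -/
def IsSupermartingaleLaw {n : ℕ} (π : Measure (Path n)) : Prop :=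
  ∀ (j : Fin n) (A : Set (Fin j → ℝ)), MeasurableSet A →
    ∫ ω, Set.indicator A (fun _ => (1 : ℝ)) (restr j ω) * (ω j.succ - ω j.castSucc) ∂π ≤ 0

/-- `M⁻_μ`: calibrated supermartingale measures. -/
def MSet {n : ℕ} (s₀ : ℝ) (μ : Fin n → Measure ℝ) : Set (Measure (Path n)) :=
  {π ∈ PiMu s₀ μ | IsSupermartingaleLaw π}

/-- `M⁻_{μ,𝔓}`: calibrated supermartingale measures giving full mass to `P`. -/
def MSetP {n : ℕ} (s₀ : ℝ) (μ : Fin n → Measure ℝ) (P : Set (Path n)) :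
    Set (Measure (Path n)) :=
  {π ∈ MSet s₀ μ | π P = 1}

/-- Assumption A on the marginals. -/
def AssumptionA {n : ℕ} (s₀ : ℝ) (μ : Fin n → Measure ℝ) : Prop :=
  (∀ i, ∫ x, x ∂(μ i) ≤ s₀) ∧
  (∀ i j : Fin n, i ≤ j → ∫ x, x ∂(μ j) ≤ ∫ x, x ∂(μ i)) ∧
  (∀ φ : ℝ → ℝ, ConcaveOn ℝ Set.univ φ → Monotone φ → (∀ x, 0 ≤ φ x) →
    ∀ i j : Fin n, i ≤ j → ∫ x, φ x ∂(μ j) ≤ ∫ x, φ x ∂(μ i))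

/-- Condition C (i): each `c_i` is nonnegative, convex and nonincreasing on `ℝ₊`. -/
def CondC1 {n : ℕ} (c : Fin n → ℝ → ℝ) : Prop :=
  ∀ i, (∀ x, 0 ≤ x → 0 ≤ c i x) ∧ ConvexOn ℝ (Set.Ici 0) (c i) ∧ AntitoneOn (c i) (Set.Ici 0)

/-- Condition C (ii): `s₀ ≥ c₁(0) ≥ … ≥ c_n(0) ≥ 0` and `c_i'(0+) ≥ −1`
(the latter expressed, for convex `c_i`, through the slopes at `0`). -/
def CondC2 {n : ℕ} (s₀ : ℝ) (c : Fin n → ℝ → ℝ) : Prop :=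
  (∀ i, c i 0 ≤ s₀) ∧ (∀ i j : Fin n, i ≤ j → c j 0 ≤ c i 0) ∧ (∀ i, 0 ≤ c i 0) ∧
    (∀ i, ∀ K : ℝ, 0 < K → c i 0 - K ≤ c i K)

/-- Condition C (iii): `c_i(K) → 0` as `K → ∞`. -/
def CondC3 {n : ℕ} (c : Fin n → ℝ → ℝ) : Prop :=
  ∀ i, Tendsto (c i) atTop (nhds 0)

/-- Condition C (iv): for every `x ≥ 0`, `c_i(0) − c_i(x)` is nonincreasing in `i`. -/
def CondC4 {n : ℕ} (c : Fin n → ℝ → ℝ) : Prop :=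
  ∀ x : ℝ, 0 ≤ x → ∀ i j : Fin n, i ≤ j → c j 0 - c j x ≤ c i 0 - c i x

/-- Condition C. -/
def CondC {n : ℕ} (s₀ : ℝ) (c : Fin n → ℝ → ℝ) : Prop :=
  CondC1 c ∧ CondC2 s₀ c ∧ CondC3 c ∧ CondC4 c

/-- Condition P (i). -/
def CondP1 {n : ℕ} (p : Fin n → ℝ → ℝ) : Prop :=
  ∀ i, (∀ x, 0 ≤ x → 0 ≤ p i x) ∧ ConvexOn ℝ (Set.Ici 0) (p i) ∧ MonotoneOn (p i) (Set.Ici 0)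

/-- Condition P (ii): `s₀ ≥ lim (x − p₁(x)) ≥ … ≥ 0` and `0 ≤ p_i'(0+) ≤ 1`. -/
def CondP2 {n : ℕ} (s₀ : ℝ) (p : Fin n → ℝ → ℝ) : Prop :=
  (∃ L : Fin n → ℝ,
    (∀ i, Tendsto (fun x => x - p i x) atTop (nhds (L i))) ∧
    (∀ i, L i ≤ s₀) ∧ (∀ i j : Fin n, i ≤ j → L j ≤ L i) ∧ (∀ i, 0 ≤ L i)) ∧
  (∃ d : Fin n → ℝ,
    (∀ i, Tendsto (fun K => (p i K - p i 0) / K) (nhdsWithin 0 (Set.Ioi 0)) (nhds (d i))) ∧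
    (∀ i, 0 ≤ d i ∧ d i ≤ 1))

/-- Condition P (iii): `p_i(K) → 0` as `K → 0` (within `ℝ₊`). -/
def CondP3 {n : ℕ} (p : Fin n → ℝ → ℝ) : Prop :=
  ∀ i, Tendsto (p i) (nhdsWithin 0 (Set.Ici 0)) (nhds 0)

/-- Condition P (iv): `p_i(x)` is nondecreasing in `i`. -/
def CondP4 {n : ℕ} (p : Fin n → ℝ → ℝ) : Prop :=
  ∀ x : ℝ, 0 ≤ x → ∀ i j : Fin n, i ≤ j → p i x ≤ p j x

/-- Condition P. -/
def CondP {n : ℕ} (s₀ : ℝ) (p : Fin n → ℝ → ℝ) : Prop :=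
  CondP1 p ∧ CondP2 s₀ p ∧ CondP3 p ∧ CondP4 p

/-- The measures `μ_i` defined from the put prices by `μ_i([0,K]) = p_i'(K)`;
equivalently, `p_i(K) = ∫ (K − x)⁺ μ_i(dx)`. -/
def PutPricesFrom {n : ℕ} (p : Fin n → ℝ → ℝ) (μ : Fin n → Measure ℝ) : Prop :=
  (∀ i, IsProbabilityMeasure (μ i)) ∧ (∀ i, μ i (Set.Iio 0) = 0) ∧
  (∀ i, Integrable (fun x => x) (μ i)) ∧
  (∀ i, ∀ K : ℝ, 0 ≤ K → p i K = ∫ x, max (K - x) 0 ∂(μ i))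

/-- The path `(s₀, s₁, …, s_i, x, s_{i+2}, …, s_n)`. -/
def mkPath {n : ℕ} (s₀ : ℝ) (i : Fin n) (s : Fin i → ℝ) (x : ℝ)
    (t : Fin (n - ((i : ℕ) + 1)) → ℝ) : Path n := fun j =>
  if h0 : (j : ℕ) = 0 then s₀
  else if h1 : (j : ℕ) ≤ (i : ℕ) then
    s ⟨(j : ℕ) - 1, by have := j.isLt; have := i.isLt; omega⟩
  else if h2 : (j : ℕ) = (i : ℕ) + 1 then x
  else t ⟨(j : ℕ) - (i : ℕ) - 2, by have := j.isLt; have := i.isLt; omega⟩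

/-- The family `β_i : ℝ₊^i → ℝ` defined recursively by `β_n = 0` and
`β_i(s₁,…,s_i) = (sup_{s_{i+2},…,s_n} limsup_{x→∞} ((β_{i+1}(s₁,…,s_i,x)
 + G(s₁,…,s_i,x,s_{i+2},…,s_n)/x)·1_𝔓)) ∨ 0`. -/
def IsBetaFamily {n : ℕ} (s₀ : ℝ) (P : Set (Path n)) (G : (Fin n → ℝ) → EReal)
    (β : (i : Fin (n + 1)) → (Fin i → ℝ) → ℝ) : Prop :=
  (∀ s, β (Fin.last n) s = 0) ∧
  ∀ (i : Fin n) (s : Fin i → ℝ), (∀ k, 0 ≤ s k) →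
    (β ⟨(i : ℕ), by have := i.isLt; omega⟩ s : EReal) =
      max 0 (⨆ (t : Fin (n - ((i : ℕ) + 1)) → ℝ) (_ : ∀ k, 0 ≤ t k),
        Filter.limsup (fun x : ℝ =>
          if mkPath s₀ i s x t ∈ P then
            ((β ⟨(i : ℕ) + 1, by have := i.isLt; omega⟩ (Fin.snoc s x) : ℝ) : EReal)
              + G (tailCoords (mkPath s₀ i s x t)) * ((x⁻¹ : ℝ) : EReal)
          else 0) Filter.atTop)

/-- Gains of the dynamic strategy `(β_i)`: `β₀(S₁ − s₀) + Σ_i β_i(S₁,…,S_i)(S_{i+1} − S_i)`. -/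
def gainsOf {n : ℕ} (β : (i : Fin (n + 1)) → (Fin i → ℝ) → ℝ) (ω : Path n) : ℝ :=
  ∑ j : Fin n, β ⟨(j : ℕ), by have := j.isLt; omega⟩ (restr j ω) * (ω j.succ - ω j.castSucc)

/-- The penalty function `λ_𝔓(s₁,…,s_n) = (1 + s₁ + … + s_n)·1{(s₁,…,s_n) ∉ 𝔓}`. -/
def lambdaP {n : ℕ} (P : Set (Path n)) (ω : Path n) : ℝ :=
  if ω ∈ P then 0 else 1 + ∑ i : Fin n, ω i.succ

/-- `min(s₀, s₁, …, s_m)`. -/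
def pmin {m : ℕ} (s₀ : ℝ) (s : Fin m → ℝ) : ℝ :=
  Finset.univ.inf' Finset.univ_nonempty
    (fun j : Fin (m + 1) =>
      if h : (j : ℕ) = 0 then s₀ else s ⟨(j : ℕ) - 1, by have := j.isLt; omega⟩)

/-- `max(s₀, s₁, …, s_m)`. -/
def pmax {m : ℕ} (s₀ : ℝ) (s : Fin m → ℝ) : ℝ :=
  Finset.univ.sup' Finset.univ_nonempty
    (fun j : Fin (m + 1) =>
      if h : (j : ℕ) = 0 then s₀ else s ⟨(j : ℕ) - 1, by have := j.isLt; omega⟩)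


section FileA
variable {n : ℕ}

/-- Freeze: keep coordinates up to `j`, set the others to zero. -/
def truncP (j : ℕ) (ω : Path n) : Path n := fun i => if (i : ℕ) ≤ j then ω i else 0

def extP (s₀ : ℝ) (j : Fin n) (x : Fin j → ℝ) : Path n := fun i =>
  if _h0 : (i : ℕ) = 0 then s₀
  else if h1 : (i : ℕ) ≤ (j : ℕ) then x ⟨(i : ℕ) - 1, by omega⟩
  else 0

lemma extP_restr {s₀ : ℝ} (j : Fin n) (ω : Path n) (h : ω 0 = s₀) :
    extP s₀ j (restr j ω) = truncP j ω := by
  funext i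
  unfold extP truncP restr
  by_cases h0 : (i : ℕ) = 0
  · have : i = 0 := Fin.ext h0
    subst this
    simp [h]
  · by_cases h1 : (i : ℕ) ≤ (j : ℕ)
    · simp only [h0, h1, dif_pos, dif_neg, not_false_eq_true, if_true]
      congr 1
      apply Fin.ext
      simp
      omega
    · simp [h0, h1]

lemma continuous_truncP (j : ℕ) : Continuous (truncP j : Path n → Path n) := by
  refine continuous_pi fun i => ?_
  unfold truncP
  by_cases h : (i : ℕ) ≤ j
  · simp only [h, if_true]; exact continuous_apply i
  · simp only [h, if_false]; exact continuous_const

lemma continuous_extP (s₀ : ℝ) (j : Fin n) : Continuous (extP s₀ j) := by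
  refine continuous_pi fun i => ?_
  unfold extP
  by_cases h0 : (i : ℕ) = 0
  · simp only [h0, dif_pos]; exact continuous_const
  · by_cases h1 : (i : ℕ) ≤ (j : ℕ)
    · simp only [h0, h1, dif_pos, dif_neg, not_false_eq_true]; exact continuous_apply _
    · simp only [h0, h1, dif_neg, not_false_eq_true]; exact continuous_const

lemma continuous_restr (j : Fin n) : Continuous (restr j : Path n → Fin j → ℝ) :=
  continuous_pi fun _ => continuous_apply _

lemma measurable_restr (j : Fin n) : Measurable (restr j : Path n → Fin j → ℝ) :=
  (continuous_restr j).measurable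

lemma restr_truncP (i j : Fin n) (h : i ≤ j) (ω : Path n) :
    restr i (truncP j ω) = restr i ω := by
  funext k
  unfold restr truncP
  have : (k : ℕ) + 1 ≤ (j : ℕ) := by
    have h1 := k.isLt
    have h2 : (i : ℕ) ≤ j := h
    omega
  simp [this]

lemma truncP_castSucc (j : Fin n) (ω : Path n) : truncP j ω j.castSucc = ω j.castSucc := by
  simp [truncP]

lemma sum_safe_aux (w : ℕ → ℝ) (N : ℕ) : ∀ d m : ℕ, m + d = N →
    ∑ k ∈ Finset.Ico m N, ((N : ℝ) - k) * (w (k + 1) - w k)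
      = ∑ k ∈ Finset.Ico m N, w (k + 1) - ((N : ℝ) - m) * w m := by
  intro d
  induction d with
  | zero => intro m h; have : m = N := by omega
            subst this; simp
  | succ d ih =>
    intro m h
    have hlt : m < N := by omega
    rw [Finset.sum_eq_sum_Ico_succ_bot hlt, Finset.sum_eq_sum_Ico_succ_bot hlt, ih (m+1) (by omega)]
    push_cast
    ring

lemma sum_fin_Ico (g : ℕ → ℝ) (m N : ℕ) :
    ∑ i : Fin N, (if m ≤ (i : ℕ) then g i else 0) = ∑ k ∈ Finset.Ico m N, g k := by
  rw [Fin.sum_univ_eq_sum_range (fun k => if m ≤ k then g k else 0) N, ← Finset.sum_filter]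
  congr 1
  ext k; simp; omega

/-- Extension of a path by zero to a sequence. -/
def seqP (ω : Path n) (k : ℕ) : ℝ := if h : k < n + 1 then ω ⟨k, h⟩ else 0

lemma seqP_succ (ω : Path n) (i : Fin n) : seqP ω (i + 1) = ω i.succ := by
  unfold seqP; rw [dif_pos (by omega)]; rfl

lemma seqP_castSucc (ω : Path n) (i : Fin n) : seqP ω i = ω i.castSucc := by
  unfold seqP; rw [dif_pos (by omega)]; rfl

lemma sum_safe_from (ω : Path n) (m : ℕ) (hm : m ≤ n) :
    ∑ i : Fin n, (if m ≤ (i : ℕ) then ((n : ℝ) - (i : ℕ)) * (ω i.succ - ω i.castSucc) else 0)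
      = ∑ i : Fin n, (if m ≤ (i : ℕ) then ω i.succ else 0) - ((n : ℝ) - m) * seqP ω m := by
  have h := sum_safe_aux (seqP ω) n (n - m) m (by omega)
  rw [← sum_fin_Ico, ← sum_fin_Ico] at h
  simpa only [seqP_succ, seqP_castSucc] using h

lemma sum_safe (ω : Path n) :
    ∑ i : Fin n, ((n : ℝ) - (i : ℕ)) * (ω i.succ - ω i.castSucc)
      = ∑ i : Fin n, ω i.succ - (n : ℝ) * ω 0 := by
  have := sum_safe_from ω 0 (Nat.zero_le _)
  simpa [seqP] using this

/-- constant safe strategy -/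
def safeDyn (n : ℕ) (c : ℝ) : Dyn n where
  pos j _ := c * ((n : ℝ) - (j : ℕ))
  meas _ := measurable_const
  bdd _ := ⟨_, fun _ => le_rfl⟩

lemma safeDyn_nonneg {c : ℝ} (hc : 0 ≤ c) : (safeDyn n c).Nonneg := by
  intro j x
  have : ((j : ℕ) : ℝ) ≤ n := by exact_mod_cast j.isLt.le
  exact mul_nonneg hc (by linarith)

lemma safeDyn_gains (c : ℝ) (ω : Path n) :
    (safeDyn n c).gains ω = c * (∑ i : Fin n, ω i.succ - (n : ℝ) * ω 0) := by
  rw [← sum_safe, Finset.mul_sum]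
  unfold Dyn.gains safeDyn
  exact Finset.sum_congr rfl fun j _ => by ring

/-- Build a strategy from measurable bounded path functionals through `extP`. -/
def Dyn.ofFun (φ : (j : Fin n) → (Fin j → ℝ) → ℝ) (hm : ∀ j, Measurable (φ j))
    (hb : ∀ j, ∃ C, ∀ x, |φ j x| ≤ C) : Dyn n := ⟨φ, hm, hb⟩

/-- convex combination -/
def Dyn.lin (a b : ℝ) (D E : Dyn n) : Dyn n where
  pos j x := a * D.pos j x + b * E.pos j x
  meas j := ((D.meas j).const_mul a).add ((E.meas j).const_mul b)
  bdd j := by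
    obtain ⟨C, hC⟩ := D.bdd j
    obtain ⟨C', hC'⟩ := E.bdd j
    refine ⟨|a| * C + |b| * C', fun x => (abs_add_le _ _).trans ?_⟩
    rw [abs_mul, abs_mul]
    exact add_le_add (mul_le_mul_of_nonneg_left (hC x) (abs_nonneg _))
      (mul_le_mul_of_nonneg_left (hC' x) (abs_nonneg _))

lemma Dyn.lin_gains (a b : ℝ) (D E : Dyn n) (ω : Path n) :
    (Dyn.lin a b D E).gains ω = a * D.gains ω + b * E.gains ω := by
  unfold Dyn.gains Dyn.lin
  rw [Finset.mul_sum, Finset.mul_sum, ← Finset.sum_add_distrib]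
  exact Finset.sum_congr rfl fun j _ => by ring

lemma Dyn.lin_nonneg {a b : ℝ} {D E : Dyn n} (ha : 0 ≤ a) (hb : 0 ≤ b) (hD : D.Nonneg)
    (hE : E.Nonneg) : (Dyn.lin a b D E).Nonneg := fun j x =>
  add_nonneg (mul_nonneg ha (hD j x)) (mul_nonneg hb (hE j x))

/-- combination of static portfolios -/
def Static.lin (a b : ℝ) (X Y : Static n) : Static n where
  const := a * X.const + b * Y.const
  m := X.m + Y.m
  coeff := Fin.append (fun k => a * X.coeff k) (fun k => b * Y.coeff k)
  idx := Fin.append X.idx Y.idx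
  strike := Fin.append X.strike Y.strike
  strike_nonneg k := by
    refine Fin.addCases (fun i => ?_) (fun i => ?_) k
    · simpa using X.strike_nonneg i
    · simpa using Y.strike_nonneg i

lemma Static.lin_price (a b : ℝ) (X Y : Static n) (c : Fin n → ℝ → ℝ) :
    (Static.lin a b X Y).price c = a * X.price c + b * Y.price c := by
  have : (Static.lin a b X Y).price c = (a * X.const + b * Y.const) +
      ∑ k : Fin (X.m + Y.m), Fin.append (fun k => a * X.coeff k) (fun k => b * Y.coeff k) k *
        c (Fin.append X.idx Y.idx k) (Fin.append X.strike Y.strike k) := rfl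
  rw [this, Fin.sum_univ_add]
  simp only [Static.price, Fin.append_left, Fin.append_right, mul_add, Finset.mul_sum, mul_assoc]
  ring

lemma Static.lin_putPayoff (a b : ℝ) (X Y : Static n) (ω : Path n) :
    (Static.lin a b X Y).putPayoff ω = a * X.putPayoff ω + b * Y.putPayoff ω := by
  have : (Static.lin a b X Y).putPayoff ω = (a * X.const + b * Y.const) +
      ∑ k : Fin (X.m + Y.m), Fin.append (fun k => a * X.coeff k) (fun k => b * Y.coeff k) k *
        max (Fin.append X.strike Y.strike k - ω (Fin.append X.idx Y.idx k).succ) 0 := rfl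
  rw [this, Fin.sum_univ_add]
  simp only [Static.putPayoff, Fin.append_left, Fin.append_right, mul_add, Finset.mul_sum, mul_assoc]
  ring

def Static.cash (n : ℕ) (a : ℝ) : Static n :=
  ⟨a, 0, fun _ => 0, fun k => k.elim0, fun _ => 0, fun _ => le_rfl⟩

lemma Static.cash_price (a : ℝ) (c : Fin n → ℝ → ℝ) : (Static.cash n a).price c = a := by
  simp [Static.price, Static.cash]

lemma Static.cash_putPayoff (a : ℝ) (ω : Path n) : (Static.cash n a).putPayoff ω = a := by
  simp [Static.putPayoff, Static.cash]

/-- A single put. -/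
def Static.put (i : Fin n) (k : ℝ) (hk : 0 ≤ k) : Static n :=
  ⟨0, 1, fun _ => 1, fun _ => i, fun _ => k, fun _ => hk⟩

lemma Static.put_price (i : Fin n) (k : ℝ) (hk : 0 ≤ k) (c : Fin n → ℝ → ℝ) :
    (Static.put i k hk).price c = c i k := by
  have : (Static.put i k hk).price c = 0 + ∑ _k : Fin 1, 1 * c i k := rfl
  rw [this]; simp

lemma Static.put_putPayoff (i : Fin n) (k : ℝ) (hk : 0 ≤ k) (ω : Path n) :
    (Static.put i k hk).putPayoff ω = max (k - ω i.succ) 0 := by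
  have : (Static.put i k hk).putPayoff ω = 0 + ∑ _k : Fin 1, 1 * max (k - ω i.succ) 0 := rfl
  rw [this]; simp

lemma continuous_putPayoff (X : Static n) : Continuous X.putPayoff := by
  unfold Static.putPayoff
  fun_prop

lemma putPayoff_bdd (X : Static n) : ∃ C, ∀ ω : Path n, (∀ i, 0 ≤ ω i) → |X.putPayoff ω| ≤ C := by
  refine ⟨|X.const| + ∑ k, |X.coeff k| * X.strike k, fun ω hω => ?_⟩
  unfold Static.putPayoff
  refine (abs_add_le _ _).trans (add_le_add le_rfl ?_)
  refine (Finset.abs_sum_le_sum_abs _ _).trans (Finset.sum_le_sum fun k _ => ?_)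
  rw [abs_mul]
  refine mul_le_mul_of_nonneg_left ?_ (abs_nonneg _)
  rw [abs_of_nonneg (le_max_right _ _)]
  exact max_le (by linarith [hω (X.idx k).succ]) (X.strike_nonneg k)

lemma isClosed_Omega (n : ℕ) (s₀ : ℝ) : IsClosed (Omega n s₀) := by
  have : Omega n s₀ = {ω | ω 0 = s₀} ∩ ⋂ i, {ω | 0 ≤ ω i} := by
    ext ω; simp [Omega]
  rw [this]
  exact (isClosed_eq (continuous_apply 0) continuous_const).inter
    (isClosed_iInter fun i => isClosed_le continuous_const (continuous_apply i))

lemma continuous_tailCoords : Continuous (tailCoords : Path n → Fin n → ℝ) :=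
  continuous_pi fun _ => continuous_apply _

lemma Dyn.measurable_gains (D : Dyn n) : Measurable D.gains := by
  unfold Dyn.gains
  refine Finset.measurable_sum _ fun j _ => ?_
  exact ((D.meas j).comp (measurable_restr j)).mul
    ((measurable_pi_apply _).sub (measurable_pi_apply _))
end FileA

section FileB
section Dom
variable {n : ℕ}

lemma mkPath_abs_le {s₀ : ℝ} (i : Fin n) (s : Fin i → ℝ) (x : ℝ)
    (t : Fin (n - ((i : ℕ) + 1)) → ℝ) (j : Fin (n + 1)) (hj : (j : ℕ) ≠ i + 1) :
    |mkPath s₀ i s x t j| ≤ |s₀| + ∑ k, |s k| + ∑ k, |t k| := by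
  have h1 : 0 ≤ ∑ k, |s k| := Finset.sum_nonneg fun _ _ => abs_nonneg _
  have h2 : 0 ≤ ∑ k, |t k| := Finset.sum_nonneg fun _ _ => abs_nonneg _
  have h3 := abs_nonneg s₀
  unfold mkPath
  split_ifs with a b
  · linarith
  · have := Finset.single_le_sum (f := fun k => |s k|) (fun _ _ => abs_nonneg _)
      (Finset.mem_univ (⟨(j : ℕ) - 1, by omega⟩ : Fin i))
    linarith
  · have := Finset.single_le_sum (f := fun k => |t k|) (fun _ _ => abs_nonneg _)
      (Finset.mem_univ (⟨(j : ℕ) - (i : ℕ) - 2, by omega⟩ : Fin (n - ((i : ℕ) + 1))))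
    linarith

lemma mkPath_succ {s₀ : ℝ} (i : Fin n) (s : Fin i → ℝ) (x : ℝ)
    (t : Fin (n - ((i : ℕ) + 1)) → ℝ) : mkPath s₀ i s x t i.succ = x := by
  unfold mkPath; simp

lemma restr_mkPath {s₀ : ℝ} (i : Fin n) (s : Fin i → ℝ) (x : ℝ)
    (t : Fin (n - ((i : ℕ) + 1)) → ℝ) : restr i (mkPath s₀ i s x t) = s := by
  funext k
  have : (k : ℕ) + 1 ≤ (i : ℕ) := k.isLt
  simp [restr, mkPath, this]

lemma restr_mkPath_succ {s₀ : ℝ} (i : Fin n) (h : (i : ℕ) + 1 < n) (s : Fin i → ℝ) (x : ℝ)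
    (t : Fin (n - ((i : ℕ) + 1)) → ℝ) :
    restr ⟨(i : ℕ) + 1, h⟩ (mkPath s₀ i s x t) = (Fin.snoc s x : Fin ((i : ℕ) + 1) → ℝ) := by
  funext k
  have hk : (k : ℕ) < (i : ℕ) + 1 := k.isLt
  unfold restr mkPath Fin.snoc
  by_cases h1 : (k : ℕ) < i
  · have : (k : ℕ) + 1 ≤ i := h1
    simp [this, h1]; rfl
  · have : (k : ℕ) = i := by omega
    simp [this]

lemma dom_step {s₀ : ℝ} {P : Set (Path n)} (hPsub : P ⊆ Omega n s₀) (D : Dyn n) (hD : D.Nonneg)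
    (i : Fin n) (s : Fin i → ℝ) (t : Fin (n - ((i : ℕ) + 1)) → ℝ) :
    ∃ c, 0 ≤ c ∧ ∀ x, 0 ≤ x → mkPath s₀ i s x t ∈ P →
      D.gains (mkPath s₀ i s x t) ≤ c + D.pos i s * x -
        (if h : (i : ℕ) + 1 < n then
          D.pos ⟨(i : ℕ) + 1, h⟩ (Fin.snoc s x : Fin ((i : ℕ) + 1) → ℝ) else 0) * x := by
  choose B hB using D.bdd
  set M := |s₀| + ∑ k, |s k| + ∑ k, |t k| with hM
  have hM0 : 0 ≤ M := by positivity
  have hB0 : ∀ j, 0 ≤ B j := fun j => (abs_nonneg _).trans (hB j 0)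
  refine ⟨∑ j, B j * (2 * M), Finset.sum_nonneg fun j _ => mul_nonneg (hB0 j) (by linarith), ?_⟩
  intro x hx hP
  set ω := mkPath s₀ i s x t with hω
  have hΩ := hPsub hP
  have key : ∀ j : Fin n, D.pos j (restr j ω) * (ω j.succ - ω j.castSucc) ≤
      B j * (2 * M) + (if j = i then D.pos i s * x else 0) -
      (if (j : ℕ) = i + 1 then D.pos j (restr j ω) * x else 0) := by
    intro j
    have hp := hD j (restr j ω)
    have hpB : D.pos j (restr j ω) ≤ B j := (le_abs_self _).trans (hB j _)
    rcases lt_trichotomy (j : ℕ) (i : ℕ) with h | h | h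
    · have a1 := mkPath_abs_le (s₀ := s₀) i s x t j.succ (by simp; omega)
      have a2 := mkPath_abs_le (s₀ := s₀) i s x t j.castSucc (by simp; omega)
      rw [if_neg (by intro hh; subst hh; omega), if_neg (by omega)]
      have : ω j.succ - ω j.castSucc ≤ 2 * M := by
        linarith [abs_le.1 a1, abs_le.1 a2]
      nlinarith [mul_le_mul_of_nonneg_left this hp, mul_le_mul_of_nonneg_right hpB (by linarith : (0:ℝ) ≤ 2 * M)]
    · have hji : j = i := Fin.ext h
      subst hji
      have e1 : ω j.succ = x := mkPath_succ _ _ _ _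
      have e2 : restr j ω = s := restr_mkPath _ _ _ _
      rw [if_pos rfl, if_neg (by omega), e1, e2]
      have := hΩ.2 j.castSucc
      have hp := hD j s
      have := mul_nonneg hp this
      have := mul_nonneg (hB0 j) (by linarith : (0:ℝ) ≤ 2 * M)
      nlinarith
    · rw [if_neg (by intro hh; subst hh; omega)]
      have a1 := mkPath_abs_le (s₀ := s₀) i s x t j.succ (by simp; omega)
      by_cases h2 : (j : ℕ) = i + 1
      · rw [if_pos h2]
        have e1 : ω j.castSucc = x := by
          have : j.castSucc = i.succ := by apply Fin.ext; simp [h2]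
          rw [this]; exact mkPath_succ _ _ _ _
        rw [e1]
        have : ω j.succ ≤ 2 * M := by linarith [(abs_le.1 a1).2]
        nlinarith [mul_le_mul_of_nonneg_left this hp, mul_le_mul_of_nonneg_right hpB (by linarith : (0:ℝ) ≤ 2 * M)]
      · have a2 := mkPath_abs_le (s₀ := s₀) i s x t j.castSucc (by simp; omega)
        rw [if_neg h2]
        have : ω j.succ - ω j.castSucc ≤ 2 * M := by
          linarith [abs_le.1 a1, abs_le.1 a2]
        nlinarith [mul_le_mul_of_nonneg_left this hp, mul_le_mul_of_nonneg_right hpB (by linarith : (0:ℝ) ≤ 2 * M)]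
  have := Finset.sum_le_sum fun j (_ : j ∈ Finset.univ) => key j
  rw [Finset.sum_sub_distrib, Finset.sum_add_distrib, Finset.sum_ite_eq' Finset.univ i] at this
  simp only [Finset.mem_univ, if_true] at this
  refine this.trans (le_of_eq ?_)
  congr 1
  by_cases h : (i : ℕ) + 1 < n
  · rw [dif_pos h, Finset.sum_eq_single (⟨(i : ℕ) + 1, h⟩ : Fin n)]
    · rw [if_pos rfl, hω, restr_mkPath_succ]
    · intro b _ hb
      rw [if_neg]
      intro hh; exact hb (Fin.ext hh)
    · simp
  · rw [dif_neg h]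
    simp only [zero_mul]
    refine Finset.sum_eq_zero fun j _ => if_neg ?_
    have := j.isLt; omega

lemma dom {s₀ : ℝ} {P : Set (Path n)} (hPsub : P ⊆ Omega n s₀) {G : (Fin n → ℝ) → EReal}
    {β : (i : Fin (n + 1)) → (Fin i → ℝ) → ℝ} (hβ : IsBetaFamily s₀ P G β)
    (D : Dyn n) (hD : D.Nonneg) (C : ℝ)
    (h : ∀ ω ∈ P, G (tailCoords ω) ≤ ((C + D.gains ω : ℝ) : EReal)) :
    ∀ (i : Fin n) (s : Fin i → ℝ), (∀ k, 0 ≤ s k) →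
      β ⟨(i : ℕ), by have := i.isLt; omega⟩ s ≤ D.pos i s := by
  suffices H : ∀ d : ℕ, ∀ i : Fin n, (i : ℕ) + d + 1 = n → ∀ (s : Fin i → ℝ), (∀ k, 0 ≤ s k) →
      β ⟨(i : ℕ), by have := i.isLt; omega⟩ s ≤ D.pos i s from
    fun i s hs => H (n - i - 1) i (by have := i.isLt; omega) s hs
  intro d
  induction d with
  | zero =>
    intro i hi s hs
    have hb := hβ.2 i s hs
    rw [← EReal.coe_le_coe_iff, hb]
    refine max_le (by exact_mod_cast hD i s) (iSup_le fun t => iSup_le fun ht => ?_)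
    obtain ⟨c, hc0, hc⟩ := dom_step hPsub D hD i s t
    have hlim : Tendsto (fun x : ℝ => ((D.pos i s + (|C| + c) * x⁻¹ : ℝ) : EReal)) atTop
        (𝓝 ((D.pos i s : ℝ) : EReal)) := by
      apply (continuous_coe_real_ereal.tendsto _).comp
      simpa using (tendsto_inv_atTop_zero.const_mul (|C| + c)).const_add (D.pos i s)
    rw [← hlim.limsup_eq]
    refine limsup_le_limsup ?_
    filter_upwards [eventually_gt_atTop 0] with x hx
    have hxi : 0 ≤ x⁻¹ := (inv_pos.2 hx).le
    split_ifs with hP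
    · have hlast : ∀ u : Fin ((i : ℕ) + 1) → ℝ, β ⟨(i : ℕ) + 1, by omega⟩ u = 0 := by
        have : (⟨(i : ℕ) + 1, by omega⟩ : Fin (n + 1)) = Fin.last n := by
          apply Fin.ext; simp; omega
        have H : ∀ (a b : Fin (n + 1)) (hab : a = b), (∀ u, β b u = 0) → ∀ u, β a u = 0 := by
          rintro a b rfl h; exact h
        exact H _ _ this hβ.1
      rw [hlast]
      have h1 := h _ hP
      have h2 := hc x hx.le hP
      rw [dif_neg (by omega)] at h2
      calc ((0:ℝ) : EReal) + G (tailCoords (mkPath s₀ i s x t)) * ((x⁻¹ : ℝ) : EReal)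
          ≤ ((0:ℝ) : EReal) + ((C + D.gains (mkPath s₀ i s x t) : ℝ) : EReal) * ((x⁻¹ : ℝ) : EReal) := by
            gcongr
        _ ≤ _ := by
            norm_cast
            have : (C + D.gains (mkPath s₀ i s x t)) * x⁻¹ ≤ (|C| + c + D.pos i s * x) * x⁻¹ := by
              apply mul_le_mul_of_nonneg_right _ hxi
              linarith [le_abs_self C]
            have e : (|C| + c + D.pos i s * x) * x⁻¹ = D.pos i s + (|C| + c) * x⁻¹ := by
              field_simp; ring
            linarith
    · have : 0 ≤ D.pos i s + (|C| + c) * x⁻¹ := by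
        have := hD i s
        have := abs_nonneg C
        positivity
      exact_mod_cast this
  | succ d ih =>
    intro i hi s hs
    have hb := hβ.2 i s hs
    rw [← EReal.coe_le_coe_iff, hb]
    refine max_le (by exact_mod_cast hD i s) (iSup_le fun t => iSup_le fun ht => ?_)
    obtain ⟨c, hc0, hc⟩ := dom_step hPsub D hD i s t
    have hlim : Tendsto (fun x : ℝ => ((D.pos i s + (|C| + c) * x⁻¹ : ℝ) : EReal)) atTop
        (𝓝 ((D.pos i s : ℝ) : EReal)) := by
      apply (continuous_coe_real_ereal.tendsto _).comp
      simpa using (tendsto_inv_atTop_zero.const_mul (|C| + c)).const_add (D.pos i s)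
    rw [← hlim.limsup_eq]
    refine limsup_le_limsup ?_
    filter_upwards [eventually_gt_atTop 0] with x hx
    have hxi : 0 ≤ x⁻¹ := (inv_pos.2 hx).le
    split_ifs with hP
    · have hn : (i : ℕ) + 1 < n := by omega
      have h1 := h _ hP
      have h2 := hc x hx.le hP
      have h3 := ih ⟨(i : ℕ) + 1, hn⟩ (by simp; omega) (Fin.snoc s x : Fin ((i : ℕ) + 1) → ℝ) (by
        intro k
        refine Fin.lastCases ?_ (fun k => ?_) k
        · simpa using hx.le
        · simpa using hs k)
      rw [dif_pos hn] at h2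
      generalize β ⟨(i : ℕ) + 1, by omega⟩ (Fin.snoc s x : Fin ((i : ℕ) + 1) → ℝ) = b at *
      calc (b : EReal) + G (tailCoords (mkPath s₀ i s x t)) * ((x⁻¹ : ℝ) : EReal)
          ≤ (b : EReal) + ((C + D.gains (mkPath s₀ i s x t) : ℝ) : EReal) * ((x⁻¹ : ℝ) : EReal) := by
            gcongr
        _ ≤ _ := by
            norm_cast
            generalize D.pos ⟨(i : ℕ) + 1, hn⟩ (Fin.snoc s x : Fin ((i : ℕ) + 1) → ℝ) = p at *
            have : (C + D.gains (mkPath s₀ i s x t)) * x⁻¹ ≤ (|C| + c + D.pos i s * x - p * x) * x⁻¹ := by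
              apply mul_le_mul_of_nonneg_right _ hxi
              linarith [le_abs_self C]
            have e : (|C| + c + D.pos i s * x - p * x) * x⁻¹ = D.pos i s + (|C| + c) * x⁻¹ - p := by
              field_simp; ring
            linarith
    · have : 0 ≤ D.pos i s + (|C| + c) * x⁻¹ := by
        have := hD i s
        have := abs_nonneg C
        positivity
      exact_mod_cast this

lemma beta_nonneg {s₀ : ℝ} {P : Set (Path n)} {G : (Fin n → ℝ) → EReal}
    {β : (i : Fin (n + 1)) → (Fin i → ℝ) → ℝ} (hβ : IsBetaFamily s₀ P G β)
    (i : Fin n) (s : Fin i → ℝ) (hs : ∀ k, 0 ≤ s k) :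
      0 ≤ β ⟨(i : ℕ), by have := i.isLt; omega⟩ s := by
  have hb := hβ.2 i s hs
  rw [← EReal.coe_le_coe_iff, hb]
  exact le_max_left _ _

/-- linear growth bound in terms of the safe strategy -/
lemma safe_superhedge {s₀ : ℝ} {G : (Fin n → ℝ) → EReal} {K : ℝ}
    (hG : ∀ s : Fin n → ℝ, (∀ i, 0 ≤ s i) → G s ≤ ((K * (1 + ∑ i, s i) : ℝ) : EReal))
    (ω : Path n) (hω : ω ∈ Omega n s₀) :
    G (tailCoords ω) ≤ ((max K 0 * (1 + n * s₀) + (safeDyn n (max K 0)).gains ω : ℝ) : EReal) := by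
  refine (hG _ fun i => hω.2 i.succ).trans ?_
  rw [safeDyn_gains, hω.1]
  norm_cast
  have h0 : 0 ≤ ∑ i : Fin n, tailCoords ω i := Finset.sum_nonneg fun i _ => hω.2 i.succ
  have : K * (1 + ∑ i, tailCoords ω i) ≤ max K 0 * (1 + ∑ i, tailCoords ω i) :=
    mul_le_mul_of_nonneg_right (le_max_left _ _) (by linarith)
  refine this.trans (le_of_eq ?_)
  simp only [tailCoords]
  ring

lemma beta_le {s₀ : ℝ} {P : Set (Path n)} (hPsub : P ⊆ Omega n s₀) {G : (Fin n → ℝ) → EReal}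
    {K : ℝ}
    (hG : ∀ s : Fin n → ℝ, (∀ i, 0 ≤ s i) → G s ≤ ((K * (1 + ∑ i, s i) : ℝ) : EReal))
    {β : (i : Fin (n + 1)) → (Fin i → ℝ) → ℝ} (hβ : IsBetaFamily s₀ P G β)
    (i : Fin n) (s : Fin i → ℝ) (hs : ∀ k, 0 ≤ s k) :
      β ⟨(i : ℕ), by have := i.isLt; omega⟩ s ≤ max K 0 * n := by
  refine (dom hPsub hβ (safeDyn n (max K 0)) (safeDyn_nonneg (le_max_right _ _)) _
    (fun ω hω => safe_superhedge hG ω (hPsub hω)) i s hs).trans ?_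
  refine mul_le_mul_of_nonneg_left ?_ (le_max_right _ _)
  have : (0:ℝ) ≤ (i : ℕ) := Nat.cast_nonneg _
  linarith
end Dom
end FileB

section FileC
section LemmaS
variable {n : ℕ}
open ProbabilityTheory

lemma condExp_nonpos_of_setIntegral {Ω : Type*} {m m0 : MeasurableSpace Ω} {μ : Measure Ω}
    [IsFiniteMeasure μ] (hm : m ≤ m0) {f : Ω → ℝ} (hf : Integrable f μ)
    (h : ∀ s, MeasurableSet[m] s → ∫ x in s, f x ∂μ ≤ 0) : μ[f | m] ≤ᵐ[μ] 0 := by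
  have hE : StronglyMeasurable[m] (μ[f | m]) := stronglyMeasurable_condExp
  have hs : MeasurableSet[m] {x | 0 ≤ (μ[f | m]) x} :=
    StronglyMeasurable.measurableSet_le (m := m) stronglyMeasurable_const hE
  have h1 := h _ hs
  rw [← setIntegral_condExp hm hf hs] at h1
  have h2 : 0 ≤ᵐ[μ.restrict {x | 0 ≤ (μ[f | m]) x}] μ[f | m] :=
    (ae_restrict_iff' (hm _ hs)).2 (Eventually.of_forall fun x hx => hx)
  have h3 : ∫ x in {x | 0 ≤ (μ[f | m]) x}, (μ[f | m]) x ∂μ = 0 :=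
    le_antisymm h1 (integral_nonneg_of_ae h2)
  rw [integral_eq_zero_iff_of_nonneg_ae h2 integrable_condExp.integrableOn] at h3
  rw [EventuallyEq, ae_restrict_iff' (hm _ hs)] at h3
  filter_upwards [h3] with x hx
  by_cases hx0 : 0 ≤ (μ[f | m]) x
  · exact (hx hx0).le
  · exact (not_le.1 hx0).le

lemma super_condExp {Q : Measure (Path n)} [IsProbabilityMeasure Q]
    (hInteg : ∀ i, Integrable (fun ω : Path n => ω i) Q) (hS : IsSupermartingaleLaw Q) (j : Fin n) :
    Q[fun ω => ω j.succ - ω j.castSucc | MeasurableSpace.comap (restr j) inferInstance] ≤ᵐ[Q] 0 := by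
  refine condExp_nonpos_of_setIntegral (measurable_restr j).comap_le ((hInteg _).sub (hInteg _)) ?_
  rintro s ⟨A, hA, rfl⟩
  have := hS j A hA
  rw [← integral_indicator (measurable_restr j hA)]
  refine le_trans (le_of_eq ?_) this
  refine integral_congr_ae (Eventually.of_forall fun ω => ?_)
  by_cases h : restr j ω ∈ A
  · simp [Set.indicator, h]
  · simp [Set.indicator, h]

/-- partial gains up to time `m` for arbitrary positions -/
def pgains (γ : (j : Fin n) → (Fin j → ℝ) → ℝ) (m : ℕ) (ω : Path n) : ℝ :=
  ∑ j : Fin n, if (j : ℕ) < m then γ j (restr j ω) * (ω j.succ - ω j.castSucc) else 0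

lemma pgains_succ (γ : (j : Fin n) → (Fin j → ℝ) → ℝ) (m : Fin n) (ω : Path n) :
    pgains γ (m + 1) ω = pgains γ m ω + γ m (restr m ω) * (ω m.succ - ω m.castSucc) := by
  unfold pgains
  have : ∀ j : Fin n, (if (j : ℕ) < m + 1 then γ j (restr j ω) * (ω j.succ - ω j.castSucc) else 0)
      = (if (j : ℕ) < m then γ j (restr j ω) * (ω j.succ - ω j.castSucc) else 0)
      + (if j = m then γ j (restr j ω) * (ω j.succ - ω j.castSucc) else 0) := by
    intro j
    by_cases h : j = m
    · subst h; simp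
    · have : (j : ℕ) ≠ m := fun hh => h (Fin.ext hh)
      by_cases h2 : (j : ℕ) < m
      · simp [h, h2, Nat.lt_succ_of_lt h2]
      · simp [h, h2]; intro; omega
  simp_rw [this, Finset.sum_add_distrib, Finset.sum_ite_eq' Finset.univ m]
  simp

lemma pgains_congr (γ : (j : Fin n) → (Fin j → ℝ) → ℝ) (m : Fin n) {ω ω' : Path n}
    (h0 : ω 0 = ω' 0) (h : restr m ω = restr m ω') : pgains γ m ω = pgains γ m ω' := by
  have ht : truncP m ω = truncP m ω' := by
    rw [← extP_restr m ω rfl, ← extP_restr m ω' h0.symm, h]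
  have hc : ∀ i : Fin (n + 1), (i : ℕ) ≤ m → ω i = ω' i := by
    intro i hi
    have := congrFun ht i
    simpa [truncP, hi] using this
  unfold pgains
  refine Finset.sum_congr rfl fun j _ => ?_
  by_cases hj : (j : ℕ) < m
  · have hr : restr j ω = restr j ω' := by
      rw [← restr_truncP j m (le_of_lt hj) ω, ht, restr_truncP j m (le_of_lt hj)]
    rw [if_pos hj, if_pos hj, hr, hc j.succ (by simp; omega), hc j.castSucc (by simp; omega)]
  · simp [hj]

theorem lemmaS {s₀ : ℝ} {Q : Measure (Path n)} [IsProbabilityMeasure Q]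
    (hInteg : ∀ i, Integrable (fun ω : Path n => ω i) Q) (hS : IsSupermartingaleLaw Q)
    (hQ : ∀ᵐ ω ∂Q, ω ∈ Omega n s₀)
    (γ : (j : Fin n) → (Fin j → ℝ) → ℝ) (hγ : ∀ j x, (∀ k, 0 ≤ x k) → 0 ≤ γ j x)
    (g : Path n → ℝ) (hg : Integrable g Q)
    (hle : ∀ᵐ ω ∂Q, g ω ≤ ∑ j : Fin n, γ j (restr j ω) * (ω j.succ - ω j.castSucc)) :
    ∫ ω, g ω ∂Q ≤ 0 := by
  have H : ∀ d m : ℕ, m + d = n → ∃ f : Path n → ℝ, Integrable f Q ∧ ∫ ω, f ω ∂Q = ∫ ω, g ω ∂Q ∧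
      ∀ᵐ ω ∂Q, f ω ≤ pgains γ m ω := by
    intro d
    induction d with
    | zero =>
      intro m hm
      refine ⟨g, hg, rfl, ?_⟩
      filter_upwards [hle] with ω h
      refine h.trans (le_of_eq ?_)
      unfold pgains
      refine Finset.sum_congr rfl fun j _ => (if_pos (by omega)).symm
    | succ d ih =>
      intro m hm
      obtain ⟨f, hf, hfi, hfl⟩ := ih (m + 1) (by omega)
      set j : Fin n := ⟨m, by omega⟩ with hj
      have hmeas := measurable_restr j
      refine ⟨Q[f | MeasurableSpace.comap (restr j) inferInstance], integrable_condExp,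
        (integral_condExp hmeas.comap_le).trans hfi, ?_⟩
      have e1 := condExp_ae_eq_integral_condDistrib_id (μ := Q) hmeas hf
      have hΔ : Integrable (fun ω : Path n => ω j.succ - ω j.castSucc) Q := (hInteg _).sub (hInteg _)
      have e2 := condExp_ae_eq_integral_condDistrib_id (μ := Q) hmeas hΔ
      have e3 := super_condExp hInteg hS j
      have i1 := (hf.comp_snd_map_prodMk (restr j)).condDistrib_ae (Y := id) hmeas.aemeasurable aemeasurable_id
      have i2 := (hΔ.comp_snd_map_prodMk (restr j)).condDistrib_ae (Y := id) hmeas.aemeasurable aemeasurable_id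
      -- good set
      have hgood : ∀ᵐ ω ∂Q, ω ∈ Omega n s₀ ∧ f ω ≤ pgains γ (m + 1) ω := hQ.and hfl
      obtain ⟨S, hSsub, hSm, hSe⟩ : ∃ S : Set (Path n), (∀ ω ∈ S, ω ∈ Omega n s₀ ∧ f ω ≤ pgains γ (m + 1) ω)
          ∧ MeasurableSet S ∧ ∀ᵐ ω ∂Q, ω ∈ S := by
        obtain ⟨t, ht, htm, ht0⟩ := exists_measurable_superset_of_null hgood
        refine ⟨tᶜ, fun ω hω => ?_, htm.compl, ?_⟩
        · by_contra hcon; exact hω (ht hcon)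
        · rw [ae_iff]; simpa using ht0
      have hkey : ∀ᵐ ω ∂Q, ∀ᵐ ω' ∂(condDistrib id (restr j) Q (restr j ω)),
          restr j ω' = restr j ω ∧ ω' ∈ S := by
        apply ae_of_ae_map (f := restr j) hmeas.aemeasurable
          (p := fun r => ∀ᵐ ω' ∂(condDistrib id (restr j) Q r), restr j ω' = r ∧ ω' ∈ S)
        have : ∀ᵐ x ∂((Q.map (restr j)) ⊗ₘ condDistrib id (restr j) Q),
            restr j x.2 = x.1 ∧ x.2 ∈ S := by
          rw [compProd_map_condDistrib aemeasurable_id, ae_map_iff]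
          · filter_upwards [hSe] with ω hω
            exact ⟨rfl, hω⟩
          · exact (hmeas.prodMk measurable_id).aemeasurable
          · exact (measurableSet_eq_fun (hmeas.comp measurable_snd) measurable_fst).inter
              (measurable_snd hSm)
        exact Measure.ae_ae_of_ae_compProd this
      filter_upwards [e1, e2, e3, i1, i2, hkey, hQ] with ω h1 h2 h3 h4 h5 h6 h7
      rw [h1]
      have hΔle : ∫ y : Path n, (y j.succ - y j.castSucc) ∂(condDistrib id (restr j) Q (restr j ω)) ≤ 0 := by
        rw [← h2]; exact h3
      have hc : 0 ≤ γ j (restr j ω) := hγ j _ fun k => h7.2 _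
      calc ∫ y, f y ∂(condDistrib id (restr j) Q (restr j ω))
          ≤ ∫ y : Path n, (pgains γ m ω + γ j (restr j ω) * (y j.succ - y j.castSucc))
              ∂(condDistrib id (restr j) Q (restr j ω)) := by
            refine integral_mono_ae h4 ((integrable_const _).add (h5.const_mul _)) ?_
            filter_upwards [h6] with y hy
            have hyS := hSsub y hy.2
            have e := pgains_succ γ j y
            have e' : pgains γ j y = pgains γ j ω :=
              pgains_congr γ j (hyS.1.1.trans h7.1.symm) hy.1
            have := hyS.2
            rw [hy.1] at e
            simp only [hj] at e e'
            rw [e, e'] at this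
            exact this
        _ = pgains γ m ω + γ j (restr j ω) *
              ∫ y : Path n, (y j.succ - y j.castSucc) ∂(condDistrib id (restr j) Q (restr j ω)) := by
            rw [integral_add (integrable_const _) (h5.const_mul _), integral_const_mul]
            simp
        _ ≤ pgains γ m ω := by nlinarith
  obtain ⟨f, hf, hfi, hfl⟩ := H n 0 (by omega)
  rw [← hfi]
  refine integral_nonpos_of_ae ?_
  filter_upwards [hfl] with ω h
  simpa [pgains] using h

end LemmaS
end FileC

section FileD
section Weak
variable {n : ℕ}

lemma posE_coe (x : ℝ) : posE (x : EReal) = ENNReal.ofReal x := by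
  simp [posE]

lemma posE_top : posE ⊤ = ⊤ := by simp [posE]

lemma posE_bot : posE ⊥ = 0 := by simp [posE]

lemma posE_eq (x : EReal) : posE x = x.toENNReal := rfl

lemma posE_mono {x y : EReal} (h : x ≤ y) : posE x ≤ posE y := by
  rw [posE_eq, posE_eq]; exact EReal.toENNReal_le_toENNReal h

lemma measurable_posE : Measurable posE := by
  have : posE = fun x => x.toENNReal := funext posE_eq
  rw [this]; exact EReal.continuous_toENNReal.measurable

lemma eexpE_eq {Q : Measure (Path n)} {f : Path n → EReal} (hf : AEMeasurable f Q)
    (h1 : ∫⁻ ω, posE (f ω) ∂Q ≠ ⊤) (h2 : ∫⁻ ω, posE (-(f ω)) ∂Q ≠ ⊤) :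
    (∀ᵐ ω ∂Q, f ω = ((f ω).toReal : EReal)) ∧ Integrable (fun ω => (f ω).toReal) Q ∧
      eexpE Q f = ((∫ ω, (f ω).toReal ∂Q : ℝ) : EReal) := by
  have a1 : ∀ᵐ ω ∂Q, posE (f ω) < ⊤ := ae_lt_top' (measurable_posE.comp_aemeasurable hf) h1
  have a2 : ∀ᵐ ω ∂Q, posE (-(f ω)) < ⊤ := ae_lt_top' (measurable_posE.comp_aemeasurable hf.neg) h2
  have a3 : ∀ᵐ ω ∂Q, f ω = ((f ω).toReal : EReal) := by
    filter_upwards [a1, a2] with ω b1 b2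
    rw [EReal.coe_toReal]
    · intro h; rw [h, posE_top] at b1; exact lt_irrefl _ b1
    · intro h
      have : -(f ω) = ⊤ := by rw [h]; rfl
      simp [this, posE_top] at b2
  have e1 : ∫⁻ ω, posE (f ω) ∂Q = ∫⁻ ω, ENNReal.ofReal (f ω).toReal ∂Q := by
    refine lintegral_congr_ae ?_
    filter_upwards [a3] with ω h
    rw [h, posE_coe]; simp
  have e2 : ∫⁻ ω, posE (-(f ω)) ∂Q = ∫⁻ ω, ENNReal.ofReal (-(f ω).toReal) ∂Q := by
    refine lintegral_congr_ae ?_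
    filter_upwards [a3] with ω h
    rw [h, ← EReal.coe_neg, posE_coe]; simp
  have hm : AEStronglyMeasurable (fun ω => (f ω).toReal) Q :=
    (measurable_ereal_toReal.comp_aemeasurable hf).aestronglyMeasurable
  have hI : Integrable (fun ω => (f ω).toReal) Q := by
    refine ⟨hm, ?_⟩
    have : ∫⁻ ω, ‖(f ω).toReal‖ₑ ∂Q ≤
        ∫⁻ ω, (ENNReal.ofReal (f ω).toReal + ENNReal.ofReal (-(f ω).toReal)) ∂Q := by
      refine lintegral_mono fun ω => ?_
      rw [Real.enorm_eq_ofReal_abs]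
      rcases le_total 0 (f ω).toReal with h | h
      · rw [abs_of_nonneg h]; exact le_self_add
      · rw [abs_of_nonpos h]; exact le_add_self
    refine lt_of_le_of_lt this ?_
    rw [lintegral_add_left' hm.aemeasurable.ennreal_ofReal, ← e1, ← e2]
    exact ENNReal.add_lt_top.2 ⟨h1.lt_top, h2.lt_top⟩
  refine ⟨a3, hI, ?_⟩
  rw [integral_eq_lintegral_pos_part_sub_lintegral_neg_part hI, ← e1, ← e2]
  unfold eexpE
  rw [EReal.coe_sub, EReal.coe_ennreal_toReal h1, EReal.coe_ennreal_toReal h2]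

lemma le_eexpE {Q : Measure (Path n)} {f : Path n → EReal} (hf : AEMeasurable f Q)
    {d : Path n → ℝ} (hd : Integrable d Q) (hfd : ∀ᵐ ω ∂Q, f ω ≤ (d ω : EReal))
    {v : ℝ} (hv : v ≤ ∫ ω, d ω ∂Q)
    (h : ∫⁻ ω, posE ((d ω : EReal) - f ω) ∂Q ≤ ENNReal.ofReal (∫ ω, d ω ∂Q - v)) :
    (v : EReal) ≤ eexpE Q f := by
  have h1 : ∫⁻ ω, posE (f ω) ∂Q ≠ ⊤ := by
    refine ne_top_of_le_ne_top hd.lintegral_lt_top.ne (lintegral_mono_ae ?_)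
    filter_upwards [hfd] with ω h
    exact (posE_mono h).trans_eq (posE_coe _)
  have h2 : ∫⁻ ω, posE (-(f ω)) ∂Q ≠ ⊤ := by
    have : ∫⁻ ω, posE (-(f ω)) ∂Q ≤ ∫⁻ ω, (posE ((d ω : EReal) - f ω) + ENNReal.ofReal (-(d ω))) ∂Q := by
      refine lintegral_mono fun ω => ?_
      rw [← posE_coe]
      induction f ω with
      | bot => simp [posE_top]
      | top => simp [posE_bot]
      | coe x =>
        rw [← EReal.coe_neg, ← EReal.coe_sub, posE_coe, posE_coe, posE_coe]
        refine le_trans (ENNReal.ofReal_le_ofReal (by linarith)) ENNReal.ofReal_add_le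
    refine ne_top_of_le_ne_top ?_ this
    rw [lintegral_add_right' (f := fun ω => posE ((d ω : EReal) - f ω)) (g := fun ω => ENNReal.ofReal (-(d ω))) hd.aemeasurable.neg.ennreal_ofReal]
    exact ENNReal.add_ne_top.2 ⟨ne_top_of_le_ne_top ENNReal.ofReal_ne_top h, hd.neg.lintegral_lt_top.ne⟩
  obtain ⟨a, b, c⟩ := eexpE_eq hf h1 h2
  rw [c, EReal.coe_le_coe_iff]
  have e : ∫⁻ ω, posE ((d ω : EReal) - f ω) ∂Q = ENNReal.ofReal (∫ ω, (d ω - (f ω).toReal) ∂Q) := by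
    rw [ofReal_integral_eq_lintegral_ofReal (f := fun ω => d ω - (f ω).toReal) (hd.sub b)]
    · refine lintegral_congr_ae ?_
      filter_upwards [a] with ω h
      rw [h, ← EReal.coe_sub, posE_coe]; simp
    · filter_upwards [a, hfd] with ω h h'
      rw [h] at h'
      have := EReal.coe_le_coe_iff.1 h'
      simpa using this
  rw [e, ENNReal.ofReal_le_ofReal_iff (by linarith), integral_sub hd b] at h
  linarith

lemma aemeasurable_of_usc {Q : Measure (Path n)} {f : Path n → EReal} {S : Set (Path n)}
    (hS : IsClosed S) (hQ : ∀ᵐ ω ∂Q, ω ∈ S) (hf : UpperSemicontinuousOn f S) : AEMeasurable f Q := by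
  have : Q.restrict S = Q := Measure.restrict_eq_self_of_ae_mem hQ
  rw [← this]
  refine aemeasurable_restrict_of_measurable_subtype hS.measurableSet ?_
  exact (upperSemicontinuousOn_iff_restrict.2 hf).measurable

lemma integral_putPayoff {Q : Measure (Path n)} [IsProbabilityMeasure Q] {μ : Fin n → Measure ℝ}
    (hmar : ∀ i : Fin n, Q.map (fun ω => ω i.succ) = μ i)
    (hmom : ∀ i, Integrable (fun x => x) (μ i)) [∀ i, IsProbabilityMeasure (μ i)] (X : Static n) :
    Integrable X.putPayoff Q ∧
    ∫ ω, X.putPayoff ω ∂Q = X.price (fun i K' => ∫ x, max (K' - x) 0 ∂(μ i)) := by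
  have h1 : ∀ (i : Fin n) (k : ℝ), Integrable (fun x => max (k - x) 0) (μ i) := fun i k =>
    ((integrable_const k).sub (hmom i)).pos_part
  have h2 : ∀ (i : Fin n) (k : ℝ), Integrable (fun ω : Path n => max (k - ω i.succ) 0) Q := by
    intro i k
    have := h1 i k
    rw [← hmar i] at this
    exact this.comp_measurable (measurable_pi_apply _)
  have h3 : ∀ (i : Fin n) (k : ℝ), ∫ ω : Path n, max (k - ω i.succ) 0 ∂Q = ∫ x, max (k - x) 0 ∂(μ i) := by
    intro i k
    rw [← hmar i, integral_map (measurable_pi_apply _).aemeasurable]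
    exact (Continuous.aestronglyMeasurable (by fun_prop))
  have h4 : Integrable (fun ω : Path n => ∑ k, X.coeff k * max (X.strike k - ω (X.idx k).succ) 0) Q :=
    integrable_finset_sum _ fun k _ => (h2 _ _).const_mul _
  refine ⟨(integrable_const _).add h4, ?_⟩
  unfold Static.putPayoff Static.price
  rw [integral_add (integrable_const _) h4, integral_finset_sum _ fun k _ => (h2 _ _).const_mul _]
  simp [integral_const_mul, h3]

lemma coord_integrable {s₀ : ℝ} {Q : Measure (Path n)} [IsProbabilityMeasure Q] {μ : Fin n → Measure ℝ}
    (hmar : ∀ i : Fin n, Q.map (fun ω => ω i.succ) = μ i)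
    (hmom : ∀ i, Integrable (fun x => x) (μ i)) (hQ : ∀ᵐ ω ∂Q, ω ∈ Omega n s₀) (i : Fin (n + 1)) :
    Integrable (fun ω : Path n => ω i) Q := by
  refine Fin.cases ?_ (fun i => ?_) i
  · refine (integrable_const s₀).congr ?_
    filter_upwards [hQ] with ω h using h.1.symm
  · have := hmom i
    rw [← hmar i] at this
    exact this.comp_measurable (measurable_pi_apply _)

lemma ae_of_measure_one {Q : Measure (Path n)} [IsProbabilityMeasure Q] {S : Set (Path n)}
    (hS : IsClosed S) (h : Q S = 1) : ∀ᵐ ω ∂Q, ω ∈ S := by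
  rw [ae_iff]
  exact (prob_compl_eq_zero_iff hS.measurableSet).2 h

theorem weak_duality {s₀ : ℝ} {P : Set (Path n)} (hPsub : P ⊆ Omega n s₀) (hPc : IsClosed P)
    {μ : Fin n → Measure ℝ} (hprob : ∀ i, IsProbabilityMeasure (μ i))
    (hmom : ∀ i, Integrable (fun x => x) (μ i))
    {G : (Fin n → ℝ) → EReal} (hGtop : ∀ s, G s ≠ ⊤)
    {K : ℝ} (hG : ∀ s : Fin n → ℝ, (∀ i, 0 ≤ s i) → G s ≤ ((K * (1 + ∑ i, s i) : ℝ) : EReal))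
    {β : (i : Fin (n + 1)) → (Fin i → ℝ) → ℝ} (hβ : IsBetaFamily s₀ P G β)
    (hmeas : ∀ Q ∈ MSetP s₀ μ P,
      AEMeasurable (fun ω => G (tailCoords ω) - ((gainsOf β ω : ℝ) : EReal)) Q) :
    (⨆ Q ∈ MSetP s₀ μ P, eexpE Q (fun ω => G (tailCoords ω) - ((gainsOf β ω : ℝ) : EReal))) ≤
    V Static.putPayoff (fun i K' => ∫ x, max (K' - x) 0 ∂(μ i)) P (fun ω => G (tailCoords ω)) := by
  refine iSup₂_le fun Q hQ => le_sInf ?_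
  rintro q ⟨X, D, hD, rfl, hsup⟩
  have hm := hmeas Q hQ
  obtain ⟨⟨⟨hQp, hQΩ, hmar⟩, hS⟩, hQP⟩ := hQ
  have haeP : ∀ᵐ ω ∂Q, ω ∈ P := ae_of_measure_one hPc hQP
  have haeΩ : ∀ᵐ ω ∂Q, ω ∈ Omega n s₀ := haeP.mono fun ω h => hPsub h
  have hInteg := coord_integrable hmar hmom haeΩ
  obtain ⟨hXi, hXp⟩ := integral_putPayoff hmar hmom X
  obtain ⟨CX, hCX⟩ := putPayoff_bdd X
  set γ : (j : Fin n) → (Fin j → ℝ) → ℝ := fun j x =>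
    D.pos j x - β ⟨(j : ℕ), by have := j.isLt; omega⟩ x with hγ
  have hdom := dom hPsub hβ D hD CX (fun ω hω => (hsup ω hω).trans (by
    norm_cast
    have := (abs_le.1 (hCX ω (hPsub hω).2)).2
    linarith))
  have hγ0 : ∀ j x, (∀ k, 0 ≤ x k) → 0 ≤ γ j x := fun j x hx => by
    have := hdom j x hx; simp only [hγ]; linarith
  choose B hB using D.bdd
  have hγB : ∀ j x, (∀ k, 0 ≤ x k) → γ j x ≤ B j := fun j x hx => by
    have h1 := beta_nonneg hβ j x hx
    have h2 := (le_abs_self _).trans (hB j x)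
    simp only [hγ]; linarith
  set f : Path n → EReal := fun ω => G (tailCoords ω) - ((gainsOf β ω : ℝ) : EReal) with hf
  have hsum : ∀ ω, ∑ j : Fin n, γ j (restr j ω) * (ω j.succ - ω j.castSucc) = D.gains ω - gainsOf β ω := by
    intro ω
    unfold Dyn.gains gainsOf
    rw [← Finset.sum_sub_distrib]
    exact Finset.sum_congr rfl fun j _ => by simp only [hγ]; ring
  have hfle : ∀ ω ∈ P, f ω ≤ ((X.putPayoff ω +
      ∑ j : Fin n, γ j (restr j ω) * (ω j.succ - ω j.castSucc) : ℝ) : EReal) := by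
    intro ω hω
    have := hsup ω hω
    rw [hsum]
    calc f ω ≤ ((X.putPayoff ω + D.gains ω : ℝ) : EReal) - ((gainsOf β ω : ℝ) : EReal) :=
          EReal.sub_le_sub this le_rfl
      _ = _ := by norm_cast; ring_nf
  have h1 : ∫⁻ ω, posE (f ω) ∂Q ≠ ⊤ := by
    have hb : Integrable (fun ω : Path n => X.putPayoff ω + ∑ j : Fin n, B j * |ω j.succ - ω j.castSucc|) Q :=
      hXi.add (integrable_finset_sum _ fun j _ => (((hInteg _).sub (hInteg _)).abs.const_mul _))
    refine ne_top_of_le_ne_top hb.lintegral_lt_top.ne (lintegral_mono_ae ?_)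
    filter_upwards [haeP] with ω hω
    refine (posE_mono (hfle ω hω)).trans ?_
    rw [posE_coe]
    refine ENNReal.ofReal_le_ofReal (add_le_add le_rfl (Finset.sum_le_sum fun j _ => ?_))
    have hr : ∀ k, 0 ≤ restr j ω k := fun k => (hPsub hω).2 _
    calc γ j (restr j ω) * (ω j.succ - ω j.castSucc)
        ≤ γ j (restr j ω) * |ω j.succ - ω j.castSucc| :=
          mul_le_mul_of_nonneg_left (le_abs_self _) (hγ0 j _ hr)
      _ ≤ _ := mul_le_mul_of_nonneg_right (hγB j _ hr) (abs_nonneg _)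
  by_cases h2 : ∫⁻ ω, posE (-(f ω)) ∂Q = ⊤
  · unfold eexpE
    rw [h2]
    simp
  obtain ⟨a, b, c⟩ := eexpE_eq hm h1 h2
  rw [c, EReal.coe_le_coe_iff, ← hXp]
  have := lemmaS hInteg hS haeΩ γ hγ0 (fun ω => (f ω).toReal - X.putPayoff ω) (b.sub hXi) (by
    filter_upwards [a, haeP] with ω h h'
    have h3 := hfle ω h'
    rw [h, EReal.coe_le_coe_iff] at h3
    linarith)
  rw [integral_sub b hXi] at this
  linarith
end Weak
end FileD

section FileE
open scoped BoundedContinuousFunction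

/-- Static put payoff as a bounded continuous function on an extended space. -/
def Xt {n : ℕ} {Z : Type*} [TopologicalSpace Z] (π : Z → Path n) (hπ : Continuous π)
    (X : Static n) : Z →ᵇ ℝ :=
  BoundedContinuousFunction.ofNormedAddCommGroup
    (fun ζ => X.putPayoff (fun i => max (π ζ i) 0))
    ((continuous_putPayoff X).comp (continuous_pi fun i =>
      ((continuous_apply i).comp hπ).max continuous_const))
    (putPayoff_bdd X).choose
    (fun ζ => by
      rw [Real.norm_eq_abs]
      exact (putPayoff_bdd X).choose_spec _ (fun i => le_max_right _ _))

lemma Xt_apply {n : ℕ} {Z : Type*} [TopologicalSpace Z] (π : Z → Path n) (hπ : Continuous π)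
    (X : Static n) (ζ : Z) : Xt π hπ X ζ = X.putPayoff (fun i => max (π ζ i) 0) := rfl

lemma Xt_lin {n : ℕ} {Z : Type*} [TopologicalSpace Z] (π : Z → Path n) (hπ : Continuous π)
    (a b : ℝ) (X Y : Static n) : Xt π hπ (Static.lin a b X Y) = a • Xt π hπ X + b • Xt π hπ Y := by
  ext ζ
  simp [Xt_apply, Static.lin_putPayoff]

lemma Xt_cash {n : ℕ} {Z : Type*} [TopologicalSpace Z] (π : Z → Path n) (hπ : Continuous π)
    (a : ℝ) : Xt π hπ (Static.cash n a) = a • (1 : Z →ᵇ ℝ) := by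
  ext ζ
  simp [Xt_apply, Static.cash_putPayoff]

lemma exists_functional {n : ℕ} {Z : Type*} [TopologicalSpace Z] (π : Z → Path n)
    (hπ : Continuous π) (z : Path n → Z) (hz : ∀ ω, π (z ω) = ω) {s₀ : ℝ} {P : Set (Path n)}
    (hP : P ⊆ Omega n s₀) (F : Path n → EReal) (p : Fin n → ℝ → ℝ) (v : ℝ)
    (hv : ∀ (X : Static n) (D : Dyn n), D.Nonneg →
      (∀ ω ∈ P, F ω ≤ ((X.putPayoff ω + D.gains ω : ℝ) : EReal)) → v ≤ X.price p)
    (hH : ∃ (C : ℝ) (D : Dyn n), D.Nonneg ∧ ∀ ω ∈ P, F ω ≤ ((C + D.gains ω : ℝ) : EReal)) :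
    ∃ L : (Z →ᵇ ℝ) →ₗ[ℝ] ℝ, (∀ f : Z →ᵇ ℝ, (∀ ω ∈ P, 0 ≤ f (z ω)) → 0 ≤ L f) ∧ L 1 = 1 ∧
      (∀ X, L (Xt π hπ X) = X.price p) ∧
      ∀ (h : Z →ᵇ ℝ) (D : Dyn n), D.Nonneg →
        (∀ ω ∈ P, F ω ≤ ((h (z ω) + D.gains ω : ℝ) : EReal)) → v ≤ L h := by
  set H : Set (Z →ᵇ ℝ) := {h | ∃ D : Dyn n, D.Nonneg ∧
    ∀ ω ∈ P, F ω ≤ ((h (z ω) + D.gains ω : ℝ) : EReal)} with hHdef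
  set S : Set (Z →ᵇ ℝ) := {a | ∃ h ∈ H, ∃ X : Static n, X.price p < v ∧ a = h - Xt π hπ X} with hS
  have hXt : ∀ X : Static n, ∀ ω ∈ P, Xt π hπ X (z ω) = X.putPayoff ω := by
    intro X ω hω
    rw [Xt_apply]
    congr 1
    funext i
    rw [hz, max_eq_left ((hP hω).2 i)]
  obtain ⟨C, D0, hD0, hC⟩ := hH
  have hh0 : (C • (1 : Z →ᵇ ℝ)) ∈ H := ⟨D0, hD0, fun ω hω => by simpa using hC ω hω⟩
  have hHadd : ∀ h ∈ H, ∀ g : Z →ᵇ ℝ, (∀ ω ∈ P, 0 ≤ g (z ω)) → h + g ∈ H := by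
    rintro h ⟨D, hD, h1⟩ g hg
    refine ⟨D, hD, fun ω hω => (h1 ω hω).trans ?_⟩
    rw [EReal.coe_le_coe_iff]
    have := hg ω hω
    simp only [BoundedContinuousFunction.coe_add, Pi.add_apply]
    linarith
  have hconv : Convex ℝ S := by
    rintro _ ⟨h, ⟨D, hD, h1⟩, X, hX, rfl⟩ _ ⟨h', ⟨D', hD', h1'⟩, X', hX', rfl⟩ a b ha hb hab
    refine ⟨a • h + b • h', ⟨Dyn.lin a b D D', Dyn.lin_nonneg ha hb hD hD', fun ω hω => ?_⟩,
      Static.lin a b X X', ?_, ?_⟩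
    · rw [Dyn.lin_gains]
      have e1 := h1 ω hω
      have e2 := h1' ω hω
      induction hF : F ω with
      | bot => exact bot_le
      | top => rw [hF] at e1; exact absurd (top_le_iff.1 e1) (EReal.coe_ne_top _)
      | coe r =>
        rw [hF, EReal.coe_le_coe_iff] at e1 e2
        rw [EReal.coe_le_coe_iff]
        simp only [BoundedContinuousFunction.coe_add, Pi.add_apply, BoundedContinuousFunction.coe_smul,
          smul_eq_mul]
        have e3 := mul_le_mul_of_nonneg_left e1 ha
        have e4 := mul_le_mul_of_nonneg_left e2 hb
        have e5 : r = a * r + b * r := by rw [← add_mul, hab, one_mul]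
        linarith
    · rw [Static.lin_price]
      rcases ha.eq_or_lt with h0 | h0
      · subst h0
        have : b = 1 := by linarith
        subst this
        simpa using hX'
      · have e3 := mul_lt_mul_of_pos_left hX h0
        have e4 := mul_le_mul_of_nonneg_left hX'.le hb
        have e5 : v = a * v + b * v := by rw [← add_mul, hab, one_mul]
        linarith
    · rw [Xt_lin, smul_sub, smul_sub]; abel
  have hdisj : Disjoint (Metric.ball (-1 : Z →ᵇ ℝ) 1) S := by
    rw [Set.disjoint_left]
    rintro _ ha ⟨h, ⟨D, hD, h1⟩, X, hX, rfl⟩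
    refine absurd (hv X D hD fun ω hω => (h1 ω hω).trans ?_) (not_le.2 hX)
    rw [EReal.coe_le_coe_iff]
    have e := BoundedContinuousFunction.dist_coe_le_dist (f := h - Xt π hπ X) (g := -1) (z ω)
    have e2 := e.trans_lt (Metric.mem_ball.1 ha)
    rw [Real.dist_eq, abs_lt] at e2
    simp only [BoundedContinuousFunction.coe_sub, Pi.sub_apply, hXt X ω hω,
      BoundedContinuousFunction.coe_neg, Pi.neg_apply, BoundedContinuousFunction.coe_one,
      Pi.one_apply] at e2
    linarith [e2.2]
  obtain ⟨f, u, hf1, hf2⟩ := geometric_hahn_banach_open (convex_ball _ _) Metric.isOpen_ball hconv hdisj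
  set c0 : Z →ᵇ ℝ := C • (1 : Z →ᵇ ℝ) - Xt π hπ (Static.cash n (v - 1)) with hc0
  have hc0S : ∀ g : Z →ᵇ ℝ, (∀ ω ∈ P, 0 ≤ g (z ω)) → c0 + g ∈ S := fun g hg =>
    ⟨C • 1 + g, hHadd _ hh0 g hg, Static.cash n (v - 1), by rw [Static.cash_price]; linarith,
      by rw [hc0]; abel⟩
  have hpos : ∀ g : Z →ᵇ ℝ, (∀ ω ∈ P, 0 ≤ g (z ω)) → 0 ≤ f g := by
    intro g hg
    by_contra hneg
    push Not at hneg
    obtain ⟨N, hN⟩ := exists_nat_gt ((f c0 - u) / (- f g))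
    rw [div_lt_iff₀ (by linarith)] at hN
    have := hf2 _ (hc0S ((N : ℝ) • g) (fun ω hω => by
      have := hg ω hω
      simp only [BoundedContinuousFunction.coe_smul, smul_eq_mul]; positivity))
    rw [map_add, map_smul, smul_eq_mul] at this
    nlinarith
  have h1nn : 0 ≤ f 1 := hpos 1 (fun ω _ => by simp)
  have hu : 0 ≤ u := by
    by_contra hneg
    push Not at hneg
    set δ : ℝ := min 1 (-u / (f 1 + 1)) with hδ
    have hδ0 : 0 < δ := lt_min one_pos (div_pos (by linarith) (by linarith))
    have hδ1 : δ ≤ 1 := min_le_left _ _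
    have hδ2 : δ * (f 1 + 1) ≤ -u := by
      have := min_le_right 1 (-u / (f 1 + 1))
      rwa [le_div_iff₀ (by linarith)] at this
    have := hf1 ((-δ) • (1 : Z →ᵇ ℝ)) (by
      rw [Metric.mem_ball, dist_eq_norm]
      have : (-δ) • (1 : Z →ᵇ ℝ) - (-1) = (1 - δ) • 1 := by
        ext; simp; ring
      rw [this, norm_smul, Real.norm_eq_abs, abs_of_nonneg (by linarith)]
      have : ‖(1 : Z →ᵇ ℝ)‖ ≤ 1 := by
        rw [BoundedContinuousFunction.norm_le zero_le_one]; intro x; simp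
      nlinarith)
    rw [map_smul, smul_eq_mul] at this
    nlinarith
  have h1pos : 0 < f 1 := by
    rcases h1nn.eq_or_lt with h | h
    · exfalso
      have hzero : ∀ g, f g = 0 := by
        intro g
        have a1 := hpos (‖g‖ • 1 - g) (fun ω _ => by
          have := (abs_le.1 (g.norm_coe_le_norm (z ω))).2
          simp only [BoundedContinuousFunction.coe_sub, Pi.sub_apply,
            BoundedContinuousFunction.coe_smul, BoundedContinuousFunction.coe_one,
            Pi.one_apply, smul_eq_mul, mul_one]
          linarith)
        have a2 := hpos (‖g‖ • 1 + g) (fun ω _ => by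
          have := (abs_le.1 (g.norm_coe_le_norm (z ω))).1
          simp only [BoundedContinuousFunction.coe_add, Pi.add_apply,
            BoundedContinuousFunction.coe_smul, BoundedContinuousFunction.coe_one,
            Pi.one_apply, smul_eq_mul, mul_one]
          linarith)
        rw [map_sub, map_smul, ← h, smul_zero] at a1
        rw [map_add, map_smul, ← h, smul_zero] at a2
        linarith
      have a1 := hf1 (-1) (Metric.mem_ball_self one_pos)
      have a2 := hf2 _ (hc0S 0 (fun ω _ => by simp))
      rw [hzero] at a1 a2
      linarith
    · exact h
  have key : ∀ h ∈ H, ∀ X : Static n, X.price p < v → (f (Xt π hπ X)) / f 1 ≤ f h / f 1 := by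
    intro h hh X hX
    have := hf2 _ ⟨h, hh, X, hX, rfl⟩
    rw [map_sub] at this
    exact div_le_div_of_nonneg_right (by linarith) h1pos.le
  refine ⟨(f 1)⁻¹ • (f : (Z →ᵇ ℝ) →ₗ[ℝ] ℝ), ?_, ?_, ?_, ?_⟩
  · intro g hg
    simp only [LinearMap.smul_apply, smul_eq_mul, ContinuousLinearMap.coe_coe]
    exact mul_nonneg (inv_nonneg.2 h1nn) (hpos g hg)
  · simp only [LinearMap.smul_apply, smul_eq_mul, ContinuousLinearMap.coe_coe]
    exact inv_mul_cancel₀ h1pos.ne'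
  · intro X
    simp only [LinearMap.smul_apply, smul_eq_mul, ContinuousLinearMap.coe_coe]
    rw [inv_mul_eq_div]
    have k2 : ∀ s : ℝ, s * (f (Xt π hπ X) / f 1 - X.price p) + (v - 1) ≤ f (C • 1) / f 1 := by
      intro s
      have := key _ hh0 (Static.lin s 1 X (Static.cash n (v - 1 - s * X.price p))) (by
        rw [Static.lin_price, Static.cash_price]; linarith)
      rw [Xt_lin, Xt_cash, map_add, map_smul, map_smul, map_smul] at this
      simp only [smul_eq_mul] at this
      rw [one_mul, add_div, mul_div_assoc, mul_div_assoc, div_self h1pos.ne'] at this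
      linarith
    by_contra hne
    set d := f (Xt π hπ X) / f 1 - X.price p with hd
    have hd0 : d ≠ 0 := sub_ne_zero.2 hne
    have := k2 ((f (C • 1) / f 1 - (v - 1) + 1) / d)
    rw [div_mul_cancel₀ _ hd0] at this
    linarith
  · intro h D hD hh
    simp only [LinearMap.smul_apply, smul_eq_mul, ContinuousLinearMap.coe_coe]
    rw [inv_mul_eq_div]
    refine le_of_forall_lt fun w hw => ?_
    obtain ⟨w', h1, h2⟩ := exists_between hw
    have := key h ⟨D, hD, hh⟩ (Static.cash n w') (by rw [Static.cash_price]; exact h2)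
    rw [Xt_cash, map_smul, smul_eq_mul, mul_div_assoc, div_self h1pos.ne', mul_one] at this
    linarith
end FileE

section FileE2
open scoped BoundedContinuousFunction CompactlySupported

lemma riesz_of_tight {Z : Type*} [TopologicalSpace Z] [T2Space Z] [LocallyCompactSpace Z]
    [MeasurableSpace Z] [BorelSpace Z] (L : (Z →ᵇ ℝ) →ₗ[ℝ] ℝ)
    (hpos : ∀ f : Z →ᵇ ℝ, (∀ x, 0 ≤ f x) → 0 ≤ L f) (h1 : L 1 = 1)
    (θ : ℕ → Z →ᵇ ℝ) (hθc : ∀ m, HasCompactSupport (θ m)) (hθ0 : ∀ m x, 0 ≤ θ m x)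
    (hθ1 : ∀ m x, θ m x ≤ 1) (hθt : ∀ x, Tendsto (fun m => θ m x) atTop (𝓝 1))
    (hLθ : Tendsto (fun m => L (θ m)) atTop (𝓝 1)) :
    ∃ Q : Measure Z, IsProbabilityMeasure Q ∧ ∀ f : Z →ᵇ ℝ, ∫ x, f x ∂Q = L f := by
  let Λ0 : C_c(Z, ℝ) →ₗ[ℝ] ℝ :=
    { toFun := fun f => L f.toBoundedContinuousFunction
      map_add' := fun f g => by
        rw [← map_add]; congr 1
      map_smul' := fun c f => by
        rw [RingHom.id_apply, ← map_smul]; congr 1 }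
  let Λ : C_c(Z, ℝ) →ₚ[ℝ] ℝ := PositiveLinearMap.mk₀ Λ0 (fun f hf => hpos _ (fun x => hf x))
  set Q := RealRMK.rieszMeasure Λ with hQ
  have hInteg : ∀ f : Z →ᵇ ℝ, HasCompactSupport f → ∫ x, f x ∂Q = L f := by
    intro f hf
    have := RealRMK.integral_rieszMeasure Λ ⟨f.toContinuousMap, hf⟩
    refine this.trans ?_
    change L _ = L f
    congr 1
  have hmono : ∀ f g : Z →ᵇ ℝ, (∀ x, f x ≤ g x) → L f ≤ L g := by
    intro f g h
    have := hpos (g - f) (fun x => by simpa using h x)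
    rw [map_sub] at this; linarith
  have hθle : ∀ m, L (θ m) ≤ 1 := fun m => by
    rw [← h1]; exact hmono _ _ (fun x => by simpa using hθ1 m x)
  have hfin : IsFiniteMeasure Q := by
    constructor
    have e1 : ∀ x, ENNReal.ofReal 1 = liminf (fun m => ENNReal.ofReal (θ m x)) atTop := fun x =>
      ((ENNReal.continuous_ofReal.tendsto _).comp (hθt x)).liminf_eq.symm
    have e2 : Q univ = ∫⁻ x, liminf (fun m => ENNReal.ofReal (θ m x)) atTop ∂Q := by
      simp_rw [← e1]; simp
    rw [e2]
    refine (lintegral_liminf_le (fun m => ?_)).trans_lt ?_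
    · exact ((θ m).continuous.measurable).ennreal_ofReal
    · refine lt_of_le_of_lt ?_ ENNReal.one_lt_top
      have e3 : ∀ m, ∫⁻ x, ENNReal.ofReal (θ m x) ∂Q ≤ 1 := by
        intro m
        rw [← ofReal_integral_eq_lintegral_ofReal, hInteg _ (hθc m)]
        · exact ENNReal.ofReal_le_one.2 (hθle m)
        · exact (θ m).continuous.integrable_of_hasCompactSupport (hθc m)
        · exact Eventually.of_forall (hθ0 m)
      refine (liminf_le_liminf (Eventually.of_forall e3)).trans ?_
      simp
  have hall : ∀ f : Z →ᵇ ℝ, ∫ x, f x ∂Q = L f := by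
    intro f
    have hc : ∀ m, HasCompactSupport (f * θ m) := fun m => by
      rw [BoundedContinuousFunction.coe_mul]; exact (hθc m).mul_left
    have t1 : Tendsto (fun m => ∫ x, (f * θ m) x ∂Q) atTop (𝓝 (∫ x, f x ∂Q)) := by
      refine tendsto_integral_of_dominated_convergence (fun _ => ‖f‖)
        (fun m => (f * θ m).continuous.aestronglyMeasurable) (integrable_const _)
        (fun m => Eventually.of_forall fun x => ?_) (Eventually.of_forall fun x => ?_)
      · rw [BoundedContinuousFunction.mul_apply, norm_mul]
        have a1 := f.norm_coe_le_norm x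
        have a2 : ‖θ m x‖ ≤ 1 := by
          rw [Real.norm_eq_abs, abs_of_nonneg (hθ0 m x)]; exact hθ1 m x
        calc _ ≤ ‖f‖ * 1 := mul_le_mul a1 a2 (norm_nonneg _) (norm_nonneg _)
          _ = _ := mul_one _
      · simpa using (hθt x).const_mul (f x)
    have t2 : Tendsto (fun m => L (f * θ m)) atTop (𝓝 (L f)) := by
      have b1 : ∀ m, L f - ‖f‖ * (1 - L (θ m)) ≤ L (f * θ m) := by
        intro m
        have := hmono (f - ‖f‖ • (1 - θ m)) (f * θ m) (fun x => by
          have a1 := (abs_le.1 (f.norm_coe_le_norm x)).2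
          have := hθ1 m x
          simp only [BoundedContinuousFunction.coe_sub, Pi.sub_apply,
            BoundedContinuousFunction.coe_smul, BoundedContinuousFunction.coe_one,
            Pi.one_apply, smul_eq_mul, BoundedContinuousFunction.coe_mul, Pi.mul_apply]
          nlinarith)
        rwa [map_sub, map_smul, map_sub, h1, smul_eq_mul] at this
      have b2 : ∀ m, L (f * θ m) ≤ L f + ‖f‖ * (1 - L (θ m)) := by
        intro m
        have := hmono (f * θ m) (f + ‖f‖ • (1 - θ m)) (fun x => by
          have a1 := (abs_le.1 (f.norm_coe_le_norm x)).1
          have := hθ1 m x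
          simp only [BoundedContinuousFunction.coe_sub, Pi.sub_apply, BoundedContinuousFunction.coe_add,
            Pi.add_apply,
            BoundedContinuousFunction.coe_smul, BoundedContinuousFunction.coe_one,
            Pi.one_apply, smul_eq_mul, BoundedContinuousFunction.coe_mul, Pi.mul_apply]
          nlinarith)
        rwa [map_add, map_smul, map_sub, h1, smul_eq_mul] at this
      have t3 : Tendsto (fun m => ‖f‖ * (1 - L (θ m))) atTop (𝓝 0) := by
        simpa using (hLθ.const_sub 1).const_mul ‖f‖
      refine tendsto_of_tendsto_of_tendsto_of_le_of_le ?_ ?_ b1 b2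
      · simpa using t3.const_sub (L f)
      · simpa using t3.const_add (L f)
    refine tendsto_nhds_unique t1 ?_
    simp_rw [fun m => hInteg _ (hc m)]
    exact t2
  refine ⟨Q, ⟨?_⟩, hall⟩
  have := hall 1
  rw [h1] at this
  simp [Measure.real] at this
  rwa [ENNReal.toReal_eq_one_iff] at this

/-- A measure concentrated through continuous functions: closed set containing the graph. -/
lemma ae_mem_of_functional {Z : Type*} [TopologicalSpace Z] [TopologicalSpace.PseudoMetrizableSpace Z]
    [MeasurableSpace Z] [BorelSpace Z] (Q : Measure Z) [IsProbabilityMeasure Q]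
    (S T : Set Z) (hT : IsClosed T) (hST : S ⊆ T)
    (h : ∀ f : Z →ᵇ ℝ, (∀ x ∈ S, 0 ≤ f x) → 0 ≤ ∫ x, f x ∂Q) : ∀ᵐ x ∂Q, x ∈ T := by
  have key : ∀ m, ∫⁻ x, hT.apprSeq m x ∂Q = 1 := by
    intro m
    have hle : ∀ x, hT.apprSeq m x ≤ 1 := fun x => HasOuterApproxClosed.apprSeq_apply_le_one hT m x
    let f : Z →ᵇ ℝ := BoundedContinuousFunction.ofNormedAddCommGroup
      (fun x => ((hT.apprSeq m x : ℝ≥0) : ℝ) - 1)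
      ((NNReal.continuous_coe.comp (hT.apprSeq m).continuous).sub continuous_const) 1
      (fun x => by
        have h1 : ((hT.apprSeq m x : ℝ≥0) : ℝ) ≤ 1 := by exact_mod_cast hle x
        have h2 : 0 ≤ ((hT.apprSeq m x : ℝ≥0) : ℝ) := NNReal.coe_nonneg _
        rw [Real.norm_eq_abs, abs_le]; constructor <;> linarith)
    have h3 := h f (fun x hx => by
      change 0 ≤ ((hT.apprSeq m x : ℝ≥0) : ℝ) - 1
      rw [HasOuterApproxClosed.apprSeq_apply_eq_one hT m (hST hx)]; simp)
    have hi : Integrable (fun x => ((hT.apprSeq m x : ℝ≥0) : ℝ)) Q := by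
      refine Integrable.of_bound
        (NNReal.continuous_coe.comp (hT.apprSeq m).continuous).aestronglyMeasurable 1
        (Eventually.of_forall fun x => ?_)
      rw [Real.norm_eq_abs, abs_of_nonneg (NNReal.coe_nonneg _)]
      exact_mod_cast hle x
    have h4 : 1 ≤ ∫ x, ((hT.apprSeq m x : ℝ≥0) : ℝ) ∂Q := by
      have : ∫ x, f x ∂Q = ∫ x, (((hT.apprSeq m x : ℝ≥0) : ℝ) - 1) ∂Q := rfl
      rw [this, integral_sub hi (integrable_const _)] at h3
      simp at h3
      linarith
    refine le_antisymm ?_ ?_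
    · calc _ ≤ ∫⁻ x, 1 ∂Q := lintegral_mono fun x => ENNReal.coe_le_one_iff.2 (hle x)
        _ = 1 := by simp
    · have e : ∫⁻ x, hT.apprSeq m x ∂Q
          = ∫⁻ x, ENNReal.ofReal ((hT.apprSeq m x : ℝ≥0) : ℝ) ∂Q := by simp
      rw [e, ← ofReal_integral_eq_lintegral_ofReal hi (Eventually.of_forall fun x => NNReal.coe_nonneg _)]
      exact ENNReal.one_le_ofReal.2 h4
  have := HasOuterApproxClosed.tendsto_lintegral_apprSeq hT Q
  simp_rw [key] at this
  have hQT : Q T = 1 := tendsto_nhds_unique this tendsto_const_nhds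
  exact (prob_compl_eq_zero_iff hT.measurableSet).2 hQT

lemma approx_indicator {Z : Type*} [TopologicalSpace Z] [TopologicalSpace.PseudoMetrizableSpace Z]
    [MeasurableSpace Z] [BorelSpace Z] (Q : Measure Z) [IsFiniteMeasure Q]
    (A : Set Z) (hA : MeasurableSet A) :
    ∃ φ : ℕ → Z →ᵇ ℝ, (∀ m x, 0 ≤ φ m x ∧ φ m x ≤ 1) ∧
      ∀ᵐ x ∂Q, Tendsto (fun m => φ m x) atTop (𝓝 (A.indicator (fun _ => (1 : ℝ)) x)) := by
  have hL : MemLp (A.indicator (fun _ => (1 : ℝ))) 1 Q :=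
    memLp_indicator_const 1 hA 1 (Or.inr (measure_ne_top _ _))
  have hex : ∀ m : ℕ, ∃ g : Z →ᵇ ℝ,
      eLpNorm (A.indicator (fun _ => (1 : ℝ)) - (g : Z → ℝ)) 1 Q ≤ ((m : ℝ≥0∞) + 1)⁻¹ := fun m => by
    obtain ⟨g, hg, _⟩ := hL.exists_boundedContinuous_eLpNorm_sub_le ENNReal.one_ne_top
      (ε := ((m : ℝ≥0∞) + 1)⁻¹) (by simp)
    exact ⟨g, hg⟩
  choose g hg using hex
  have ht : Tendsto (fun m => eLpNorm ((g m : Z → ℝ) - A.indicator (fun _ => (1 : ℝ))) 1 Q) atTop (𝓝 0) := by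
    refine tendsto_of_tendsto_of_tendsto_of_le_of_le tendsto_const_nhds
      (?_ : Tendsto (fun m : ℕ => ((m : ℝ≥0∞) + 1)⁻¹) atTop (𝓝 0)) (fun _ => zero_le)
      (fun m => by rw [eLpNorm_sub_comm]; exact hg m)
    have := (tendsto_add_atTop_iff_nat (f := fun k : ℕ => ((k : ℝ≥0∞))⁻¹) 1).2
      ENNReal.tendsto_inv_nat_nhds_zero
    simpa using this
  have hm := tendstoInMeasure_of_tendsto_eLpNorm one_ne_zero
    (fun m => (g m).continuous.aestronglyMeasurable) hL.1 ht
  obtain ⟨ns, _, hns⟩ := hm.exists_seq_tendsto_ae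
  refine ⟨fun m => BoundedContinuousFunction.ofNormedAddCommGroup
    (fun x => max 0 (min 1 (g (ns m) x)))
    (continuous_const.max (continuous_const.min (g (ns m)).continuous)) 1 (fun x => ?_),
    fun m x => ⟨le_max_left _ _, max_le zero_le_one (min_le_left _ _)⟩, ?_⟩
  · rw [Real.norm_eq_abs, abs_of_nonneg (le_max_left _ _)]
    exact max_le zero_le_one (min_le_left _ _)
  · filter_upwards [hns] with x hx
    have hc : Continuous (fun t : ℝ => max 0 (min 1 t)) := by fun_prop
    have := (hc.tendsto _).comp hx
    have e : max 0 (min 1 (A.indicator (fun _ => (1 : ℝ)) x)) = A.indicator (fun _ => (1 : ℝ)) x := by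
      by_cases h : x ∈ A <;> simp [h]
    rw [e] at this
    exact this
end FileE2

section FileE3
open scoped BoundedContinuousFunction CompactlySupported

lemma put_abs_le (K x : ℝ) (hK : 0 ≤ K) (hx : 0 ≤ x) : ‖max (K - x) 0‖ ≤ K := by
  rw [Real.norm_eq_abs, abs_of_nonneg (le_max_right _ _)]
  exact max_le (by linarith) hK

lemma put_integrable (μ : Measure ℝ) [IsProbabilityMeasure μ] (hμ : μ (Set.Iio 0) = 0) (K : ℝ)
    (hK : 0 ≤ K) : Integrable (fun x => max (K - x) 0) μ := by
  have h0 : ∀ᵐ x ∂μ, 0 ≤ x := by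
    rw [ae_iff]; simpa [Set.Iio] using hμ
  refine Integrable.of_bound (by fun_prop) K ?_
  filter_upwards [h0] with x hx
  exact put_abs_le K x hK hx

lemma put_spread_tendsto (μ : Measure ℝ) [IsProbabilityMeasure μ] (hμ : μ (Set.Iio 0) = 0) :
    Tendsto (fun m : ℕ => (∫ x, max ((m : ℝ) + 1 - x) 0 ∂μ) - ∫ x, max ((m : ℝ) - x) 0 ∂μ)
      atTop (𝓝 1) := by
  have h0 : ∀ᵐ x ∂μ, 0 ≤ x := by
    rw [ae_iff]; simpa [Set.Iio] using hμ
  have e : ∀ m : ℕ, (∫ x, max ((m : ℝ) + 1 - x) 0 ∂μ) - ∫ x, max ((m : ℝ) - x) 0 ∂μ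
      = ∫ x, (max ((m : ℝ) + 1 - x) 0 - max ((m : ℝ) - x) 0) ∂μ := fun m =>
    (integral_sub (put_integrable μ hμ _ (by positivity)) (put_integrable μ hμ _ (by positivity))).symm
  simp_rw [e]
  have h1 : 𝓝 (1 : ℝ) = 𝓝 (∫ x, (1 : ℝ) ∂μ) := by simp
  refine le_of_le_of_eq (b := 𝓝 (∫ x, (1 : ℝ) ∂μ)) ?_ h1.symm
  refine tendsto_integral_of_dominated_convergence (fun _ => 1) (fun m => by fun_prop)
    (integrable_const _) (fun m => Eventually.of_forall fun x => ?_) (Eventually.of_forall fun x => ?_)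
  · rw [Real.norm_eq_abs, abs_le]
    rcases le_total ((m : ℝ) - x) 0 with h | h
    · rw [max_eq_right h]
      constructor
      · linarith [le_max_right ((m : ℝ) + 1 - x) 0]
      · rw [sub_zero]; exact max_le (by linarith) zero_le_one
    · rw [max_eq_left h, max_eq_left (by linarith)]; constructor <;> linarith
  · refine tendsto_const_nhds.congr' ?_
    obtain ⟨N, hN⟩ := exists_nat_gt x
    filter_upwards [eventually_ge_atTop N] with m hm
    have : (N : ℝ) ≤ m := by exact_mod_cast hm
    rw [max_eq_left (by linarith), max_eq_left (by linarith)]; ring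

lemma put_Iic_tendsto (μ : Measure ℝ) [IsProbabilityMeasure μ] (hμ : μ (Set.Iio 0) = 0) (a : ℝ)
    (ha : 0 ≤ a) :
    Tendsto (fun m : ℕ => ((m : ℝ) + 1) * ((∫ x, max (a + 1 / ((m : ℝ) + 1) - x) 0 ∂μ)
      - ∫ x, max (a - x) 0 ∂μ)) atTop (𝓝 (μ.real (Set.Iic a))) := by
  have hp : ∀ m : ℕ, (0 : ℝ) < (m : ℝ) + 1 := fun m => by positivity
  have e : ∀ m : ℕ, ((m : ℝ) + 1) * ((∫ x, max (a + 1 / ((m : ℝ) + 1) - x) 0 ∂μ)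
      - ∫ x, max (a - x) 0 ∂μ)
      = ∫ x, ((m : ℝ) + 1) * (max (a + 1 / ((m : ℝ) + 1) - x) 0 - max (a - x) 0) ∂μ := fun m => by
    rw [integral_const_mul, integral_sub (put_integrable μ hμ _ (by positivity))
      (put_integrable μ hμ _ ha)]
  simp_rw [e]
  have h1 : μ.real (Set.Iic a) = ∫ x, (Set.Iic a).indicator (fun _ => (1 : ℝ)) x ∂μ := by
    rw [integral_indicator measurableSet_Iic]; simp
  rw [h1]
  refine tendsto_integral_of_dominated_convergence (fun _ => 1) (fun m => by fun_prop)
    (integrable_const _) (fun m => Eventually.of_forall fun x => ?_) (Eventually.of_forall fun x => ?_)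
  · have h2 : (0 : ℝ) < 1 / ((m : ℝ) + 1) := by positivity
    have h3 : ((m : ℝ) + 1) * (1 / ((m : ℝ) + 1)) = 1 := by field_simp
    have h4 : 0 ≤ max (a + 1 / ((m : ℝ) + 1) - x) 0 - max (a - x) 0 := by
      have : max (a - x) 0 ≤ max (a + 1 / ((m : ℝ) + 1) - x) 0 := max_le_max (by linarith) le_rfl
      linarith
    have h5 : max (a + 1 / ((m : ℝ) + 1) - x) 0 - max (a - x) 0 ≤ 1 / ((m : ℝ) + 1) := by
      have : max (a + 1 / ((m : ℝ) + 1) - x) 0 ≤ max (a - x) 0 + 1 / ((m : ℝ) + 1) := by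
        refine max_le ?_ ?_
        · linarith [le_max_left (a - x) 0]
        · linarith [le_max_right (a - x) 0]
      linarith
    rw [Real.norm_eq_abs, abs_of_nonneg (mul_nonneg (hp m).le h4)]
    exact (mul_le_mul_of_nonneg_left h5 (hp m).le).trans_eq h3
  · by_cases hx : x ≤ a
    · refine tendsto_const_nhds.congr fun m => ?_
      have h2 : (0 : ℝ) < 1 / ((m : ℝ) + 1) := by positivity
      rw [Set.indicator_of_mem (by exact hx), max_eq_left (by linarith), max_eq_left (by linarith)]
      field_simp
      ring
    · rw [Set.indicator_of_notMem (by exact hx)]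
      refine tendsto_const_nhds.congr' ?_
      push Not at hx
      have := (tendsto_one_div_add_atTop_nhds_zero_nat (𝕜 := ℝ)).eventually_lt_const (sub_pos.2 hx)
      filter_upwards [this] with m hm
      rw [max_eq_right (by linarith), max_eq_right (by linarith)]; ring

lemma measure_eq_of_puts (μ ν : Measure ℝ) [IsProbabilityMeasure μ] [IsProbabilityMeasure ν]
    (hμ : μ (Set.Iio 0) = 0) (hν : ν (Set.Iio 0) = 0)
    (h : ∀ K, 0 ≤ K → ∫ x, max (K - x) 0 ∂μ = ∫ x, max (K - x) 0 ∂ν) : μ = ν := by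
  refine Measure.ext_of_Iic _ _ fun a => ?_
  by_cases ha : 0 ≤ a
  · have h1 := put_Iic_tendsto μ hμ a ha
    have h2 := put_Iic_tendsto ν hν a ha
    have h3 : μ.real (Set.Iic a) = ν.real (Set.Iic a) := by
      refine tendsto_nhds_unique h1 (h2.congr fun m => ?_)
      rw [h _ (by positivity), h _ ha]
    rwa [measureReal_eq_measureReal_iff] at h3
  · have : Set.Iic a ⊆ Set.Iio 0 := fun x hx => lt_of_le_of_lt hx (not_le.1 ha)
    rw [measure_mono_null this hμ, measure_mono_null this hν]

/-- A strategy trading only at time `j`. -/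
def Dyn.single {n : ℕ} (j : Fin n) (g : (Fin j → ℝ) → ℝ) (hg : Measurable g)
    (hb : ∃ C, ∀ x, |g x| ≤ C) : Dyn n where
  pos i x := if h : j = i then g (fun k => x ⟨k, by subst h; exact k.isLt⟩) else 0
  meas i := by
    by_cases h : j = i
    · subst h; simpa using hg
    · simp only [h, dif_neg, not_false_eq_true]; exact measurable_const
  bdd i := by
    by_cases h : j = i
    · subst h; simpa using hb
    · simp only [h, dif_neg, not_false_eq_true]; exact ⟨0, by simp⟩

lemma Dyn.single_nonneg {n : ℕ} (j : Fin n) (g : (Fin j → ℝ) → ℝ) (hg : Measurable g)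
    (hb : ∃ C, ∀ x, |g x| ≤ C) (h0 : ∀ x, 0 ≤ g x) : (Dyn.single j g hg hb).Nonneg := by
  intro i x
  unfold Dyn.single
  by_cases h : j = i
  · subst h; simpa using h0 x
  · simp [h]

lemma Dyn.single_gains {n : ℕ} (j : Fin n) (g : (Fin j → ℝ) → ℝ) (hg : Measurable g)
    (hb : ∃ C, ∀ x, |g x| ≤ C) (ω : Path n) :
    (Dyn.single j g hg hb).gains ω = g (restr j ω) * (ω j.succ - ω j.castSucc) := by
  unfold Dyn.gains
  rw [Finset.sum_eq_single j]
  · simp [Dyn.single]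
  · intro i _ hi
    simp [Dyn.single, hi.symm]
  · simp
end FileE3

section FileE4
open scoped BoundedContinuousFunction CompactlySupported

lemma ext_duality {n : ℕ} {Z : Type*} [TopologicalSpace Z] [T2Space Z] [LocallyCompactSpace Z]
    [TopologicalSpace.PseudoMetrizableSpace Z] [MeasurableSpace Z] [BorelSpace Z]
    (π : Z → Path n) (hπ : Continuous π) (hprop : ∀ R : ℝ, IsCompact (π ⁻¹' Metric.closedBall 0 R))
    (z : Path n → Z) (hz : ∀ ω, π (z ω) = ω) {s₀ : ℝ} {P : Set (Path n)}
    (hP : P ⊆ Omega n s₀) (μ : Fin n → Measure ℝ) (hprob : ∀ i, IsProbabilityMeasure (μ i))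
    (hsupp : ∀ i, μ i (Set.Iio 0) = 0) (hmom : ∀ i, Integrable (fun x => x) (μ i))
    (F : Path n → EReal) (v : ℝ)
    (hv : ∀ (X : Static n) (D : Dyn n), D.Nonneg →
      (∀ ω ∈ P, F ω ≤ ((X.putPayoff ω + D.gains ω : ℝ) : EReal)) →
        v ≤ X.price (fun i K' => ∫ x, max (K' - x) 0 ∂(μ i)))
    (C : ℝ) (D0 : Dyn n) (hD0 : D0.Nonneg) (hC : ∀ ω ∈ P, F ω ≤ ((C + D0.gains ω : ℝ) : EReal))
    (r : (j : Fin n) → (Fin j → ℝ) → Z) (hr : ∀ j, Measurable (r j))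
    (ρ : Fin n → Z → Z) (hρ : ∀ j, Continuous (ρ j))
    (hρz : ∀ j, ∀ ω ∈ P, ρ j (z ω) = r j (restr j ω))
    (hρj : ∀ j ζ, π (ρ j ζ) j.castSucc = π ζ j.castSucc) :
    ∃ Q : Measure Z, IsProbabilityMeasure Q ∧
      (∀ T : Set Z, IsClosed T → (∀ ω ∈ P, z ω ∈ T) → ∀ᵐ ζ ∂Q, ζ ∈ T) ∧
      (∀ i : Fin n, Q.map (fun ζ => π ζ i.succ) = μ i) ∧
      (∀ i, Integrable (fun ζ => π ζ i) Q) ∧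
      (∀ (h : Z →ᵇ ℝ) (D : Dyn n), D.Nonneg →
        (∀ ω ∈ P, F ω ≤ ((h (z ω) + D.gains ω : ℝ) : EReal)) → v ≤ ∫ ζ, h ζ ∂Q) ∧
      (∀ (j : Fin n) (A : Set Z), MeasurableSet A →
        ∫ ζ, A.indicator (fun _ => (1 : ℝ)) (ρ j ζ) * (π ζ j.succ - π ζ j.castSucc) ∂Q ≤ 0) := by
  set p : Fin n → ℝ → ℝ := fun i K' => ∫ x, max (K' - x) 0 ∂(μ i) with hp
  obtain ⟨L, hLpos, hL1, hLX, hLv⟩ := exists_functional π hπ z hz hP F p v hv ⟨C, D0, hD0, hC⟩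
  have hmonoP : ∀ f g : Z →ᵇ ℝ, (∀ ω ∈ P, f (z ω) ≤ g (z ω)) → L f ≤ L g := by
    intro f g h
    have := hLpos (g - f) (fun ω hω => by simpa using h ω hω)
    rw [map_sub] at this; linarith
  -- cutoffs
  have hcθ : ∀ m : ℕ, Continuous (fun ζ => max 0 (min 1 ((m : ℝ) + 2 - ‖π ζ‖))) := fun m => by
    fun_prop
  let θ : ℕ → Z →ᵇ ℝ := fun m => BoundedContinuousFunction.ofNormedAddCommGroup
    (fun ζ => max 0 (min 1 ((m : ℝ) + 2 - ‖π ζ‖))) (hcθ m) 1 (fun x => by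
      rw [Real.norm_eq_abs, abs_of_nonneg (le_max_left _ _)]
      exact max_le zero_le_one (min_le_left _ _))
  have hθa : ∀ m ζ, θ m ζ = max 0 (min 1 ((m : ℝ) + 2 - ‖π ζ‖)) := fun _ _ => rfl
  have hθ1 : ∀ m ζ, θ m ζ ≤ 1 := fun m ζ => max_le zero_le_one (min_le_left _ _)
  have hLθ : Tendsto (fun m => L (θ m)) atTop (𝓝 1) := by
    have hsp : ∀ i : Fin n, ∀ m : ℕ, ∃ f : Z →ᵇ ℝ, L f = p i ((m : ℝ) + 1) - p i m ∧
        ∀ ω ∈ P, f (z ω) = max ((m : ℝ) + 1 - ω i.succ) 0 - max ((m : ℝ) - ω i.succ) 0 := by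
      intro i m
      have h0 : (0 : ℝ) ≤ (m : ℝ) + 1 := by positivity
      have h1 : (0 : ℝ) ≤ (m : ℝ) := by positivity
      refine ⟨Xt π hπ (Static.lin 1 (-1) (Static.put i ((m : ℝ) + 1) h0) (Static.put i (m : ℝ) h1)),
        ?_, fun ω hω => ?_⟩
      · rw [hLX, Static.lin_price, Static.put_price, Static.put_price]; ring
      · rw [Xt_apply, Static.lin_putPayoff, Static.put_putPayoff, Static.put_putPayoff, hz,
          max_eq_left ((hP hω).2 i.succ)]
        ring
    choose f hf1 hf2 using hsp
    have lower : ∀ᶠ m : ℕ in atTop, 1 - ∑ i, (1 - L (f i m)) ≤ L (θ m) := by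
      obtain ⟨N, hN⟩ := exists_nat_gt |s₀|
      filter_upwards [eventually_ge_atTop N] with m hm
      have hmN : (N : ℝ) ≤ m := by exact_mod_cast hm
      have := hmonoP (1 - ∑ i, (1 - f i m)) (θ m) (fun ω hω => by
        have e1 : (1 - ∑ i, (1 - f i m)) (z ω) = 1 - ∑ i, (1 - f i m (z ω)) := by
          simp [BoundedContinuousFunction.coe_sub, BoundedContinuousFunction.coe_sum]
        rw [e1]
        have hnn : ∀ i, 0 ≤ 1 - f i m (z ω) := by
          intro i
          rw [hf2 i m ω hω]
          have : max ((m : ℝ) + 1 - ω i.succ) 0 ≤ max ((m : ℝ) - ω i.succ) 0 + 1 := by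
            refine max_le ?_ ?_
            · linarith [le_max_left ((m : ℝ) - ω i.succ) 0]
            · linarith [le_max_right ((m : ℝ) - ω i.succ) 0]
          linarith
        by_cases hb : ‖ω‖ ≤ (m : ℝ) + 1
        · rw [hθa, hz, min_eq_left (by linarith), max_eq_right zero_le_one]
          have := Finset.sum_nonneg fun i (_ : i ∈ Finset.univ) => hnn i
          linarith
        · push Not at hb
          have hex : ∃ i : Fin n, (m : ℝ) + 1 < ω i.succ := by
            by_contra hcon
            push Not at hcon
            refine absurd hb (not_lt.2 ((pi_norm_le_iff_of_nonneg (by positivity)).2 fun i => ?_))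
            rw [Real.norm_eq_abs]
            refine Fin.cases ?_ (fun i => ?_) i
            · rw [(hP hω).1]; linarith
            · rw [abs_of_nonneg ((hP hω).2 _)]; exact hcon i
          obtain ⟨i, hi⟩ := hex
          have h1 : 1 ≤ 1 - f i m (z ω) := by
            rw [hf2 i m ω hω, max_eq_right (by linarith), max_eq_right (by linarith)]; linarith
          have := Finset.single_le_sum (fun i (_ : i ∈ Finset.univ) => hnn i) (Finset.mem_univ i)
          have h2 : 0 ≤ θ m (z ω) := le_max_left _ _
          linarith)
      rw [map_sub, hL1, map_sum] at this
      simpa only [map_sub, hL1] using this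
    have hlim : Tendsto (fun m : ℕ => 1 - ∑ i, (1 - L (f i m))) atTop (𝓝 1) := by
      have : Tendsto (fun m : ℕ => 1 - ∑ i, (1 - L (f i m))) atTop (𝓝 (1 - ∑ i : Fin n, (1 - 1))) := by
        refine (tendsto_finset_sum _ fun i _ => ?_).const_sub 1
        refine Tendsto.const_sub 1 ?_
        simp_rw [hf1]
        haveI := hprob i
        exact put_spread_tendsto (μ i) (hsupp i)
      simpa using this
    refine tendsto_of_tendsto_of_tendsto_of_le_of_le' hlim tendsto_const_nhds lower
      (Eventually.of_forall fun m => ?_)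
    rw [← hL1]
    exact hmonoP _ _ fun ω _ => by simpa using hθ1 m (z ω)
  obtain ⟨Q, hQ, hQL⟩ := riesz_of_tight L (fun f hf => hLpos f fun ω _ => hf _) hL1 θ
    (fun m => by
      refine HasCompactSupport.intro (hprop ((m : ℝ) + 2)) fun ζ hζ => ?_
      rw [mem_preimage, mem_closedBall_zero_iff, not_le] at hζ
      rw [hθa, min_eq_right (by linarith), max_eq_left (by linarith)])
    (fun m ζ => le_max_left _ _) hθ1
    (fun ζ => by
      refine tendsto_const_nhds.congr' ?_
      obtain ⟨N, hN⟩ := exists_nat_gt ‖π ζ‖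
      filter_upwards [eventually_ge_atTop N] with m hm
      have hmN : (N : ℝ) ≤ m := by exact_mod_cast hm
      rw [hθa, min_eq_left (by linarith), max_eq_right zero_le_one]) hLθ
  have hclosed : ∀ T : Set Z, IsClosed T → (∀ ω ∈ P, z ω ∈ T) → ∀ᵐ ζ ∂Q, ζ ∈ T := by
    intro T hT hPT
    refine ae_mem_of_functional Q (z '' P) T hT (by rintro _ ⟨ω, hω, rfl⟩; exact hPT ω hω) ?_
    intro f hf
    rw [hQL]
    exact hLpos f fun ω hω => hf _ ⟨ω, hω, rfl⟩
  have hnonneg : ∀ i, ∀ᵐ ζ ∂Q, 0 ≤ π ζ i := fun i =>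
    hclosed {ζ | 0 ≤ π ζ i} (isClosed_le continuous_const ((continuous_apply i).comp hπ))
      fun ω hω => by simpa [hz] using (hP hω).2 i
  have hmeas : ∀ i, Measurable (fun ζ => π ζ i) := fun i => ((continuous_apply i).comp hπ).measurable
  have hmar : ∀ i : Fin n, Q.map (fun ζ => π ζ i.succ) = μ i := by
    intro i
    haveI := hprob i
    haveI := Measure.isProbabilityMeasure_map (μ := Q) (hmeas i.succ).aemeasurable
    refine measure_eq_of_puts _ _ ?_ (hsupp i) fun k hk => ?_
    · rw [Measure.map_apply (hmeas _) measurableSet_Iio]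
      have := hnonneg i.succ
      rw [ae_iff] at this
      simpa [Set.preimage] using this
    · rw [integral_map (hmeas _).aemeasurable (by fun_prop)]
      have := hLX (Static.put i k hk)
      rw [← hQL, Static.put_price] at this
      rw [← show p i k = ∫ x, max (k - x) 0 ∂(μ i) from rfl, ← this]
      refine integral_congr_ae ?_
      filter_upwards [hnonneg i.succ] with ζ hζ
      rw [Xt_apply, Static.put_putPayoff, max_eq_left hζ]
  have hInteg : ∀ i, Integrable (fun ζ => π ζ i) Q := by
    intro i
    refine Fin.cases ?_ (fun i => ?_) i
    · have : ∀ᵐ ζ ∂Q, π ζ 0 = s₀ :=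
        hclosed {ζ | π ζ 0 = s₀} (isClosed_eq ((continuous_apply 0).comp hπ) continuous_const)
          fun ω hω => by simpa [hz] using (hP hω).1
      exact (integrable_const s₀).congr (this.mono fun ζ hζ => hζ.symm)
    · have := hmom i
      rw [← hmar i] at this
      exact (integrable_map_measure (by fun_prop) (hmeas _).aemeasurable).1 this
  have hvQ : ∀ (h : Z →ᵇ ℝ) (D : Dyn n), D.Nonneg →
        (∀ ω ∈ P, F ω ≤ ((h (z ω) + D.gains ω : ℝ) : EReal)) → v ≤ ∫ ζ, h ζ ∂Q := by
    intro h D hD hh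
    rw [hQL]; exact hLv h D hD hh
  refine ⟨Q, hQ, hclosed, hmar, hInteg, hvQ, ?_⟩
  -- supermartingale property
  have hcont : ∀ (j : Fin n) (φ : Z →ᵇ ℝ), (∀ x, 0 ≤ φ x ∧ φ x ≤ 1) →
      ∫ ζ, φ (ρ j ζ) * (π ζ j.succ - π ζ j.castSucc) ∂Q ≤ 0 := by
    intro j φ hφ
    let cut : ℕ → ℝ → ℝ := fun m a => max 0 (min 1 ((m : ℝ) + 1 - |a|))
    have hcut0 : ∀ m a, 0 ≤ cut m a := fun m a => le_max_left _ _
    have hcut1 : ∀ m a, cut m a ≤ 1 := fun m a => max_le zero_le_one (min_le_left _ _)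
    have hcutc : ∀ m, Continuous (cut m) := fun m => by fun_prop
    have hcutb : ∀ m a, |cut m a * a| ≤ (m : ℝ) + 1 := by
      intro m a
      rw [abs_mul, abs_of_nonneg (hcut0 m a)]
      by_cases h : |a| ≤ (m : ℝ) + 1
      · calc _ ≤ 1 * |a| := mul_le_mul_of_nonneg_right (hcut1 m a) (abs_nonneg _)
          _ ≤ _ := by linarith
      · push Not at h
        have : cut m a = 0 := by
          simp only [cut]; rw [min_eq_right (by linarith), max_eq_left (by linarith)]
        rw [this, zero_mul]; positivity
    let clip : ℕ → ℝ → ℝ := fun m x => max 0 (min x m)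
    have hclipc : ∀ m, Continuous (clip m) := fun m => by fun_prop
    have hclip0 : ∀ m x, 0 ≤ clip m x := fun m x => le_max_left _ _
    have hclip1 : ∀ m x, clip m x ≤ m := fun m x => max_le (by positivity) (min_le_right _ _)
    have hclip2 : ∀ m x, clip m x ≤ |x| := fun m x =>
      max_le (abs_nonneg _) ((min_le_left _ _).trans (le_abs_self _))
    let g : ℕ → Z → ℝ := fun m ζ => φ (ρ j ζ) * cut m (π ζ j.castSucc) *
      (clip m (π ζ j.succ) - π ζ j.castSucc)
    have hπc : ∀ i, Continuous (fun ζ => π ζ i) := fun i => (continuous_apply i).comp hπ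
    have hgc : ∀ m, Continuous (g m) := fun m =>
      (((φ.continuous.comp (hρ j)).mul ((hcutc m).comp (hπc _))).mul
        (((hclipc m).comp (hπc _)).sub (hπc _)))
    have hgb : ∀ m ζ, ‖g m ζ‖ ≤ (m : ℝ) + ((m : ℝ) + 1) := by
      intro m ζ
      have e : g m ζ = φ (ρ j ζ) * (cut m (π ζ j.castSucc) * clip m (π ζ j.succ)
        - cut m (π ζ j.castSucc) * π ζ j.castSucc) := by simp only [g]; ring
      rw [e, Real.norm_eq_abs, abs_mul, abs_of_nonneg (hφ _).1]
      have h1 : |cut m (π ζ j.castSucc) * clip m (π ζ j.succ)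
        - cut m (π ζ j.castSucc) * π ζ j.castSucc| ≤ (m : ℝ) + ((m : ℝ) + 1) := by
        refine (abs_sub _ _).trans (add_le_add ?_ (hcutb m _))
        rw [abs_of_nonneg (mul_nonneg (hcut0 _ _) (hclip0 _ _))]
        calc _ ≤ 1 * (m : ℝ) := mul_le_mul (hcut1 _ _) (hclip1 _ _) (hclip0 _ _) zero_le_one
          _ = _ := one_mul _
      calc _ ≤ 1 * ((m : ℝ) + ((m : ℝ) + 1)) :=
            mul_le_mul (hφ _).2 h1 (abs_nonneg _) zero_le_one
        _ = _ := one_mul _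
    have hgle : ∀ m, ∫ ζ, g m ζ ∂Q ≤ 0 := by
      intro m
      let gb : Z →ᵇ ℝ := BoundedContinuousFunction.ofNormedAddCommGroup (g m) (hgc m) _ (hgb m)
      have hmr : Measurable (fun x : Fin j → ℝ => φ (r j x) * cut m (π (r j x) j.castSucc)) :=
        ((φ.continuous.measurable.comp (hr j)).mul
          ((hcutc m).measurable.comp ((hmeas _).comp (hr j))))
      have hnn : ∀ x : Fin j → ℝ, 0 ≤ φ (r j x) * cut m (π (r j x) j.castSucc) := fun x =>
        mul_nonneg (hφ _).1 (hcut0 _ _)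
      have hbd : ∃ C, ∀ x : Fin j → ℝ, |φ (r j x) * cut m (π (r j x) j.castSucc)| ≤ C := by
        refine ⟨1, fun x => ?_⟩
        rw [abs_of_nonneg (hnn x)]
        exact mul_le_one₀ (hφ _).2 (hcut0 _ _) (hcut1 _ _)
      set E := Dyn.single j _ hmr hbd with hE
      have hEn : E.Nonneg := Dyn.single_nonneg j _ hmr hbd hnn
      have hN : ∀ N : ℕ, v ≤ C - N * ∫ ζ, g m ζ ∂Q := by
        intro N
        have := hvQ (C • 1 - (N : ℝ) • gb) (Dyn.lin 1 N D0 E)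
          (Dyn.lin_nonneg zero_le_one (by positivity) hD0 hEn) (fun ω hω => (hC ω hω).trans ?_)
        · have e : ∀ ζ, (C • (1 : Z →ᵇ ℝ) - (N : ℝ) • gb) ζ = C - N * g m ζ := by
            intro ζ; simp [gb]
          simp_rw [e] at this
          have hgi : Integrable (g m) Q := gb.integrable Q
          rw [integral_sub (integrable_const _) (hgi.const_mul _), integral_const_mul] at this
          simpa using this
        · rw [EReal.coe_le_coe_iff, Dyn.lin_gains, Dyn.single_gains]
          have e : (C • (1 : Z →ᵇ ℝ) - (N : ℝ) • gb) (z ω) = C - N * g m (z ω) := by simp [gb]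
          have hle : g m (z ω) ≤ φ (r j (restr j ω)) * cut m (π (r j (restr j ω)) j.castSucc) *
              (ω j.succ - ω j.castSucc) := by
            have e2 : g m (z ω) = φ (r j (restr j ω)) * cut m (π (r j (restr j ω)) j.castSucc) *
              (clip m (ω j.succ) - ω j.castSucc) := by
              simp only [g]
              rw [← hρj j (z ω), hρz j ω hω, ← hρz j ω hω, hρj, hz]
            rw [e2]
            refine mul_le_mul_of_nonneg_left ?_ (hnn _)
            have := hclip2 m (ω j.succ)
            rw [abs_of_nonneg ((hP hω).2 _)] at this
            linarith
          have := mul_le_mul_of_nonneg_left hle (Nat.cast_nonneg (α := ℝ) N)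
          rw [e]
          linarith
      by_contra hcon
      push Not at hcon
      obtain ⟨N, hN'⟩ := exists_nat_gt ((C - v) / ∫ ζ, g m ζ ∂Q)
      rw [div_lt_iff₀ hcon] at hN'
      linarith [hN N]
    have hlim : Tendsto (fun m => ∫ ζ, g m ζ ∂Q) atTop
        (𝓝 (∫ ζ, φ (ρ j ζ) * (π ζ j.succ - π ζ j.castSucc) ∂Q)) := by
      refine tendsto_integral_of_dominated_convergence (fun ζ => |π ζ j.succ| + |π ζ j.castSucc|)
        (fun m => (hgc m).aestronglyMeasurable) ((hInteg _).abs.add (hInteg _).abs)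
        (fun m => Eventually.of_forall fun ζ => ?_) ?_
      · simp only [g]
        rw [Real.norm_eq_abs, abs_mul, abs_of_nonneg (mul_nonneg (hφ _).1 (hcut0 _ _))]
        have h1 : |clip m (π ζ j.succ) - π ζ j.castSucc| ≤ |π ζ j.succ| + |π ζ j.castSucc| := by
          refine (abs_sub _ _).trans (add_le_add ?_ le_rfl)
          rw [abs_of_nonneg (hclip0 _ _)]; exact hclip2 _ _
        calc _ ≤ 1 * (|π ζ j.succ| + |π ζ j.castSucc|) :=
              mul_le_mul (mul_le_one₀ (hφ _).2 (hcut0 _ _) (hcut1 _ _)) h1 (abs_nonneg _) zero_le_one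
          _ = _ := one_mul _
      · filter_upwards [hnonneg j.succ] with ζ hζ
        refine tendsto_const_nhds.congr' ?_
        obtain ⟨N, hN⟩ := exists_nat_gt (|π ζ j.succ| + |π ζ j.castSucc|)
        filter_upwards [eventually_ge_atTop N] with m hm
        have hmN : (N : ℝ) ≤ m := by exact_mod_cast hm
        have a1 := abs_nonneg (π ζ j.succ)
        have a2 := abs_nonneg (π ζ j.castSucc)
        have a3 := le_abs_self (π ζ j.succ)
        simp only [g, cut, clip]
        rw [min_eq_left (by linarith), min_eq_left (by linarith), max_eq_right zero_le_one,
          max_eq_right hζ, mul_one]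
    exact le_of_tendsto' hlim hgle
  intro j A hA
  haveI : IsFiniteMeasure (Q.map (ρ j)) := by infer_instance
  obtain ⟨φ, hφ, hφt⟩ := approx_indicator (Q.map (ρ j)) A hA
  have hφt' := ae_of_ae_map (hρ j).measurable.aemeasurable hφt
  have hlim : Tendsto (fun m => ∫ ζ, φ m (ρ j ζ) * (π ζ j.succ - π ζ j.castSucc) ∂Q) atTop
      (𝓝 (∫ ζ, A.indicator (fun _ => (1 : ℝ)) (ρ j ζ) * (π ζ j.succ - π ζ j.castSucc) ∂Q)) := by
    refine tendsto_integral_of_dominated_convergence (fun ζ => |π ζ j.succ - π ζ j.castSucc|)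
      (fun m => ?_) ((hInteg _).sub (hInteg _)).abs (fun m => Eventually.of_forall fun ζ => ?_) ?_
    · exact (((φ m).continuous.comp (hρ j)).measurable.mul ((hmeas _).sub (hmeas _))).aestronglyMeasurable
    · rw [norm_mul, Real.norm_eq_abs, Real.norm_eq_abs, abs_of_nonneg (hφ _ _).1]
      exact mul_le_of_le_one_left (abs_nonneg _) (hφ _ _).2
    · filter_upwards [hφt'] with ζ hζ
      exact hζ.mul_const _
  exact le_of_tendsto' hlim fun m => hcont j (φ m) (hφ m)
end FileE4

section FileF
open scoped BoundedContinuousFunction CompactlySupported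

lemma ext_mem {n : ℕ} {Z : Type*} [TopologicalSpace Z]  [MeasurableSpace Z] [BorelSpace Z]
    (π : Z → Path n) (hπ : Continuous π) (z : Path n → Z) (hz : ∀ ω, π (z ω) = ω) {s₀ : ℝ}
    {P : Set (Path n)} (hP : P ⊆ Omega n s₀) (hPc : IsClosed P) (μ : Fin n → Measure ℝ)
    (ρ : Fin n → Z → Z) (hρr : ∀ j ζ, restr j (π (ρ j ζ)) = restr j (π ζ))
    (Q : Measure Z) [IsProbabilityMeasure Q]
    (hcl : ∀ T : Set Z, IsClosed T → (∀ ω ∈ P, z ω ∈ T) → ∀ᵐ ζ ∂Q, ζ ∈ T)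
    (hmar : ∀ i : Fin n, Q.map (fun ζ => π ζ i.succ) = μ i)
    (hsup : ∀ (j : Fin n) (A : Set Z), MeasurableSet A →
        ∫ ζ, A.indicator (fun _ => (1 : ℝ)) (ρ j ζ) * (π ζ j.succ - π ζ j.castSucc) ∂Q ≤ 0) :
    Q.map π ∈ MSetP s₀ μ P := by
  have hprob : IsProbabilityMeasure (Q.map π) :=
    Measure.isProbabilityMeasure_map hπ.measurable.aemeasurable
  have hone : ∀ T : Set (Path n), IsClosed T → P ⊆ T → Q.map π T = 1 := by
    intro T hT hPT
    rw [Measure.map_apply hπ.measurable hT.measurableSet]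
    have h := hcl (π ⁻¹' T) (hT.preimage hπ) (fun ω hω => by
      rw [mem_preimage, hz]; exact hPT hω)
    exact (prob_compl_eq_zero_iff (hT.preimage hπ).measurableSet).1 h
  refine ⟨⟨⟨hprob, hone _ (isClosed_Omega n s₀) hP, fun i => ?_⟩, fun j A hA => ?_⟩,
    hone P hPc subset_rfl⟩
  · rw [Measure.map_map (measurable_pi_apply _) hπ.measurable]
    exact hmar i
  · rw [integral_map hπ.measurable.aemeasurable]
    · have := hsup j ((fun ζ => restr j (π ζ)) ⁻¹' A)
        (((measurable_restr j).comp hπ.measurable) hA)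
      refine le_of_eq_of_le ?_ this
      refine integral_congr_ae (Eventually.of_forall fun ζ => ?_)
      simp only [Set.indicator, mem_preimage, hρr]
    · refine Measurable.aestronglyMeasurable ?_
      exact ((measurable_const.indicator hA).comp (measurable_restr j)).mul
        ((measurable_pi_apply _).sub (measurable_pi_apply _))

lemma usc_approx {X : Type*} [PseudoMetricSpace X] [Nonempty X] (P : Set X) (f : X → EReal)
    (husc : UpperSemicontinuousOn f P) (C : ℝ) (hC0 : 0 ≤ C) (hC : ∀ x ∈ P, f x ≤ (C : EReal)) :
    ∃ h : ℕ → X →ᵇ ℝ, (∀ r, ∀ x ∈ P, f x ≤ ((h r x : ℝ) : EReal)) ∧ (∀ r x, h r x ≤ C) ∧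
      ∀ x ∈ P, Tendsto (fun r => ((h r x : ℝ) : EReal)) atTop (𝓝 (f x)) := by
  let g : ℕ → X → ℝ := fun r y => if y ∈ P then (max (f y) ((-(r : ℝ) : ℝ) : EReal)).toReal else -r
  have hgc : ∀ r : ℕ, ∀ y ∈ P, ((g r y : ℝ) : EReal) = max (f y) ((-(r : ℝ) : ℝ) : EReal) := by
    intro r y hy
    simp only [g, hy, if_true]
    refine EReal.coe_toReal ?_ ?_
    · refine (lt_of_le_of_lt (max_le (hC y hy) ?_) (EReal.coe_lt_top C)).ne
      rw [EReal.coe_le_coe_iff]; have : (0 : ℝ) ≤ r := by positivity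
      linarith
    · exact (lt_of_lt_of_le (EReal.bot_lt_coe _) (le_max_right _ _)).ne'
  have hg1 : ∀ (r : ℕ) (y : X), -(r : ℝ) ≤ g r y := by
    intro r y
    by_cases hy : y ∈ P
    · rw [← EReal.coe_le_coe_iff, hgc r y hy]; exact le_max_right _ _
    · simp [g, hy]
  have hg2 : ∀ r y, g r y ≤ C := by
    intro r y
    have hr : (0 : ℝ) ≤ r := by positivity
    by_cases hy : y ∈ P
    · rw [← EReal.coe_le_coe_iff, hgc r y hy]; refine max_le (hC y hy) ?_
      rw [EReal.coe_le_coe_iff]; linarith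
    · simp only [g, hy, if_false]; linarith
  let h : ℕ → X → ℝ := fun r x => ⨆ y, (g r y - r * dist x y)
  have hbdd : ∀ r x, BddAbove (range fun y => g r y - r * dist x y) := by
    intro r x
    refine ⟨C, ?_⟩
    rintro _ ⟨y, rfl⟩
    have : 0 ≤ (r : ℝ) * dist x y := by positivity
    simp only; linarith [hg2 r y]
  have hge : ∀ r x, g r x ≤ h r x := by
    intro r x
    have := le_ciSup (hbdd r x) x
    simpa using this
  have hle : ∀ r x, h r x ≤ C := by
    intro r x
    refine ciSup_le fun y => ?_
    have : 0 ≤ (r : ℝ) * dist x y := by positivity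
    linarith [hg2 r y]
  have hlip : ∀ r : ℕ, LipschitzWith r (h r) := by
    intro r
    refine LipschitzWith.of_le_add_mul r fun x x' => ?_
    refine ciSup_le fun y => ?_
    have h1 := le_ciSup (hbdd r x') y
    have h2 : dist x' y ≤ dist x x' + dist x y := by rw [dist_comm x x']; exact dist_triangle _ _ _
    have h3 := mul_le_mul_of_nonneg_left h2 (Nat.cast_nonneg (α := ℝ) r)
    have h4 : g r y - r * dist x' y ≤ h r x' := h1
    push_cast
    linarith
  refine ⟨fun r => BoundedContinuousFunction.ofNormedAddCommGroup (h r) (hlip r).continuous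
    (max C r) (fun x => ?_), ?_, hle, ?_⟩
  · rw [Real.norm_eq_abs, abs_le]
    constructor
    · have := le_max_right C (r : ℝ); linarith [hg1 r x, hge r x]
    · exact (hle r x).trans (le_max_left _ _)
  · intro r x hx
    change f x ≤ ((h r x : ℝ) : EReal)
    refine le_trans ?_ (EReal.coe_le_coe_iff.2 (hge r x))
    rw [hgc r x hx]; exact le_max_left _ _
  · intro x hx
    change Tendsto (fun r => ((h r x : ℝ) : EReal)) atTop (𝓝 (f x))
    have hfh : ∀ r, f x ≤ ((h r x : ℝ) : EReal) := by
      intro r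
      refine le_trans ?_ (EReal.coe_le_coe_iff.2 (hge r x))
      rw [hgc r x hx]; exact le_max_left _ _
    refine tendsto_order.2 ⟨fun a ha => Eventually.of_forall fun r => ha.trans_le (hfh r), fun a ha => ?_⟩
    obtain ⟨b, hb1, hb2⟩ := EReal.lt_iff_exists_real_btwn.1 ha
    have := husc x hx _ hb1
    obtain ⟨δ, hδ, hball⟩ := Metric.mem_nhdsWithin_iff.1 this
    obtain ⟨N, hN⟩ := exists_nat_gt (max (-b) ((C - b) / δ))
    filter_upwards [eventually_ge_atTop N] with r hr
    have hrN : (N : ℝ) ≤ r := by exact_mod_cast hr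
    have hr1 : -b < r := lt_of_lt_of_le ((le_max_left _ _).trans_lt hN) hrN
    have hr2 : C - b < r * δ := by
      rw [← div_lt_iff₀ hδ]; exact lt_of_lt_of_le ((le_max_right _ _).trans_lt hN) hrN
    refine lt_of_le_of_lt (EReal.coe_le_coe_iff.2 (ciSup_le fun y => ?_)) hb2
    have h0 : 0 ≤ (r : ℝ) * dist x y := by positivity
    by_cases hy : y ∈ P
    · by_cases hd : dist y x < δ
      · have h1 : f y < b := hball ⟨Metric.mem_ball.2 hd, hy⟩
        have h2 : g r y ≤ b := by
          rw [← EReal.coe_le_coe_iff, hgc r y hy]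
          refine max_le h1.le ?_
          rw [EReal.coe_le_coe_iff]; linarith
        linarith
      · push Not at hd
        rw [dist_comm] at hd
        have h3 := mul_le_mul_of_nonneg_left hd (Nat.cast_nonneg (α := ℝ) r)
        linarith [hg2 r y]
    · have h2 : g r y = -r := by simp [g, hy]
      linarith
end FileF

section FileG
section Select
variable {n : ℕ}

lemma sc_of_closed {X : Type*} [TopologicalSpace X] [SigmaCompactSpace X] {S : Set X}
    (h : IsClosed S) : IsSigmaCompact S :=
  isSigmaCompact_univ.of_isClosed_subset h (subset_univ _)

lemma sc_inter {X : Type*} [TopologicalSpace X] [T2Space X] {S T : Set X}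
    (hS : IsSigmaCompact S) (hT : IsSigmaCompact T) : IsSigmaCompact (S ∩ T) := by
  obtain ⟨K, hK, rfl⟩ := hS
  obtain ⟨L, hL, rfl⟩ := hT
  rw [iUnion_inter]
  refine isSigmaCompact_iUnion _ fun i => ?_
  rw [inter_iUnion]
  exact isSigmaCompact_iUnion _ fun j => ((hK i).inter (hL j)).isSigmaCompact

lemma sc_union {X : Type*} [TopologicalSpace X] {S T : Set X}
    (hS : IsSigmaCompact S) (hT : IsSigmaCompact T) : IsSigmaCompact (S ∪ T) := by
  rw [union_eq_iUnion]
  exact isSigmaCompact_iUnion _ fun b => by cases b <;> assumption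

lemma sc_preimage {X Y : Type*} [TopologicalSpace X] [SigmaCompactSpace X] [TopologicalSpace Y]
    [T2Space Y] {f : X → Y} (hf : Continuous f) {S : Set Y} (hS : IsSigmaCompact S) :
    IsSigmaCompact (f ⁻¹' S) := by
  obtain ⟨K, hK, rfl⟩ := hS
  rw [preimage_iUnion]
  exact isSigmaCompact_iUnion _ fun i => sc_of_closed ((hK i).isClosed.preimage hf)

lemma sc_measurable {X : Type*} [TopologicalSpace X] [T2Space X] [MeasurableSpace X] [BorelSpace X]
    {S : Set X} (hS : IsSigmaCompact S) : MeasurableSet S := by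
  obtain ⟨K, hK, rfl⟩ := hS
  exact MeasurableSet.iUnion fun i => (hK i).measurableSet

/-- Replace the coordinate with index `m`. -/
def updN (ω : Path n) (m : ℕ) (x : ℝ) : Path n := fun i => if (i : ℕ) = m then x else ω i

lemma continuous_updN (m : ℕ) : Continuous (fun q : Path n × ℝ => updN q.1 m q.2) := by
  refine continuous_pi fun i => ?_
  unfold updN
  by_cases h : (i : ℕ) = m
  · simp only [h, if_true]; exact continuous_snd
  · simp only [h, if_false]; exact (continuous_apply i).comp continuous_fst

lemma continuous_seqP (m : ℕ) : Continuous (fun ω : Path n => seqP ω m) := by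
  unfold seqP
  by_cases h : m < n + 1
  · simp only [h, dif_pos]; exact continuous_apply _
  · simp only [h, dif_neg, not_false_eq_true]; exact continuous_const

def mvT (j : ℕ) (p : Path n × ℝ) (b x : ℝ) : Path n × ℝ :=
  (updN p.1 (j + 1) x, p.2 + b * (x - seqP p.1 j))

lemma continuous_mvT {X : Type*} [TopologicalSpace X] (j : ℕ) {p : X → Path n × ℝ} {b x : X → ℝ}
    (hp : Continuous p) (hb : Continuous b) (hx : Continuous x) :
    Continuous (fun t => mvT j (p t) (b t) (x t)) := by
  unfold mvT
  refine Continuous.prodMk ?_ ?_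
  · exact (continuous_updN (n := n) (j + 1)).comp
      (Continuous.prodMk (continuous_fst.comp hp) hx)
  · exact (continuous_snd.comp hp).add (hb.mul (hx.sub ((continuous_seqP j).comp (continuous_fst.comp hp))))

def stepU (C : ℝ) (j : ℕ) (U : Set (Path n × ℝ)) : Set (Path n × ℝ) :=
  {p | (∃ x₁ x₂ b : ℝ, seqP p.1 j ≤ x₁ ∧ x₂ ≤ seqP p.1 j ∧ b ∈ Icc 0 C ∧
      mvT j p b x₁ ∈ U ∧ mvT j p b x₂ ∈ U) ∨
    (∃ x, seqP p.1 j ≤ x ∧ mvT j p C x ∈ U) ∨ ∃ x, x ≤ seqP p.1 j ∧ mvT j p 0 x ∈ U}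

def bstar (C : ℝ) (j : ℕ) (U : Set (Path n × ℝ)) (p : Path n × ℝ) : ℝ :=
  sInf {b | 0 ≤ b ∧ b ≤ C ∧ (b = C ∨ ∀ x, seqP p.1 j ≤ x → mvT j p b x ∉ U)}

def LowU (U : Set (Path n × ℝ)) : Prop := ∀ ω w w', (ω, w) ∈ U → w' ≤ w → (ω, w') ∈ U
def OpenU (U : Set (Path n × ℝ)) : Prop := ∀ ω w, (ω, w) ∈ U → ∃ w' > w, (ω, w') ∈ U

variable {C : ℝ} {j : ℕ} {U : Set (Path n × ℝ)}

lemma mvT_low (hl : LowU U) {p : Path n × ℝ} {b x b' : ℝ} (h : mvT j p b x ∈ U)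
    (hle : b' * (x - seqP p.1 j) ≤ b * (x - seqP p.1 j)) : mvT j p b' x ∈ U :=
  hl _ _ _ h (by linarith)

lemma mvT_shift (ho : OpenU U) {p : Path n × ℝ} {b x : ℝ} (h : mvT j p b x ∈ U) :
    ∃ w' > p.2, ∀ (hl : LowU U), ∀ w ≤ w', mvT j (p.1, w) b x ∈ U := by
  obtain ⟨w', h1, h2⟩ := ho _ _ h
  refine ⟨p.2 + (w' - (p.2 + b * (x - seqP p.1 j))), by linarith, fun hl w hw => ?_⟩
  exact hl _ _ _ h2 (by simp only; linarith)

lemma mvT_b (hl : LowU U) (ho : OpenU U) {p : Path n × ℝ} {b x : ℝ} (h : mvT j p b x ∈ U) :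
    ∃ ε > 0, ∀ b', |b' - b| ≤ ε → mvT j p b' x ∈ U := by
  obtain ⟨w', h1, h2⟩ := ho _ _ h
  set d := x - seqP p.1 j with hd
  refine ⟨(w' - (p.2 + b * d)) / (|d| + 1), div_pos (by linarith) (by positivity), fun b' hb' => ?_⟩
  refine hl _ _ _ h2 ?_
  rw [le_div_iff₀ (by positivity)] at hb'
  have h3 : (b' - b) * d ≤ |b' - b| * |d| := by rw [← abs_mul]; exact le_abs_self _
  have h4 := abs_nonneg (b' - b)
  simp only [← hd]
  nlinarith

lemma stepU_low (hl : LowU U) : LowU (stepU C j U) := by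
  rintro ω w w' h hle
  have key : ∀ b x, mvT j (ω, w) b x ∈ U → mvT j (ω, w') b x ∈ U := fun b x h =>
    hl _ _ _ h (by simp only; linarith)
  rcases h with ⟨x₁, x₂, b, h1, h2, h3, h4, h5⟩ | ⟨x, h1, h2⟩ | ⟨x, h1, h2⟩
  · exact Or.inl ⟨x₁, x₂, b, h1, h2, h3, key _ _ h4, key _ _ h5⟩
  · exact Or.inr (Or.inl ⟨x, h1, key _ _ h2⟩)
  · exact Or.inr (Or.inr ⟨x, h1, key _ _ h2⟩)

lemma stepU_open (hl : LowU U) (ho : OpenU U) : OpenU (stepU C j U) := by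
  rintro ω w (⟨x₁, x₂, b, h1, h2, h3, h4, h5⟩ | ⟨x, h1, h2⟩ | ⟨x, h1, h2⟩)
  · obtain ⟨w₁, e1, e2⟩ := mvT_shift ho h4
    obtain ⟨w₂, e3, e4⟩ := mvT_shift ho h5
    exact ⟨min w₁ w₂, lt_min e1 e3, Or.inl ⟨x₁, x₂, b, h1, h2, h3, e2 hl _ (min_le_left _ _),
      e4 hl _ (min_le_right _ _)⟩⟩
  · obtain ⟨w₁, e1, e2⟩ := mvT_shift ho h2
    exact ⟨w₁, e1, Or.inr (Or.inl ⟨x, h1, e2 hl _ le_rfl⟩)⟩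
  · obtain ⟨w₁, e1, e2⟩ := mvT_shift ho h2
    exact ⟨w₁, e1, Or.inr (Or.inr ⟨x, h1, e2 hl _ le_rfl⟩)⟩

lemma sc_exists_up (c : ℝ) (hU : IsSigmaCompact U) :
    IsSigmaCompact {p : Path n × ℝ | ∃ x, seqP p.1 j ≤ x ∧ mvT j p c x ∈ U} := by
  have e : {p : Path n × ℝ | ∃ x, seqP p.1 j ≤ x ∧ mvT j p c x ∈ U} =
      (Prod.fst : (Path n × ℝ) × ℝ → Path n × ℝ) '' ({t | seqP t.1.1 j ≤ t.2} ∩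
        (fun t : (Path n × ℝ) × ℝ => mvT j t.1 c t.2) ⁻¹' U) := by
    ext p; constructor
    · rintro ⟨x, h1, h2⟩; exact ⟨(p, x), ⟨h1, h2⟩, rfl⟩
    · rintro ⟨⟨p', x⟩, ⟨h1, h2⟩, rfl⟩; exact ⟨x, h1, h2⟩
  rw [e]
  refine (sc_inter (sc_of_closed (isClosed_le ?_ continuous_snd))
    (sc_preimage (continuous_mvT j continuous_fst continuous_const continuous_snd) hU)).image continuous_fst
  exact (continuous_seqP j).comp (continuous_fst.comp continuous_fst)

lemma sc_exists_down (c : ℝ) (hU : IsSigmaCompact U) :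
    IsSigmaCompact {p : Path n × ℝ | ∃ x, x ≤ seqP p.1 j ∧ mvT j p c x ∈ U} := by
  have e : {p : Path n × ℝ | ∃ x, x ≤ seqP p.1 j ∧ mvT j p c x ∈ U} =
      (Prod.fst : (Path n × ℝ) × ℝ → Path n × ℝ) '' ({t | t.2 ≤ seqP t.1.1 j} ∩
        (fun t : (Path n × ℝ) × ℝ => mvT j t.1 c t.2) ⁻¹' U) := by
    ext p; constructor
    · rintro ⟨x, h1, h2⟩; exact ⟨(p, x), ⟨h1, h2⟩, rfl⟩
    · rintro ⟨⟨p', x⟩, ⟨h1, h2⟩, rfl⟩; exact ⟨x, h1, h2⟩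
  rw [e]
  refine (sc_inter (sc_of_closed (isClosed_le continuous_snd ?_))
    (sc_preimage (continuous_mvT j continuous_fst continuous_const continuous_snd) hU)).image continuous_fst
  exact (continuous_seqP j).comp (continuous_fst.comp continuous_fst)

lemma stepU_sc (hU : IsSigmaCompact U) : IsSigmaCompact (stepU C j U) := by
  have e : stepU C j U = ((Prod.fst : (Path n × ℝ) × (ℝ × ℝ × ℝ) → Path n × ℝ) ''
      (({t | seqP t.1.1 j ≤ t.2.1} ∩ {t | t.2.2.1 ≤ seqP t.1.1 j} ∩
        {t | 0 ≤ t.2.2.2} ∩ {t | t.2.2.2 ≤ C}) ∩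
        ((fun t : (Path n × ℝ) × (ℝ × ℝ × ℝ) => mvT j t.1 t.2.2.2 t.2.1) ⁻¹' U ∩
        (fun t : (Path n × ℝ) × (ℝ × ℝ × ℝ) => mvT j t.1 t.2.2.2 t.2.2.1) ⁻¹' U))) ∪
      ({p : Path n × ℝ | ∃ x, seqP p.1 j ≤ x ∧ mvT j p C x ∈ U} ∪
      {p : Path n × ℝ | ∃ x, x ≤ seqP p.1 j ∧ mvT j p 0 x ∈ U}) := by
    ext p; constructor
    · rintro (⟨x₁, x₂, b, h1, h2, h3, h4, h5⟩ | h | h)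
      · exact Or.inl ⟨(p, x₁, x₂, b), ⟨⟨⟨⟨h1, h2⟩, h3.1⟩, h3.2⟩, h4, h5⟩, rfl⟩
      · exact Or.inr (Or.inl h)
      · exact Or.inr (Or.inr h)
    · rintro (⟨⟨p', x₁, x₂, b⟩, ⟨⟨⟨⟨h1, h2⟩, h3⟩, h3'⟩, h4, h5⟩, rfl⟩ | h | h)
      · exact Or.inl ⟨x₁, x₂, b, h1, h2, ⟨h3, h3'⟩, h4, h5⟩
      · exact Or.inr (Or.inl h)
      · exact Or.inr (Or.inr h)
  rw [e]
  have hs : Continuous (fun t : (Path n × ℝ) × (ℝ × ℝ × ℝ) => seqP t.1.1 j) :=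
    (continuous_seqP j).comp (continuous_fst.comp continuous_fst)
  refine sc_union ((sc_inter (sc_of_closed ?_) (sc_inter ?_ ?_)).image continuous_fst)
    (sc_union (sc_exists_up C hU) (sc_exists_down 0 hU))
  · exact (((isClosed_le hs (by fun_prop)).inter (isClosed_le (by fun_prop) hs)).inter
      (isClosed_le continuous_const (by fun_prop))).inter (isClosed_le (by fun_prop) continuous_const)
  · exact sc_preimage (continuous_mvT j continuous_fst (by fun_prop) (by fun_prop)) hU
  · exact sc_preimage (continuous_mvT j continuous_fst (by fun_prop) (by fun_prop)) hU

lemma bstar_bdd (p : Path n × ℝ) : BddBelow {b | 0 ≤ b ∧ b ≤ C ∧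
    (b = C ∨ ∀ x, seqP p.1 j ≤ x → mvT j p b x ∉ U)} := ⟨0, fun _ h => h.1⟩

lemma bstar_mem (hC : 0 ≤ C) (p : Path n × ℝ) : bstar C j U p ∈ Icc 0 C := by
  have hm : C ∈ {b | 0 ≤ b ∧ b ≤ C ∧ (b = C ∨ ∀ x, seqP p.1 j ≤ x → mvT j p b x ∉ U)} :=
    ⟨hC, le_rfl, Or.inl rfl⟩
  exact ⟨le_csInf ⟨C, hm⟩ fun b h => h.1, csInf_le (bstar_bdd p) hm⟩

lemma lt_bstar (hl : LowU U) (ho : OpenU U) {c : ℝ} (hc : 0 ≤ c) (hcC : c < C) (p : Path n × ℝ) :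
    c < bstar C j U p ↔ ∃ x, seqP p.1 j ≤ x ∧ mvT j p c x ∈ U := by
  constructor
  · intro h
    by_contra hcon
    push Not at hcon
    exact absurd h (not_lt.2 (csInf_le (bstar_bdd p) ⟨hc, hcC.le, Or.inr hcon⟩))
  · rintro ⟨x, hx, hbad⟩
    obtain ⟨ε, hε, h⟩ := mvT_b hl ho hbad
    have : min (c + ε) C ≤ bstar C j U p := by
      refine le_csInf ⟨C, hc.trans hcC.le, le_rfl, Or.inl rfl⟩ ?_
      rintro b ⟨h1, h2, rfl | h3⟩
      · exact min_le_right _ _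
      · by_contra hlt
        push Not at hlt
        have hb : b < c + ε := hlt.trans_le (min_le_left _ _)
        refine h3 x hx (mvT_low hl (h (c + ε) (by simp [abs_of_pos hε])) ?_)
        exact mul_le_mul_of_nonneg_right hb.le (by linarith)
    exact lt_of_lt_of_le (lt_min (by linarith) hcC) this

lemma bstar_measurable (hC : 0 ≤ C) (hl : LowU U) (ho : OpenU U) (hU : IsSigmaCompact U) :
    Measurable (bstar C j U) := by
  refine measurable_of_Ioi fun c => ?_
  by_cases h0 : 0 ≤ c
  · by_cases h1 : c < C
    · have : bstar C j U ⁻¹' Ioi c = {p : Path n × ℝ | ∃ x, seqP p.1 j ≤ x ∧ mvT j p c x ∈ U} := by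
        ext p; exact lt_bstar hl ho h0 h1 p
      rw [this]
      exact sc_measurable (sc_exists_up c hU)
    · have : bstar C j U ⁻¹' Ioi c = ∅ := by
        ext p
        simp only [mem_preimage, mem_Ioi, mem_empty_iff_false, iff_false, not_lt]
        exact (bstar_mem hC p).2.trans (not_lt.1 h1)
      rw [this]; exact MeasurableSet.empty
  · have : bstar C j U ⁻¹' Ioi c = univ := by
      ext p
      simp only [mem_preimage, mem_Ioi, mem_univ, iff_true]
      exact (not_le.1 h0).trans_le (bstar_mem hC p).1
    rw [this]; exact MeasurableSet.univ

lemma bstar_select (hC : 0 ≤ C) (hl : LowU U) (ho : OpenU U) {p : Path n × ℝ}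
    (hp : p ∉ stepU C j U) (x : ℝ) : mvT j p (bstar C j U p) x ∉ U := by
  intro hbad
  have hm := bstar_mem (j := j) (U := U) hC p
  rcases le_total (seqP p.1 j) x with hx | hx
  · rcases hm.2.eq_or_lt with h | h
    · rw [h] at hbad
      exact hp (Or.inr (Or.inl ⟨x, hx, hbad⟩))
    · exact absurd ((lt_bstar hl ho hm.1 h p).2 ⟨x, hx, hbad⟩) (lt_irrefl _)
  · rcases hm.1.eq_or_lt with h | h
    · rw [← h] at hbad
      exact hp (Or.inr (Or.inr ⟨x, hx, hbad⟩))
    · obtain ⟨ε, hε, hb⟩ := mvT_b hl ho hbad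
      set c := max 0 (bstar C j U p - ε) with hc
      have hc1 : c < bstar C j U p := max_lt h (by linarith)
      have hc0 : 0 ≤ c := le_max_left _ _
      have hc2 : mvT j p c x ∈ U := hb c (by
        rw [abs_le]; constructor
        · linarith [le_max_right 0 (bstar C j U p - ε)]
        · linarith)
      obtain ⟨x₁, h1, h2⟩ := (lt_bstar hl ho hc0 (hc1.trans_le hm.2) p).1 hc1
      exact hp (Or.inl ⟨x₁, x, c, h1, hx, ⟨hc0, hc1.le.trans hm.2⟩, h2, hc2⟩)

lemma notMem_stepU (hl : LowU U) {p : Path n × ℝ} {b : ℝ} (hb : b ∈ Icc 0 C)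
    (h : ∀ x, mvT j p b x ∉ U) : p ∉ stepU C j U := by
  rintro (⟨x₁, x₂, c, h1, h2, h3, h4, h5⟩ | ⟨x, h1, h2⟩ | ⟨x, h1, h2⟩)
  · rcases le_total b c with hbc | hbc
    · exact h x₁ (mvT_low hl h4 (mul_le_mul_of_nonneg_right hbc (by linarith)))
    · exact h x₂ (mvT_low hl h5 (mul_le_mul_of_nonpos_right hbc (by linarith)))
  · exact h x (mvT_low hl h2 (mul_le_mul_of_nonneg_right hb.2 (by linarith)))
  · exact h x (mvT_low hl h2 (mul_le_mul_of_nonpos_right hb.1 (by linarith)))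

end Select
end FileG

section FileG2
section LemmaB
variable {n : ℕ}

def Uend (P : Set (Path n)) (f : Path n → EReal) : Set (Path n × ℝ) :=
  {p | p.1 ∈ P ∧ (p.2 : EReal) < f p.1}

lemma Uend_low (P : Set (Path n)) (f : Path n → EReal) : LowU (Uend P f) := by
  rintro ω w w' ⟨h1, h2⟩ h
  exact ⟨h1, lt_of_le_of_lt (EReal.coe_le_coe_iff.2 h) h2⟩

lemma Uend_open (P : Set (Path n)) (f : Path n → EReal) : OpenU (Uend P f) := by
  rintro ω w ⟨h1, h2⟩
  obtain ⟨x, hx1, hx2⟩ := EReal.lt_iff_exists_real_btwn.1 h2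
  exact ⟨x, EReal.coe_lt_coe_iff.1 hx1, h1, hx2⟩

lemma Uend_sc {P : Set (Path n)} (hPc : IsClosed P) {f : Path n → EReal}
    (hf : UpperSemicontinuousOn f P) : IsSigmaCompact (Uend P f) := by
  have e : Uend P f = ⋃ q : ℚ, {ω : Path n | ω ∈ P ∧ ((q : ℝ) : EReal) ≤ f ω} ×ˢ
      ⋃ m : ℕ, Iic ((q : ℝ) - 1 / ((m : ℝ) + 1)) := by
    ext ⟨ω, w⟩
    simp only [Uend, mem_setOf_eq, mem_iUnion, mem_prod, mem_Iic]
    constructor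
    · rintro ⟨h1, h2⟩
      obtain ⟨x, hx1, hx2⟩ := EReal.lt_iff_exists_real_btwn.1 h2
      obtain ⟨q, hq1, hq2⟩ := exists_rat_btwn (EReal.coe_lt_coe_iff.1 hx1)
      refine ⟨q, ⟨h1, ((EReal.coe_lt_coe_iff.2 hq2).trans hx2).le⟩, ?_⟩
      obtain ⟨m, hm⟩ := exists_nat_one_div_lt (sub_pos.2 hq1)
      exact ⟨m, by linarith⟩
    · rintro ⟨q, ⟨h1, h2⟩, m, hm⟩
      refine ⟨h1, lt_of_lt_of_le (EReal.coe_lt_coe_iff.2 ?_) h2⟩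
      have : 0 < 1 / ((m : ℝ) + 1) := by positivity
      linarith
  rw [e]
  refine isSigmaCompact_iUnion _ fun q => ?_
  rw [prod_iUnion]
  refine isSigmaCompact_iUnion _ fun m => sc_of_closed (IsClosed.prod ?_ isClosed_Iic)
  have := (upperSemicontinuousOn_iff_restrict.2 hf)
  have h2 : IsClosed {x : P | ((q : ℝ) : EReal) ≤ f x} := by
    have := this.isClosed_preimage ((q : ℝ) : EReal)
    exact this
  have h3 := hPc.isClosedEmbedding_subtypeVal.isClosedMap _ h2
  convert h3 using 1
  ext ω
  simp [and_comm]

def Urec (C : ℝ) (U : Set (Path n × ℝ)) : ℕ → Set (Path n × ℝ)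
  | 0 => U
  | k + 1 => stepU C (n - (k + 1)) (Urec C U k)

lemma Urec_props {C : ℝ} (hC : 0 ≤ C) {U : Set (Path n × ℝ)} (hl : LowU U) (ho : OpenU U)
    (hs : IsSigmaCompact U) : ∀ k, LowU (Urec C U k) ∧ OpenU (Urec C U k) ∧
      IsSigmaCompact (Urec C U k) := by
  intro k
  induction k with
  | zero => exact ⟨hl, ho, hs⟩
  | succ k ih =>
    exact ⟨stepU_low ih.1, stepU_open ih.1 ih.2.1, stepU_sc ih.2.2⟩

lemma Urec_step (C : ℝ) (U : Set (Path n × ℝ)) (j : ℕ) (hj : j < n) :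
    Urec C U (n - j) = stepU C j (Urec C U (n - (j + 1))) := by
  have h : n - j = (n - (j + 1)) + 1 := by omega
  rw [h]
  show stepU C (n - (n - (j + 1) + 1)) _ = _
  congr 1
  omega

lemma updN_seq (ω : Path n) (j : Fin n) (x : ℝ) : updN ω (j + 1) x j.succ = x ∧
    updN ω (j + 1) x j.castSucc = ω j.castSucc ∧ restr j (updN ω (j + 1) x) = restr j ω ∧
    updN ω (j + 1) x 0 = ω 0 := by
  refine ⟨by simp [updN], by simp [updN], ?_, ?_⟩
  · funext k
    have := k.isLt
    simp only [restr, updN]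
    rw [if_neg]; simp; omega
  · simp only [updN]
    rw [if_neg]; simp

lemma Urec_back {C : ℝ} {U : Set (Path n × ℝ)} (hC : 0 ≤ C) (hl : LowU U) (ho : OpenU U)
    (hs : IsSigmaCompact U) (γ : (j : Fin n) → (Fin j → ℝ) → ℝ)
    (hγ : ∀ j x, γ j x ∈ Icc 0 C) (h0 : ∀ ω, (ω, pgains γ n ω) ∉ U) :
    ∀ k, k ≤ n → ∀ ω, (ω, pgains γ (n - k) ω) ∉ Urec C U k := by
  intro k
  induction k with
  | zero => intro _ ω; exact h0 ω
  | succ k ih =>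
    intro hk ω
    have hp := Urec_props hC hl ho hs k
    refine notMem_stepU hp.1 (hγ ⟨n - (k + 1), by omega⟩ (restr _ ω)) fun x => ?_
    set j : Fin n := ⟨n - (k + 1), by omega⟩ with hj
    have hjv : (j : ℕ) = n - (k + 1) := rfl
    have hu := updN_seq ω j x
    have := ih (by omega) (updN ω (j + 1) x)
    have hjk : n - k = (j : ℕ) + 1 := by omega
    rw [hjk, pgains_succ, hu.1, hu.2.1, hu.2.2.1, pgains_congr γ j hu.2.2.2 hu.2.2.1] at this
    unfold mvT
    rw [← hjv, seqP_castSucc]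
    exact this

def Wf (C : ℝ) (U : Set (Path n × ℝ)) : ℕ → Path n → ℝ
  | 0, _ => 0
  | j + 1, ω => Wf C U j ω + bstar C j (Urec C U (n - (j + 1))) (truncP j ω, Wf C U j ω) *
      (seqP ω (j + 1) - seqP ω j)

lemma seqP_truncP (ω : Path n) {i j : ℕ} (h : i ≤ j) : seqP (truncP j ω) i = seqP ω i := by
  unfold seqP truncP
  split_ifs <;> rfl

lemma truncP_truncP (ω : Path n) {i j : ℕ} (h : i ≤ j) : truncP i (truncP j ω) = truncP i ω := by
  funext k
  simp only [truncP]
  split_ifs <;> first | rfl | omega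

lemma Wf_trunc (C : ℝ) (U : Set (Path n × ℝ)) : ∀ (j j' : ℕ), j ≤ j' → ∀ ω,
    Wf C U j (truncP j' ω) = Wf C U j ω := by
  intro j
  induction j with
  | zero => intros; rfl
  | succ j ih =>
    intro j' h ω
    simp only [Wf]
    rw [ih j' (by omega), truncP_truncP ω (by omega), seqP_truncP ω h, seqP_truncP ω (by omega)]

lemma Wf_meas {C : ℝ} (hC : 0 ≤ C) {U : Set (Path n × ℝ)} (hl : LowU U) (ho : OpenU U)
    (hs : IsSigmaCompact U) : ∀ j, Measurable (Wf C U j) := by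
  intro j
  induction j with
  | zero => exact measurable_const
  | succ j ih =>
    have hp := Urec_props hC hl ho hs (n - (j + 1))
    have e : Wf C U (j + 1) = fun ω => Wf C U j ω + bstar C j (Urec C U (n - (j + 1)))
      (truncP j ω, Wf C U j ω) * (seqP ω (j + 1) - seqP ω j) := by funext ω; rfl
    rw [e]
    refine ih.add (((bstar_measurable hC hp.1 hp.2.1 hp.2.2).comp
      ((continuous_truncP j).measurable.prodMk ih)).mul ?_)
    exact ((continuous_seqP _).sub (continuous_seqP _)).measurable

lemma updN_truncP (ω : Path n) (j : ℕ) : updN (truncP j ω) (j + 1) (seqP ω (j + 1)) =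
    truncP (j + 1) ω := by
  funext i
  simp only [updN, truncP, seqP]
  by_cases h : (i : ℕ) = j + 1
  · have : j + 1 < n + 1 := h ▸ i.isLt
    rw [if_pos h, dif_pos this, if_pos (by omega)]
    congr 1; exact Fin.ext h.symm
  · rw [if_neg h]
    by_cases h2 : (i : ℕ) ≤ j
    · rw [if_pos h2, if_pos (by omega)]
    · rw [if_neg h2, if_neg (by omega)]

lemma Wf_inv {C : ℝ} (hC : 0 ≤ C) {U : Set (Path n × ℝ)} (hl : LowU U) (ho : OpenU U)
    (hs : IsSigmaCompact U) (ω : Path n) (h0 : (truncP 0 ω, (0 : ℝ)) ∉ Urec C U n) :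
    ∀ j, j ≤ n → (truncP j ω, Wf C U j ω) ∉ Urec C U (n - j) := by
  intro j
  induction j with
  | zero => intro _; exact h0
  | succ j ih =>
    intro hj
    have h1 := ih (by omega)
    rw [Urec_step C U j (by omega)] at h1
    have hp := Urec_props hC hl ho hs (n - (j + 1))
    have := bstar_select hC hp.1 hp.2.1 h1 (seqP ω (j + 1))
    unfold mvT at this
    simp only [updN_truncP, seqP_truncP ω le_rfl] at this
    exact this

/-- Measurable selection of a bounded nonnegative hedging strategy. -/
lemma lemmaB {s₀ : ℝ} {P : Set (Path n)} (hPsub : P ⊆ Omega n s₀) (hPc : IsClosed P)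
    {f : Path n → EReal} (hf : UpperSemicontinuousOn f P) {C : ℝ} (hC : 0 ≤ C)
    (γ : (j : Fin n) → (Fin j → ℝ) → ℝ) (hγ : ∀ j x, γ j x ∈ Icc 0 C)
    (hle : ∀ ω ∈ P, f ω ≤ ((pgains γ n ω : ℝ) : EReal)) :
    ∃ D : Dyn n, D.Nonneg ∧ ∀ ω ∈ P, f ω ≤ ((D.gains ω : ℝ) : EReal) := by
  set U := Uend P f with hU
  have hl : LowU U := Uend_low P f
  have ho : OpenU U := Uend_open P f
  have hs : IsSigmaCompact U := Uend_sc hPc hf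
  have hback := Urec_back hC hl ho hs γ hγ (by
    rintro ω ⟨h1, h2⟩
    exact absurd h2 (not_lt.2 (hle ω h1)))
  have hB : ∀ j p, bstar C j (Urec C U (n - (j + 1))) p ∈ Icc 0 C := fun j p => bstar_mem hC p
  let D : Dyn n :=
    { pos := fun j x => bstar C j (Urec C U (n - ((j : ℕ) + 1))) (extP s₀ j x, Wf C U j (extP s₀ j x))
      meas := by
        intro j
        have hp := Urec_props hC hl ho hs (n - ((j : ℕ) + 1))
        exact (bstar_measurable hC hp.1 hp.2.1 hp.2.2).comp
          ((continuous_extP s₀ j).measurable.prodMk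
            ((Wf_meas hC hl ho hs j).comp (continuous_extP s₀ j).measurable))
      bdd := fun j => ⟨C, fun x => by
        rw [abs_of_nonneg (hB _ _).1]; exact (hB _ _).2⟩ }
  refine ⟨D, fun j x => (hB _ _).1, fun ω hω => ?_⟩
  have h0 : (truncP 0 ω, (0 : ℝ)) ∉ Urec C U n := by
    have := hback n le_rfl (truncP 0 ω)
    simpa [pgains] using this
  have hinv := Wf_inv hC hl ho hs ω h0 n le_rfl
  have ht : truncP n ω = ω := by
    funext i
    have := i.isLt
    simp only [truncP]
    rw [if_pos (by omega)]
  have hgain : ∀ m, Wf C U m ω = ∑ j ∈ Finset.range m,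
      bstar C j (Urec C U (n - (j + 1))) (truncP j ω, Wf C U j ω) * (seqP ω (j + 1) - seqP ω j) := by
    intro m
    induction m with
    | zero => rfl
    | succ m ih => rw [Finset.sum_range_succ, ← ih]; rfl
  have hW : D.gains ω = Wf C U n ω := by
    rw [hgain n, ← Fin.sum_univ_eq_sum_range (fun j => bstar C j (Urec C U (n - (j + 1)))
      (truncP j ω, Wf C U j ω) * (seqP ω (j + 1) - seqP ω j)) n]
    unfold Dyn.gains
    refine Finset.sum_congr rfl fun j _ => ?_
    show bstar C j (Urec C U (n - ((j : ℕ) + 1))) (extP s₀ j (restr j ω), Wf C U j (extP s₀ j (restr j ω)))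
      * _ = _
    rw [extP_restr j ω (hPsub hω).1, Wf_trunc C U j j le_rfl, seqP_succ, seqP_castSucc]
  rw [hW]
  rw [ht, Nat.sub_self] at hinv
  by_contra hcon
  exact hinv ⟨hω, not_le.1 hcon⟩
end LemmaB
end FileG2

section FileH
section Fat
variable {n : ℕ}

lemma tendsto_sub_left_E (d : ℝ) {f : ℕ → EReal} {a : EReal} (h : Tendsto f atTop (𝓝 a)) :
    Tendsto (fun k => (d : EReal) - f k) atTop (𝓝 ((d : EReal) - a)) := by
  have hc : ContinuousAt (fun p : EReal × EReal => p.1 + p.2) ((d : EReal), -a) :=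
    EReal.continuousAt_add (Or.inl (EReal.coe_ne_top d)) (Or.inl (EReal.coe_ne_bot d))
  have h1 : Tendsto (fun k => ((d : EReal), -(f k))) atTop (𝓝 ((d : EReal), -a)) :=
    tendsto_const_nhds.prodMk_nhds (((continuous_neg (G := EReal)).tendsto a).comp h)
  have := hc.tendsto.comp h1
  simpa [Function.comp_def, sub_eq_add_neg] using this

lemma fatouE {Z : Type*} [MeasurableSpace Z] {Q : Measure Z} {g : ℕ → Z → ℝ} {d : Z → ℝ}
    (hg : ∀ k, Integrable (g k) Q) (hd : Integrable d Q) (hgd : ∀ k, ∀ᵐ x ∂Q, g k x ≤ d x)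
    {f : Z → EReal} (hf : ∀ᵐ x ∂Q, Tendsto (fun k => ((g k x : ℝ) : EReal)) atTop (𝓝 (f x)))
    {v : ℝ} (hv : ∀ k, v ≤ ∫ x, g k x ∂Q) :
    ∃ g' : Z → ℝ, Integrable g' Q ∧ (∀ᵐ x ∂Q, f x = ((g' x : ℝ) : EReal)) ∧ v ≤ ∫ x, g' x ∂Q := by
  have hgd' := ae_all_iff.2 hgd
  have hfm : AEMeasurable f Q := aemeasurable_of_tendsto_metrizable_ae atTop
    (fun k => (hg k).aestronglyMeasurable.aemeasurable.coe_real_ereal) hf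
  have hle : ∀ᵐ x ∂Q, f x ≤ (d x : EReal) := by
    filter_upwards [hf, hgd'] with x h1 h2
    exact le_of_tendsto' h1 fun k => EReal.coe_le_coe_iff.2 (h2 k)
  have hL : ∫⁻ x, posE ((d x : EReal) - f x) ∂Q ≤ ENNReal.ofReal (∫ x, d x ∂Q - v) := by
    calc ∫⁻ x, posE ((d x : EReal) - f x) ∂Q
        ≤ ∫⁻ x, liminf (fun k => ENNReal.ofReal (d x - g k x)) atTop ∂Q := by
          refine lintegral_mono_ae ?_
          filter_upwards [hf] with x h1
          have h2 : Tendsto (fun k => posE ((d x : EReal) - ((g k x : ℝ) : EReal))) atTop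
              (𝓝 (posE ((d x : EReal) - f x))) := by
            simp only [posE_eq]
            exact (EReal.continuous_toENNReal.tendsto _).comp (tendsto_sub_left_E (d x) h1)
          refine (le_of_eq ?_)
          rw [← h2.liminf_eq]
          congr 1
      _ ≤ liminf (fun k => ∫⁻ x, ENNReal.ofReal (d x - g k x) ∂Q) atTop :=
          lintegral_liminf_le' fun k => (hd.sub (hg k)).aestronglyMeasurable.aemeasurable.ennreal_ofReal
      _ ≤ _ := by
          refine (liminf_le_liminf (v := fun _ => ENNReal.ofReal (∫ x, d x ∂Q - v)) (Eventually.of_forall fun k => ?_)).trans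
            (by simp)
          show ∫⁻ x, ENNReal.ofReal (d x - g k x) ∂Q ≤ ENNReal.ofReal (∫ x, d x ∂Q - v)
          have hdk : Integrable (fun x => d x - g k x) Q := hd.sub (hg k)
          rw [← ofReal_integral_eq_lintegral_ofReal hdk (by
            filter_upwards [hgd k] with x h; simpa using h)]
          refine ENNReal.ofReal_le_ofReal ?_
          rw [integral_sub hd (hg k)]; linarith [hv k]
  have hfin : ∀ᵐ x ∂Q, posE ((d x : EReal) - f x) < ⊤ := by
    refine ae_lt_top' ?_ (ne_top_of_le_ne_top ENNReal.ofReal_ne_top hL)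
    exact measurable_posE.comp_aemeasurable
      ((hd.aestronglyMeasurable.aemeasurable.coe_real_ereal).sub hfm)
  have hco : ∀ᵐ x ∂Q, f x = ((f x).toReal : EReal) := by
    filter_upwards [hfin, hle] with x h1 h2
    refine (EReal.coe_toReal ?_ ?_).symm
    · exact ne_top_of_le_ne_top (EReal.coe_ne_top _) h2
    · intro h; rw [h] at h1; simp [posE_eq] at h1
  have hL2 : ∫⁻ x, ENNReal.ofReal (d x - (f x).toReal) ∂Q ≤ ENNReal.ofReal (∫ x, d x ∂Q - v) := by
    refine le_trans (le_of_eq (lintegral_congr_ae ?_)) hL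
    filter_upwards [hco] with x h
    rw [h, ← EReal.coe_sub, posE_coe, EReal.toReal_coe]
  have hnn : 0 ≤ᵐ[Q] fun x => d x - (f x).toReal := by
    filter_upwards [hco, hle] with x h1 h2
    rw [h1, EReal.coe_le_coe_iff] at h2
    simpa using h2
  have hm : AEStronglyMeasurable (fun x => d x - (f x).toReal) Q :=
    (hd.aestronglyMeasurable.aemeasurable.sub
      (measurable_ereal_toReal.comp_aemeasurable hfm)).aestronglyMeasurable
  have hI : Integrable (fun x => d x - (f x).toReal) Q := by
    refine ⟨hm, ?_⟩
    rw [hasFiniteIntegral_iff_ofReal hnn]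
    exact lt_of_le_of_lt hL2 ENNReal.ofReal_lt_top
  have hI2 : Integrable (fun x => (f x).toReal) Q := by
    have := hd.sub hI
    refine this.congr (Eventually.of_forall fun x => ?_)
    simp
  refine ⟨fun x => (f x).toReal, hI2, hco, ?_⟩
  have hvd : v ≤ ∫ x, d x ∂Q := (hv 0).trans (integral_mono_ae (hg 0) hd (hgd 0))
  rw [← ofReal_integral_eq_lintegral_ofReal hI hnn, ENNReal.ofReal_le_ofReal_iff (by linarith),
    integral_sub hd hI2] at hL2
  linarith

lemma le_eexpE_map {Z : Type*} [MeasurableSpace Z] {Q : Measure Z} {π : Z → Path n}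
    (hπ : Measurable π) {f : Path n → EReal} (hf : AEMeasurable f (Q.map π)) {g : Z → ℝ}
    (hg : Integrable g Q) (hfg : ∀ᵐ x ∂Q, f (π x) = ((g x : ℝ) : EReal)) {v : ℝ}
    (hv : v ≤ ∫ x, g x ∂Q) : (v : EReal) ≤ eexpE (Q.map π) f := by
  unfold eexpE
  have m1 : AEMeasurable (fun ω => posE (f ω)) (Q.map π) := measurable_posE.comp_aemeasurable hf
  have m2 : AEMeasurable (fun ω => posE (-(f ω))) (Q.map π) :=
    measurable_posE.comp_aemeasurable ((continuous_neg (G := EReal)).measurable.comp_aemeasurable hf)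
  rw [lintegral_map' m1 hπ.aemeasurable, lintegral_map' m2 hπ.aemeasurable]
  have e1 : ∫⁻ x, posE (f (π x)) ∂Q = ∫⁻ x, ENNReal.ofReal (g x) ∂Q :=
    lintegral_congr_ae (by filter_upwards [hfg] with x h; rw [h, posE_coe])
  have e2 : ∫⁻ x, posE (-(f (π x))) ∂Q = ∫⁻ x, ENNReal.ofReal (-(g x)) ∂Q :=
    lintegral_congr_ae (by filter_upwards [hfg] with x h; rw [h, ← EReal.coe_neg, posE_coe])
  have f1 := hg.lintegral_lt_top
  have f2 := hg.neg.lintegral_lt_top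
  have e3 := integral_eq_lintegral_pos_part_sub_lintegral_neg_part hg
  simp only [Pi.neg_apply] at e2 f2
  rw [e2, e1]
  rw [e3] at hv
  rw [← ENNReal.ofReal_toReal f1.ne, ← ENNReal.ofReal_toReal f2.ne,
    EReal.coe_ennreal_ofReal, EReal.coe_ennreal_ofReal, max_eq_left ENNReal.toReal_nonneg,
    max_eq_left ENNReal.toReal_nonneg, ← EReal.coe_sub, EReal.coe_le_coe_iff]
  exact hv

lemma usc_tail {G : (Fin n → ℝ) → EReal} (hGusc : UpperSemicontinuousOn G {s | ∀ i, 0 ≤ s i})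
    (s₀ : ℝ) : UpperSemicontinuousOn (fun ω : Path n => G (tailCoords ω)) (Omega n s₀) := by
  intro ω hω y hy
  have h1 := hGusc (tailCoords ω) (fun i => hω.2 _) y hy
  have h2 : Tendsto tailCoords (𝓝[Omega n s₀] ω) (𝓝[{s | ∀ i, 0 ≤ s i}] (tailCoords ω)) :=
    tendsto_nhdsWithin_iff.2 ⟨continuous_tailCoords.continuousAt.tendsto.mono_left nhdsWithin_le_nhds,
      eventually_mem_nhdsWithin.mono fun ω' h i => h.2 _⟩
  exact h2.eventually h1

lemma usc_sub_cont {X : Type*} [TopologicalSpace X] {S : Set X} {f : X → EReal}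
    (hf : UpperSemicontinuousOn f S) {h : X → ℝ} (hh : Continuous h) :
    UpperSemicontinuousOn (fun x => f x - ((h x : ℝ) : EReal)) S := by
  have h1 : UpperSemicontinuousOn (fun x => (((-h x : ℝ)) : EReal)) S :=
    ((continuous_coe_real_ereal.comp hh.neg).upperSemicontinuous).upperSemicontinuousOn S
  have := UpperSemicontinuousOn.add' hf h1 (fun x _ =>
    EReal.continuousAt_add (Or.inr (EReal.coe_ne_bot _)) (Or.inr (EReal.coe_ne_top _)))
  simpa [sub_eq_add_neg] using this

lemma sub_swap {a : EReal} {b c : ℝ} (ha : a ≠ ⊤) (h : a - (b : EReal) ≤ (c : EReal)) :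
    a - (c : EReal) ≤ (b : EReal) := by
  induction a with
  | bot => simp
  | top => exact absurd rfl ha
  | coe a =>
    rw [← EReal.coe_sub, EReal.coe_le_coe_iff] at *
    linarith

lemma le_add_of_sub_le' {a : EReal} {b c : ℝ} (ha : a ≠ ⊤) (h : a - (b : EReal) ≤ (c : EReal)) :
    a ≤ ((b + c : ℝ) : EReal) := by
  induction a with
  | bot => simp
  | top => exact absurd rfl ha
  | coe a =>
    rw [← EReal.coe_sub, EReal.coe_le_coe_iff] at h
    rw [EReal.coe_le_coe_iff]
    linarith

lemma V_le_of_forall {pay : Static n → Path n → ℝ} {c : Fin n → ℝ → ℝ} {P : Set (Path n)}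
    {F : Path n → EReal} {S : EReal} (htop : V pay c P F ≠ ⊤)
    (h : ∀ v : ℝ, (∀ (X : Static n) (D : Dyn n), D.Nonneg →
      (∀ ω ∈ P, F ω ≤ ((pay X ω + D.gains ω : ℝ) : EReal)) → v ≤ X.price c) → (v : EReal) ≤ S) :
    V pay c P F ≤ S := by
  refine le_of_forall_lt fun a ha => ?_
  obtain ⟨x, hx1, hx2⟩ := EReal.lt_iff_exists_real_btwn.1 ha
  refine hx1.trans_le (h x fun X D hD hs => ?_)
  have : V pay c P F ≤ (X.price c : EReal) := sInf_le ⟨X, D, hD, rfl, hs⟩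
  exact EReal.coe_le_coe_iff.1 (hx2.le.trans this)
end Fat
end FileH

section FileH2
section Part1
variable {n : ℕ}
open scoped BoundedContinuousFunction

lemma V_ne_top {s₀ : ℝ} {P : Set (Path n)} (hPsub : P ⊆ Omega n s₀) {G : (Fin n → ℝ) → EReal} {K : ℝ}
    (hG : ∀ s : Fin n → ℝ, (∀ i, 0 ≤ s i) → G s ≤ ((K * (1 + ∑ i, s i) : ℝ) : EReal))
    (c : Fin n → ℝ → ℝ) :
    V Static.putPayoff c P (fun ω => G (tailCoords ω)) ≠ ⊤ := by
  have : V Static.putPayoff c P (fun ω => G (tailCoords ω)) ≤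
      (((Static.cash n (max K 0 * (1 + n * s₀))).price c : ℝ) : EReal) := by
    refine sInf_le ⟨_, safeDyn n (max K 0), safeDyn_nonneg (le_max_right _ _), rfl, fun ω hω => ?_⟩
    rw [Static.cash_putPayoff]
    exact safe_superhedge hG ω (hPsub hω)
  exact ne_top_of_le_ne_top (EReal.coe_ne_top _) this

lemma gainsOf_eq_pgains {s₀ : ℝ} {P : Set (Path n)} (hPsub : P ⊆ Omega n s₀)
    {G : (Fin n → ℝ) → EReal} {K : ℝ}
    (hG : ∀ s : Fin n → ℝ, (∀ i, 0 ≤ s i) → G s ≤ ((K * (1 + ∑ i, s i) : ℝ) : EReal))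
    {β : (i : Fin (n + 1)) → (Fin i → ℝ) → ℝ} (hβ : IsBetaFamily s₀ P G β)
    (ω : Path n) (hω : ω ∈ Omega n s₀) :
    pgains (fun (j : Fin n) x => min (max (β ⟨(j : ℕ), by have := j.isLt; omega⟩ x) 0) (max K 0 * n)) n ω
      = gainsOf β ω := by
  unfold pgains gainsOf
  refine Finset.sum_congr rfl fun j _ => ?_
  rw [if_pos j.isLt]
  have hr : ∀ k, 0 ≤ restr j ω k := fun k => hω.2 _
  beta_reduce
  rw [max_eq_left (beta_nonneg hβ j _ hr), min_eq_left (beta_le hPsub hG hβ j _ hr)]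

lemma part1_le {s₀ : ℝ}
    (P : Set (Path n)) (hPsub : P ⊆ Omega n s₀) (hPclosed : IsClosed P)
    (μ : Fin n → Measure ℝ) (hprob : ∀ i, IsProbabilityMeasure (μ i))
    (hsupp : ∀ i, μ i (Set.Iio 0) = 0) (hmom : ∀ i, Integrable (fun x => x) (μ i))
    (G : (Fin n → ℝ) → EReal) (hGtop : ∀ s, G s ≠ ⊤)
    (hGusc : UpperSemicontinuousOn G {s | ∀ i, 0 ≤ s i})
    (K : ℝ) (hG : ∀ s : Fin n → ℝ, (∀ i, 0 ≤ s i) → G s ≤ ((K * (1 + ∑ i, s i) : ℝ) : EReal))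
    (β : (i : Fin (n + 1)) → (Fin i → ℝ) → ℝ) (hβ : IsBetaFamily s₀ P G β)
    (husc : UpperSemicontinuousOn
        (fun ω => G (tailCoords ω) - ((gainsOf β ω : ℝ) : EReal)) (Omega n s₀))
    (C : ℝ) (hC : ∀ ω ∈ Omega n s₀,
        G (tailCoords ω) - ((gainsOf β ω : ℝ) : EReal) ≤ (C : EReal)) :
      V Static.putPayoff (fun i K' => ∫ x, max (K' - x) 0 ∂(μ i)) P
          (fun ω => G (tailCoords ω)) ≤
        ⨆ Q ∈ MSetP s₀ μ P,
          eexpE Q (fun ω => G (tailCoords ω) - ((gainsOf β ω : ℝ) : EReal)) := by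
  refine V_le_of_forall (V_ne_top hPsub hG _) fun v hv => ?_
  obtain ⟨Q, hQp, hcl, hmar, hInteg, hhv, hsup⟩ := ext_duality (Z := Path n) id continuous_id
    (fun R => by simpa using isCompact_closedBall (0 : Path n) R) id (fun _ => rfl) hPsub μ hprob hsupp hmom
    (fun ω => G (tailCoords ω)) v hv (max K 0 * (1 + n * s₀)) (safeDyn n (max K 0))
    (safeDyn_nonneg (le_max_right _ _)) (fun ω hω => safe_superhedge hG ω (hPsub hω))
    (fun j => extP s₀ j) (fun j => (continuous_extP s₀ j).measurable)
    (fun j => truncP j) (fun j => continuous_truncP j)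
    (fun j ω hω => (extP_restr j ω (hPsub hω).1).symm) (fun j ζ => truncP_castSucc j ζ)
  have hmem := ext_mem (Z := Path n) id continuous_id id (fun _ => rfl) hPsub hPclosed μ
    (fun j => truncP j) (fun j ζ => restr_truncP j j le_rfl ζ) Q hcl hmar hsup
  have hP : ∀ᵐ ω ∂Q, ω ∈ P := hcl P hPclosed fun ω hω => hω
  refine le_trans ?_ (le_iSup₂ (f := fun Q (_ : Q ∈ MSetP s₀ μ P) => eexpE Q _) (Q.map id) hmem)
  set f : Path n → EReal := fun ω => G (tailCoords ω) - ((gainsOf β ω : ℝ) : EReal) with hf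
  have huP : UpperSemicontinuousOn f P := husc.mono hPsub
  obtain ⟨h, h1, h2, h3⟩ := usc_approx P f huP (max C 0) (le_max_right _ _)
    (fun ω hω => (hC ω (hPsub hω)).trans (EReal.coe_le_coe_iff.2 (le_max_left _ _)))
  have hvr : ∀ r, v ≤ ∫ ω, h r ω ∂Q := by
    intro r
    obtain ⟨D, hD, hD2⟩ := lemmaB (f := fun ω => G (tailCoords ω) - ((h r ω : ℝ) : EReal)) hPsub hPclosed
      (usc_sub_cont ((usc_tail hGusc s₀).mono hPsub) (h r).continuous)
      (C := max K 0 * n) (by positivity)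
      (fun j x => min (max (β ⟨(j : ℕ), by have := j.isLt; omega⟩ x) 0) (max K 0 * n))
      (fun j x => ⟨le_min (le_max_right _ _) (by positivity), min_le_right _ _⟩)
      (fun ω hω => by
        rw [gainsOf_eq_pgains hPsub hG hβ ω (hPsub hω)]
        exact sub_swap (hGtop _) (h1 r ω hω))
    exact hhv (h r) D hD fun ω hω => le_add_of_sub_le' (hGtop _) (hD2 ω hω)
  obtain ⟨g', hg', hfg, hvg⟩ := fatouE (g := fun r ω => h r ω) (d := fun _ => max C 0)
    (fun r => (h r).integrable Q) (integrable_const _) (fun r => Eventually.of_forall (h2 r))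
    (f := f) (by filter_upwards [hP] with ω hω; exact h3 ω hω) hvr
  refine le_eexpE_map measurable_id ?_ hg' hfg hvg
  rw [Measure.map_id]
  exact aemeasurable_of_usc hPclosed hP huP
end Part1
end FileH2

section FileI
section PartTwo
variable {n : ℕ}
open scoped BoundedContinuousFunction

/-- Extended path space: path, normalised positions of all strategies, code of the negative part. -/
abbrev ZZ (n : ℕ) := Path n × ((ℕ → ℕ → unitInterval) × unitInterval)

def yZ (B : ℕ → ℝ) (k j : ℕ) (ζ : ZZ n) : ℝ := B k * (ζ.2.1 k j : ℝ)
def sZ (j : ℕ) (ζ : ZZ n) : ℝ := seqP ζ.1 j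
def xZ (B : ℕ → ℝ) (k j : ℕ) (ζ : ZZ n) : ℝ :=
  ∑ i ∈ Finset.range j, yZ B k i ζ * (sZ (i + 1) ζ - sZ i ζ)
def tZ (κ : ℝ) (j : ℕ) (ζ : ZZ n) : ℝ :=
  κ * (1 + ∑ i ∈ Finset.range j, sZ (i + 1) ζ + ((n : ℝ) - j) * sZ j ζ)
def rhoZ (j : ℕ) (ζ : ZZ n) : ZZ n :=
  (truncP j ζ.1, (fun k i => if i ≤ j then ζ.2.1 k i else 0, 0))

lemma continuous_yZ (B : ℕ → ℝ) (k j : ℕ) : Continuous (yZ B k j : ZZ n → ℝ) := by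
  unfold yZ
  exact continuous_const.mul (continuous_subtype_val.comp ((continuous_apply j).comp
    ((continuous_apply k).comp (continuous_fst.comp continuous_snd))))

lemma continuous_sZ (j : ℕ) : Continuous (sZ j : ZZ n → ℝ) :=
  (continuous_seqP j).comp continuous_fst

lemma continuous_xZ (B : ℕ → ℝ) (k j : ℕ) : Continuous (xZ B k j : ZZ n → ℝ) := by
  unfold xZ
  exact continuous_finset_sum _ fun i _ => (continuous_yZ B k i).mul
    ((continuous_sZ (i + 1)).sub (continuous_sZ i))

lemma continuous_tZ (κ : ℝ) (j : ℕ) : Continuous (tZ κ j : ZZ n → ℝ) := by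
  unfold tZ
  exact continuous_const.mul ((continuous_const.add (continuous_finset_sum _ fun i _ =>
    continuous_sZ (i + 1))).add (continuous_const.mul (continuous_sZ j)))

lemma continuous_rhoZ (j : ℕ) : Continuous (rhoZ j : ZZ n → ZZ n) := by
  unfold rhoZ
  refine Continuous.prodMk ((continuous_truncP j).comp continuous_fst)
    (Continuous.prodMk ?_ continuous_const)
  refine continuous_pi fun k => continuous_pi fun i => ?_
  by_cases h : i ≤ j
  · simp only [h, if_true]
    exact (continuous_apply i).comp ((continuous_apply k).comp (continuous_fst.comp continuous_snd))
  · simp only [h, if_false]; exact continuous_const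

lemma yZ_rho (B : ℕ → ℝ) (k : ℕ) {i j : ℕ} (h : i ≤ j) (ζ : ZZ n) : yZ B k i (rhoZ j ζ) = yZ B k i ζ := by
  simp [yZ, rhoZ, h]

lemma sZ_rho {i j : ℕ} (h : i ≤ j) (ζ : ZZ n) : sZ i (rhoZ j ζ) = sZ i ζ :=
  seqP_truncP ζ.1 h

lemma xZ_rho (B : ℕ → ℝ) (k : ℕ) {i j : ℕ} (h : i ≤ j) (ζ : ZZ n) : xZ B k i (rhoZ j ζ) = xZ B k i ζ := by
  unfold xZ
  refine Finset.sum_congr rfl fun l hl => ?_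
  have := Finset.mem_range.1 hl
  rw [yZ_rho B k (by omega), sZ_rho (by omega), sZ_rho (by omega)]

lemma tZ_rho (κ : ℝ) {i j : ℕ} (h : i ≤ j) (ζ : ZZ n) : tZ κ i (rhoZ j ζ) = tZ κ i ζ := by
  unfold tZ
  rw [sZ_rho h]
  congr 3
  refine Finset.sum_congr rfl fun l hl => ?_
  have := Finset.mem_range.1 hl
  rw [sZ_rho (by omega)]

lemma rhoZ_rhoZ {i j : ℕ} (h : i ≤ j) (ζ : ZZ n) : rhoZ i (rhoZ j ζ) = rhoZ i ζ := by
  unfold rhoZ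
  simp only [truncP_truncP ζ.1 h, Prod.mk.injEq, true_and, and_true]
  funext k l
  by_cases hl : l ≤ i
  · simp [hl, hl.trans h]
  · simp [hl]

lemma yZ_nonneg {B : ℕ → ℝ} (hB : ∀ k, 0 < B k) (k j : ℕ) (ζ : ZZ n) : 0 ≤ yZ B k j ζ :=
  mul_nonneg (hB k).le (ζ.2.1 k j).2.1

lemma yZ_le {B : ℕ → ℝ} (hB : ∀ k, 0 < B k) (k j : ℕ) (ζ : ZZ n) : yZ B k j ζ ≤ B k := by
  have := mul_le_mul_of_nonneg_left (ζ.2.1 k j).2.2 (hB k).le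
  simpa [yZ] using this

lemma abel_mix (κ : ℝ) (B : ℕ → ℝ) (k : ℕ) (ζ : ZZ n) (w : ℕ → ℝ) (hw0 : w 0 = 1) : ∀ m : ℕ,
    tZ κ m ζ - ∑ i ∈ Finset.range m, (w (i + 1) * yZ B k i ζ + (1 - w (i + 1)) * (κ * ((n : ℝ) - i))) *
      (sZ (i + 1) ζ - sZ i ζ) =
    ∑ j ∈ Finset.range m, (w j - w (j + 1)) * (tZ κ j ζ - xZ B k j ζ) + w m * (tZ κ m ζ - xZ B k m ζ) := by
  intro m
  induction m with
  | zero => simp [hw0, xZ]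
  | succ m ih =>
    rw [Finset.sum_range_succ, Finset.sum_range_succ _ m]
    have hx : xZ B k (m + 1) ζ = xZ B k m ζ + yZ B k m ζ * (sZ (m + 1) ζ - sZ m ζ) := by
      unfold xZ; rw [Finset.sum_range_succ]
    have ht : tZ κ (m + 1) ζ = tZ κ m ζ + κ * ((n : ℝ) - m) * (sZ (m + 1) ζ - sZ m ζ) := by
      unfold tZ; rw [Finset.sum_range_succ]; push_cast; ring
    rw [hx, ht]
    linear_combination ih

lemma tZ_nonneg {κ : ℝ} (hκ : 0 ≤ κ) {ζ : ZZ n} (hζ : ∀ i, 0 ≤ sZ i ζ) {j : ℕ} (hj : j ≤ n) :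
    0 ≤ tZ κ j ζ := by
  have : (j : ℝ) ≤ n := by exact_mod_cast hj
  refine mul_nonneg hκ (add_nonneg (add_nonneg zero_le_one (Finset.sum_nonneg fun i _ => hζ _))
    (mul_nonneg (by linarith) (hζ _)))
end PartTwo
end FileI

section FileI2
section PartTwoB
variable {n : ℕ}
open scoped BoundedContinuousFunction

def encZ (βN : ℕ → Dyn n) (B : ℕ → ℝ) (k i : ℕ) (ω : Path n) : unitInterval :=
  if h : i < n then Set.projIcc 0 1 zero_le_one ((βN k).pos ⟨i, h⟩ (restr ⟨i, h⟩ ω) / B k) else 0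

def uF (a : EReal) : unitInterval :=
  if a = ⊥ then 0 else Set.projIcc 0 1 zero_le_one (1 / (1 + max (-a.toReal) 0))

def zZ (βN : ℕ → Dyn n) (B : ℕ → ℝ) (F : Path n → EReal) (ω : Path n) : ZZ n :=
  (ω, (fun k i => encZ βN B k i ω, uF (F ω)))

def rZ (βN : ℕ → Dyn n) (B : ℕ → ℝ) (s₀ : ℝ) (j : Fin n) (x : Fin j → ℝ) : ZZ n :=
  (extP s₀ j x, (fun k i => if i ≤ (j : ℕ) then encZ βN B k i (extP s₀ j x) else 0, 0))

lemma measurable_encZ (βN : ℕ → Dyn n) (B : ℕ → ℝ) (k i : ℕ) : Measurable (encZ βN B k i) := by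
  unfold encZ
  by_cases h : i < n
  · simp only [h, dif_pos]
    exact continuous_projIcc.measurable.comp
      ((((βN k).meas _).comp (measurable_restr _)).div_const _)
  · simp only [h, dif_neg, not_false_eq_true]; exact measurable_const

lemma measurable_rZ (βN : ℕ → Dyn n) (B : ℕ → ℝ) (s₀ : ℝ) (j : Fin n) : Measurable (rZ βN B s₀ j) := by
  unfold rZ
  refine (continuous_extP s₀ j).measurable.prodMk (Measurable.prodMk ?_ measurable_const)
  refine measurable_pi_lambda _ fun k => measurable_pi_lambda _ fun i => ?_
  by_cases h : i ≤ (j : ℕ)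
  · simp only [h, if_true]
    exact (measurable_encZ βN B k i).comp (continuous_extP s₀ j).measurable
  · simp only [h, if_false]; exact measurable_const

lemma encZ_trunc (βN : ℕ → Dyn n) (B : ℕ → ℝ) (k : ℕ) {i : ℕ} {j : Fin n} (h : i ≤ (j : ℕ)) (ω : Path n) :
    encZ βN B k i (truncP j ω) = encZ βN B k i ω := by
  unfold encZ
  by_cases hi : i < n
  · simp only [hi, dif_pos]
    rw [restr_truncP ⟨i, hi⟩ j h]
  · simp [hi]

lemma rho_zZ (βN : ℕ → Dyn n) (B : ℕ → ℝ) (F : Path n → EReal) {s₀ : ℝ} (j : Fin n) (ω : Path n)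
    (hω : ω 0 = s₀) : rhoZ j (zZ βN B F ω) = rZ βN B s₀ j (restr j ω) := by
  unfold rhoZ zZ rZ
  rw [extP_restr j ω hω]
  simp only [Prod.mk.injEq, true_and, and_true]
  funext k i
  by_cases h : i ≤ (j : ℕ)
  · simp only [h, if_true]; rw [encZ_trunc βN B k h]
  · simp [h]

lemma yZ_zZ {βN : ℕ → Dyn n} (hN : ∀ k, (βN k).Nonneg) {B : ℕ → ℝ} (hB : ∀ k, 0 < B k)
    (hBb : ∀ k j x, (βN k).pos j x ≤ B k) (F : Path n → EReal) (k : ℕ) (j : Fin n) (ω : Path n) :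
    yZ B k j (zZ βN B F ω) = (βN k).pos j (restr j ω) := by
  unfold yZ zZ encZ
  simp only [j.isLt, dif_pos, Fin.eta]
  rw [Set.projIcc_of_mem zero_le_one ⟨div_nonneg (hN k j _) (hB k).le,
    (div_le_one (hB k)).2 (hBb k j _)⟩]
  have := (hB k).ne'
  field_simp

lemma xZ_zZ {βN : ℕ → Dyn n} (hN : ∀ k, (βN k).Nonneg) {B : ℕ → ℝ} (hB : ∀ k, 0 < B k)
    (hBb : ∀ k j x, (βN k).pos j x ≤ B k) (F : Path n → EReal) (k : ℕ) (ω : Path n) :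
    xZ B k n (zZ βN B F ω) = (βN k).gains ω := by
  unfold xZ Dyn.gains
  rw [← Fin.sum_univ_eq_sum_range (fun i => yZ B k i (zZ βN B F ω) *
    (sZ (i + 1) (zZ βN B F ω) - sZ i (zZ βN B F ω))) n]
  refine Finset.sum_congr rfl fun j _ => ?_
  rw [yZ_zZ hN hB hBb]
  simp only [sZ, zZ, seqP_succ, seqP_castSucc]

lemma tZ_n (κ : ℝ) (ζ : ZZ n) : tZ κ n ζ = κ * (1 + ∑ i : Fin n, ζ.1 i.succ) := by
  unfold tZ
  rw [← Fin.sum_univ_eq_sum_range (fun i => sZ (i + 1) ζ) n]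
  simp only [sZ, seqP_succ]
  ring

lemma le_tZ_n {s₀ : ℝ} {G : (Fin n → ℝ) → EReal} {K : ℝ}
    (hG : ∀ s : Fin n → ℝ, (∀ i, 0 ≤ s i) → G s ≤ ((K * (1 + ∑ i, s i) : ℝ) : EReal))
    (ζ : ZZ n) (hω : ζ.1 ∈ Omega n s₀) : G (tailCoords ζ.1) ≤ ((tZ (max K 0) n ζ : ℝ) : EReal) := by
  refine (hG _ fun i => hω.2 i.succ).trans (EReal.coe_le_coe_iff.2 ?_)
  rw [tZ_n]
  have h0 : 0 ≤ ∑ i : Fin n, ζ.1 i.succ := Finset.sum_nonneg fun i _ => hω.2 i.succ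
  exact mul_le_mul_of_nonneg_right (le_max_left _ _) (by linarith)

lemma uF_coe (a : ℝ) : ((uF (a : EReal)) : ℝ) = 1 / (1 + max (-a) 0) := by
  unfold uF
  rw [if_neg (EReal.coe_ne_bot a), EReal.toReal_coe, Set.projIcc_of_mem zero_le_one]
  have : 0 ≤ max (-a) 0 := le_max_right _ _
  exact ⟨by positivity, by rw [div_le_one (by linarith)]; linarith⟩

lemma uF_bot : ((uF ⊥ : unitInterval) : ℝ) = 0 := by simp [uF]

/-- the mixed strategy as a genuine strategy -/
lemma mix_dyn {s₀ : ℝ} {P : Set (Path n)} (hPsub : P ⊆ Omega n s₀)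
    {βN : ℕ → Dyn n} (hN : ∀ k, (βN k).Nonneg) {B : ℕ → ℝ} (hB : ∀ k, 0 < B k)
    (F : Path n → EReal) {κ : ℝ} (hκ : 0 ≤ κ) (k : ℕ)
    (w : ℕ → ZZ n → ℝ) (hwc : ∀ i, Continuous (w i)) (hw01 : ∀ i ζ, w i ζ ∈ Icc (0 : ℝ) 1)
    (hwρ : ∀ i ζ, w (i + 1) (rhoZ i ζ) = w (i + 1) ζ) :
    ∃ D : Dyn n, D.Nonneg ∧ ∀ ω ∈ P, D.gains ω = ∑ i ∈ Finset.range n,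
      (w (i + 1) (zZ βN B F ω) * yZ B k i (zZ βN B F ω) +
        (1 - w (i + 1) (zZ βN B F ω)) * (κ * ((n : ℝ) - i))) *
      (sZ (i + 1) (zZ βN B F ω) - sZ i (zZ βN B F ω)) := by
  have hM : ∀ j : Fin n, 0 ≤ κ * ((n : ℝ) - (j : ℕ)) ∧ κ * ((n : ℝ) - (j : ℕ)) ≤ κ * n := fun j => by
    have h1 : ((j : ℕ) : ℝ) ≤ n := by exact_mod_cast j.isLt.le
    have h2 : (0 : ℝ) ≤ (j : ℕ) := Nat.cast_nonneg _
    exact ⟨mul_nonneg hκ (by linarith), mul_le_mul_of_nonneg_left (by linarith) hκ⟩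
  have hnn : ∀ (j : Fin n) ζ, 0 ≤ w (j + 1) ζ * yZ B k j ζ + (1 - w (j + 1) ζ) * (κ * ((n : ℝ) - (j : ℕ))) :=
    fun j ζ => add_nonneg (mul_nonneg (hw01 _ _).1 (yZ_nonneg hB _ _ _))
      (mul_nonneg (by linarith [(hw01 (j + 1) ζ).2]) (hM j).1)
  let D : Dyn n :=
    { pos := fun j x => w (j + 1) (rZ βN B s₀ j x) * yZ B k j (rZ βN B s₀ j x) +
        (1 - w (j + 1) (rZ βN B s₀ j x)) * (κ * ((n : ℝ) - (j : ℕ)))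
      meas := fun j => by
        have h1 := (hwc (j + 1)).measurable.comp (measurable_rZ βN B s₀ j)
        have h2 := (continuous_yZ (n := n) B k j).measurable.comp (measurable_rZ βN B s₀ j)
        exact (h1.mul h2).add ((measurable_const.sub h1).mul_const _)
      bdd := fun j => ⟨B k + κ * n, fun x => by
        rw [abs_of_nonneg (hnn j _)]
        set ζ := rZ βN B s₀ j x
        have h1 := hw01 (j + 1) ζ
        have h2 := yZ_le hB k j ζ
        have h3 := yZ_nonneg hB k j ζ
        have h4 := hM j
        refine add_le_add ?_ ?_
        · exact (mul_le_of_le_one_left h3 h1.2).trans h2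
        · exact (mul_le_of_le_one_left h4.1 (by linarith [h1.1])).trans h4.2⟩ }
  refine ⟨D, fun j x => hnn j _, fun ω hω => ?_⟩
  rw [← Fin.sum_univ_eq_sum_range (fun i => (w (i + 1) (zZ βN B F ω) * yZ B k i (zZ βN B F ω) +
        (1 - w (i + 1) (zZ βN B F ω)) * (κ * ((n : ℝ) - i))) *
      (sZ (i + 1) (zZ βN B F ω) - sZ i (zZ βN B F ω))) n]
  unfold Dyn.gains
  refine Finset.sum_congr rfl fun j _ => ?_
  show (w (j + 1) (rZ βN B s₀ j (restr j ω)) * yZ B k j (rZ βN B s₀ j (restr j ω)) +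
        (1 - w (j + 1) (rZ βN B s₀ j (restr j ω))) * (κ * ((n : ℝ) - (j : ℕ)))) * _ = _
  rw [← rho_zZ βN B F j ω (hPsub hω).1, hwρ, yZ_rho B k le_rfl]
  simp only [sZ, zZ, seqP_succ, seqP_castSucc]

end PartTwoB
end FileI2

section FileI3
section PartTwoC
variable {n : ℕ}
open scoped BoundedContinuousFunction

structure QProp (P : Set (Path n)) (κ v : ℝ) (B : ℕ → ℝ) (βN : ℕ → Dyn n)
    (G : (Fin n → ℝ) → EReal) (Q : Measure (ZZ n)) : Prop where
  prob : IsProbabilityMeasure Q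
  mem : ∀ᵐ ζ ∂Q, ζ.1 ∈ P
  int : ∀ i, Integrable (fun ζ : ZZ n => ζ.1 i) Q
  upos : ∀ᵐ ζ ∂Q, 0 < (ζ.2.2 : ℝ)
  low : ∀ k (h : Path n →ᵇ ℝ),
    (∀ ω ∈ P, G (tailCoords ω) - (((βN k).gains ω : ℝ) : EReal) ≤ ((h ω : ℝ) : EReal)) →
    ∀ᵐ ζ ∂Q, -1 ≤ (ζ.2.2 : ℝ) * (xZ B k n ζ + h ζ.1)
  sup : ∀ j < n, ∀ A : Set (ZZ n), MeasurableSet A →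
    ∫ ζ, A.indicator (fun _ => (1 : ℝ)) (rhoZ j ζ) * (sZ (j + 1) ζ - sZ j ζ) ∂Q ≤ 0
  mix : ∀ k (h : Path n →ᵇ ℝ),
    (∀ ω ∈ P, G (tailCoords ω) - (((βN k).gains ω : ℝ) : EReal) ≤ ((h ω : ℝ) : EReal)) →
    ∀ w : ℕ → ZZ n → ℝ, (∀ i, Continuous (w i)) → (∀ i ζ, w i ζ ∈ Icc (0 : ℝ) 1) →
    (∀ i ζ, w (i + 1) (rhoZ i ζ) = w (i + 1) ζ) → (∀ ζ, w 0 ζ = 1) →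
    (∀ j < n, ∃ R, ∀ ζ, w j ζ - w (j + 1) ζ ≠ 0 → ‖(rhoZ j ζ).1‖ ≤ R) →
    v ≤ ∫ ζ, (∑ j ∈ Finset.range n, (w j ζ - w (j + 1) ζ) * (tZ κ j ζ - xZ B k j ζ)
      + w n ζ * max (min (h ζ.1) (tZ κ n ζ - xZ B k n ζ)) (-‖h‖)) ∂Q

lemma fst_compact (R : ℝ) : IsCompact ((Prod.fst : ZZ n → Path n) ⁻¹' Metric.closedBall 0 R) := by
  have : (Prod.fst : ZZ n → Path n) ⁻¹' Metric.closedBall 0 R = Metric.closedBall 0 R ×ˢ univ := by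
    ext; simp
  rw [this]
  exact (isCompact_closedBall _ _).prod isCompact_univ

lemma le_coe_of_sub_le {a : EReal} {b c : ℝ} (ha : a ≠ ⊤) (h : a - (b : EReal) ≤ (c : EReal)) :
    a = ⊥ ∨ ∃ r : ℝ, a = r ∧ r - b ≤ c := by
  induction a using EReal.rec with
  | bot => exact Or.inl rfl
  | top => exact absurd rfl ha
  | coe r => exact Or.inr ⟨r, rfl, by exact_mod_cast h⟩

lemma mix_bcf (κ : ℝ) (B : ℕ → ℝ) (k : ℕ) (h : Path n →ᵇ ℝ) (w : ℕ → ZZ n → ℝ)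
    (hwc : ∀ i, Continuous (w i)) (hw01 : ∀ i ζ, w i ζ ∈ Icc (0 : ℝ) 1)
    (hR : ∀ j < n, ∃ R, ∀ ζ, w j ζ - w (j + 1) ζ ≠ 0 → ‖(rhoZ j ζ).1‖ ≤ R) :
    ∃ H : ZZ n →ᵇ ℝ, ∀ ζ, H ζ = (∑ j ∈ Finset.range n, (w j ζ - w (j + 1) ζ) * (tZ κ j ζ - xZ B k j ζ)
      + w n ζ * max (min (h ζ.1) (tZ κ n ζ - xZ B k n ζ)) (-‖h‖)) := by
  have hb : ∀ j, ∃ Cj : ℝ, ∀ ζ, j < n → |(w j ζ - w (j + 1) ζ) * (tZ κ j ζ - xZ B k j ζ)| ≤ Cj := by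
    intro j
    by_cases hj : j < n
    · obtain ⟨R, hR⟩ := hR j hj
      have hc : Continuous (fun ζ : ZZ n => tZ κ j ζ - xZ B k j ζ) :=
        (continuous_tZ κ j).sub (continuous_xZ B k j)
      obtain ⟨C, hC⟩ := (fst_compact (n := n) R).exists_bound_of_continuousOn hc.continuousOn
      refine ⟨|C|, fun ζ _ => ?_⟩
      by_cases h0 : w j ζ - w (j + 1) ζ = 0
      · rw [h0, zero_mul, abs_zero]; exact abs_nonneg _
      · have h1 := hC (rhoZ j ζ) (by
          rw [mem_preimage, mem_closedBall_zero_iff]; exact hR ζ h0)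
        rw [tZ_rho κ le_rfl, xZ_rho B k le_rfl, Real.norm_eq_abs] at h1
        rw [abs_mul]
        have h2 : |w j ζ - w (j + 1) ζ| ≤ 1 := by
          rw [abs_le]; constructor <;> linarith [(hw01 j ζ).1, (hw01 j ζ).2, (hw01 (j+1) ζ).1, (hw01 (j+1) ζ).2]
        exact (mul_le_of_le_one_left (abs_nonneg _) h2).trans (h1.trans (le_abs_self _))
    · exact ⟨0, fun _ h => absurd h hj⟩
  choose Cj hCj using hb
  have hcont : Continuous (fun ζ => (∑ j ∈ Finset.range n, (w j ζ - w (j + 1) ζ) * (tZ κ j ζ - xZ B k j ζ)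
      + w n ζ * max (min (h ζ.1) (tZ κ n ζ - xZ B k n ζ)) (-‖h‖))) := by
    refine Continuous.add (continuous_finset_sum _ fun j _ => ((hwc j).sub (hwc (j + 1))).mul
      ((continuous_tZ κ j).sub (continuous_xZ B k j))) ((hwc n).mul ?_)
    exact ((h.continuous.comp continuous_fst).min ((continuous_tZ κ n).sub (continuous_xZ B k n))).max
      continuous_const
  refine ⟨BoundedContinuousFunction.ofNormedAddCommGroup _ hcont
    (∑ j ∈ Finset.range n, Cj j + ‖h‖) (fun ζ => ?_), fun ζ => rfl⟩
  rw [Real.norm_eq_abs]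
  refine (abs_add_le _ _).trans (add_le_add ((Finset.abs_sum_le_sum_abs _ _).trans
    (Finset.sum_le_sum fun j hj => hCj j ζ (Finset.mem_range.1 hj))) ?_)
  rw [abs_mul, abs_of_nonneg (hw01 n ζ).1]
  refine (mul_le_of_le_one_left (abs_nonneg _) (hw01 n ζ).2).trans ?_
  rw [abs_le]
  refine ⟨le_max_right _ _, max_le ((min_le_left _ _).trans ((le_abs_self _).trans ?_)) ?_⟩
  · exact h.norm_coe_le_norm ζ.1
  · linarith [norm_nonneg h]

lemma upos_aux {κ s₀ v : ℝ} (Q : Measure (ZZ n)) [IsProbabilityMeasure Q] (c0 : ℝ)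
    (h : ∀ N : ℕ, v ≤ ∫ ζ, (c0 - (1 / max (ζ.2.2 : ℝ) (1 / ((N : ℝ) + 1)) - 1)) ∂Q) :
    ∀ᵐ ζ ∂Q, 0 < (ζ.2.2 : ℝ) := by
  have hcu : Continuous (fun ζ : ZZ n => (ζ.2.2 : ℝ)) :=
    continuous_subtype_val.comp (continuous_snd.comp continuous_snd)
  set A : Set (ZZ n) := {ζ | (ζ.2.2 : ℝ) = 0} with hA
  have hAm : MeasurableSet A := (isClosed_eq hcu continuous_const).measurableSet
  have key : ∀ N : ℕ, ((N : ℝ) + 1) * Q.real A ≤ c0 + 1 - v := by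
    intro N
    have hN : (0 : ℝ) < (N : ℝ) + 1 := by positivity
    have h1 : ∫ ζ, (c0 - (1 / max (ζ.2.2 : ℝ) (1 / ((N : ℝ) + 1)) - 1)) ∂Q ≤
        ∫ ζ, (c0 + 1 - A.indicator (fun _ => ((N : ℝ) + 1)) ζ) ∂Q := by
      refine integral_mono ?_ ?_ fun ζ => ?_
      · refine Integrable.of_bound (C := |c0| + ((N : ℝ) + 1) + 1) ?_ (Eventually.of_forall fun ζ => ?_)
        · refine Continuous.aestronglyMeasurable ?_
          refine continuous_const.sub (Continuous.sub (Continuous.div continuous_const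
            (hcu.max continuous_const) fun ζ => ?_) continuous_const)
          exact (lt_of_lt_of_le (by positivity) (le_max_right _ _)).ne'
        · have hm : 1 / max (ζ.2.2 : ℝ) (1 / ((N : ℝ) + 1)) ≤ (N : ℝ) + 1 := by
            rw [div_le_iff₀ (lt_of_lt_of_le (by positivity) (le_max_right _ _))]
            have := mul_le_mul_of_nonneg_left (le_max_right (ζ.2.2 : ℝ) (1 / ((N : ℝ) + 1))) hN.le
            rw [mul_one_div_cancel hN.ne'] at this
            exact this
          have hm0 : 0 ≤ 1 / max (ζ.2.2 : ℝ) (1 / ((N : ℝ) + 1)) :=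
            div_nonneg zero_le_one (le_max_of_le_left ζ.2.2.2.1)
          rw [Real.norm_eq_abs, abs_le]
          constructor <;> linarith [neg_abs_le c0, le_abs_self c0]
      · exact (integrable_const _).sub ((integrable_const _).indicator hAm)
      · by_cases hζ : ζ ∈ A
        · have : (ζ.2.2 : ℝ) = 0 := hζ
          simp only [Set.indicator_of_mem hζ]
          rw [this, max_eq_right (by positivity), one_div_one_div]
          linarith
        · simp only [Set.indicator_of_notMem hζ]
          have hm0 : 0 ≤ 1 / max (ζ.2.2 : ℝ) (1 / ((N : ℝ) + 1)) :=
            div_nonneg zero_le_one (le_max_of_le_left ζ.2.2.2.1)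
          linarith
    have h2 : ∫ ζ, (c0 + 1 - A.indicator (fun _ => ((N : ℝ) + 1)) ζ) ∂Q =
        ∫ ζ, (c0 + 1) ∂Q - ∫ ζ, A.indicator (fun _ => ((N : ℝ) + 1)) ζ ∂Q :=
      integral_sub (integrable_const _) ((integrable_const _).indicator hAm)
    rw [h2, integral_indicator hAm] at h1
    simp only [integral_const, probReal_univ, one_smul, smul_eq_mul, measureReal_restrict_apply_univ] at h1
    nlinarith [h N]
  have hz : Q.real A = 0 := by
    by_contra hne
    have hpos : 0 < Q.real A := lt_of_le_of_ne measureReal_nonneg (Ne.symm hne)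
    obtain ⟨N, hN⟩ := exists_nat_gt ((c0 + 1 - v) / Q.real A)
    rw [div_lt_iff₀ hpos] at hN
    nlinarith [key N]
  have hz' : Q A = 0 := by
    rwa [measureReal_eq_zero_iff] at hz
  rw [ae_iff]
  refine measure_mono_null (fun ζ hζ => ?_) hz'
  exact le_antisymm (not_lt.1 hζ) ζ.2.2.2.1

lemma extQ {s₀ : ℝ} (P : Set (Path n)) (hPsub : P ⊆ Omega n s₀) (hPclosed : IsClosed P)
    (μ : Fin n → Measure ℝ) (hprob : ∀ i, IsProbabilityMeasure (μ i))
    (hsupp : ∀ i, μ i (Set.Iio 0) = 0) (hmom : ∀ i, Integrable (fun x => x) (μ i))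
    (G : (Fin n → ℝ) → EReal) (hGtop : ∀ s, G s ≠ ⊤)
    (K : ℝ) (hG : ∀ s : Fin n → ℝ, (∀ i, 0 ≤ s i) → G s ≤ ((K * (1 + ∑ i, s i) : ℝ) : EReal))
    (βN : ℕ → Dyn n) (hN : ∀ k, (βN k).Nonneg) (v : ℝ)
    (hv : ∀ (X : Static n) (D : Dyn n), D.Nonneg →
      (∀ ω ∈ P, G (tailCoords ω) ≤ ((X.putPayoff ω + D.gains ω : ℝ) : EReal)) →
        v ≤ X.price (fun i K' => ∫ x, max (K' - x) 0 ∂(μ i))) :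
    ∃ (B : ℕ → ℝ) (Q : Measure (ZZ n)), (∀ k, 0 < B k) ∧ QProp P (max K 0) v B βN G Q ∧
      Q.map Prod.fst ∈ MSetP s₀ μ P := by
  have hκ : 0 ≤ max K 0 := le_max_right _ _
  set κ := max K 0 with hκd
  obtain ⟨B, hB, hBb⟩ : ∃ B : ℕ → ℝ, (∀ k, 0 < B k) ∧ ∀ k j x, (βN k).pos j x ≤ B k := by
    choose C hC using fun k j => (βN k).bdd j
    refine ⟨fun k => 1 + ∑ j, |C k j|, fun k => ?_, fun k j x => ?_⟩
    · have := Finset.sum_nonneg (s := Finset.univ) fun (j : Fin n) _ => abs_nonneg (C k j)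
      linarith
    · have := Finset.single_le_sum (s := Finset.univ) (f := fun j => |C k j|)
        (fun j _ => abs_nonneg (C k j)) (Finset.mem_univ j)
      have h2 := hC k j x
      beta_reduce at this ⊢
      linarith [le_abs_self ((βN k).pos j x), le_abs_self (C k j)]
  set F : Path n → EReal := fun ω => G (tailCoords ω) with hF
  obtain ⟨Q, hQp, hcl, hmar, hInteg, hhv, hsup⟩ := ext_duality (Z := ZZ n) Prod.fst continuous_fst
    fst_compact (zZ βN B F) (fun _ => rfl) hPsub μ hprob hsupp hmom
    F v hv (κ * (1 + n * s₀)) (safeDyn n κ)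
    (safeDyn_nonneg hκ) (fun ω hω => safe_superhedge hG ω (hPsub hω))
    (fun j => rZ βN B s₀ j) (fun j => measurable_rZ βN B s₀ j)
    (fun j => rhoZ j) (fun j => continuous_rhoZ j)
    (fun j ω hω => rho_zZ βN B F j ω (hPsub hω).1) (fun j ζ => truncP_castSucc j ζ.1)
  have hmem := ext_mem (Z := ZZ n) Prod.fst continuous_fst (zZ βN B F) (fun _ => rfl) hPsub hPclosed μ
    (fun j => rhoZ j) (fun j ζ => restr_truncP j j le_rfl ζ.1) Q hcl hmar hsup
  have hcu : Continuous (fun ζ : ZZ n => (ζ.2.2 : ℝ)) :=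
    continuous_subtype_val.comp (continuous_snd.comp continuous_snd)
  refine ⟨B, Q, hB, ⟨hQp, ?_, hInteg, ?_, ?_, ?_, ?_⟩, hmem⟩
  · exact hcl (Prod.fst ⁻¹' P) (hPclosed.preimage continuous_fst) fun ω hω => hω
  · refine upos_aux (κ := κ) (s₀ := s₀) (v := v) Q (κ * (1 + n * s₀)) fun N => ?_
    have hN0 : (0 : ℝ) < 1 / ((N : ℝ) + 1) := by positivity
    have hmp : ∀ ζ : ZZ n, 0 < max (ζ.2.2 : ℝ) (1 / ((N : ℝ) + 1)) :=
      fun ζ => lt_of_lt_of_le hN0 (le_max_right _ _)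
    have hcont : Continuous (fun ζ : ZZ n => κ * (1 + n * s₀) - (1 / max (ζ.2.2 : ℝ) (1 / ((N : ℝ) + 1)) - 1)) :=
      continuous_const.sub (Continuous.sub (Continuous.div continuous_const
            (hcu.max continuous_const) fun ζ => (hmp ζ).ne') continuous_const)
    refine hhv (BoundedContinuousFunction.ofNormedAddCommGroup _ hcont (|κ * (1 + n * s₀)| + ((N : ℝ) + 1) + 1)
      fun ζ => ?_) (safeDyn n κ) (safeDyn_nonneg hκ) fun ω hω => ?_
    · have hNp : (0 : ℝ) < (N : ℝ) + 1 := by positivity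
      have hm : 1 / max (ζ.2.2 : ℝ) (1 / ((N : ℝ) + 1)) ≤ (N : ℝ) + 1 := by
        rw [div_le_iff₀ (hmp ζ)]
        have := mul_le_mul_of_nonneg_left (le_max_right (ζ.2.2 : ℝ) (1 / ((N : ℝ) + 1))) hNp.le
        rw [mul_one_div_cancel hNp.ne'] at this
        exact this
      have hm0 : 0 ≤ 1 / max (ζ.2.2 : ℝ) (1 / ((N : ℝ) + 1)) := div_nonneg zero_le_one (hmp ζ).le
      rw [Real.norm_eq_abs, abs_le]
      constructor <;> linarith [neg_abs_le (κ * (1 + n * s₀)), le_abs_self (κ * (1 + n * s₀))]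
    · show F ω ≤ (((κ * (1 + n * s₀) - (1 / max ((uF (F ω)) : ℝ) (1 / ((N : ℝ) + 1)) - 1)) +
        (safeDyn n κ).gains ω : ℝ) : EReal)
      have hs := safe_superhedge hG ω (hPsub hω)
      rcases le_coe_of_sub_le (b := 0) (c := κ * (1 + n * s₀) + (safeDyn n κ).gains ω) (hGtop (tailCoords ω))
        (by simpa using hs) with hb | ⟨a, ha, hac⟩
      · have : F ω = ⊥ := hb
        rw [this]; exact bot_le
      · have hFa : F ω = (a : EReal) := ha
        rw [hFa, uF_coe, EReal.coe_le_coe_iff]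
        have hm0 : 0 ≤ max (-a) 0 := le_max_right _ _
        have hle : 1 / max (1 / (1 + max (-a) 0)) (1 / ((N : ℝ) + 1)) ≤ 1 + max (-a) 0 := by
          rw [div_le_iff₀ (lt_of_lt_of_le hN0 (le_max_right _ _))]
          have := mul_le_mul_of_nonneg_left (le_max_left (1 / (1 + max (-a) 0)) (1 / ((N : ℝ) + 1)))
            (show 0 ≤ 1 + max (-a) 0 by linarith)
          rw [mul_one_div_cancel (by linarith)] at this
          exact this
        have hg : 0 ≤ κ * (1 + n * s₀) + (safeDyn n κ).gains ω := by
          rw [safeDyn_gains, (hPsub hω).1]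
          have h0 : 0 ≤ ∑ i : Fin n, ω i.succ := Finset.sum_nonneg fun i _ => (hPsub hω).2 i.succ
          nlinarith
        rcases le_total a 0 with h | h
        · rw [max_eq_left (by linarith : (0:ℝ) ≤ -a)] at *
          linarith
        · rw [max_eq_right (by linarith : -a ≤ 0)] at *
          linarith
  · intro k h hh
    refine hcl {ζ : ZZ n | -1 ≤ (ζ.2.2 : ℝ) * (xZ B k n ζ + h ζ.1)} ?_ fun ω hω => ?_
    · exact isClosed_le continuous_const
        (hcu.mul ((continuous_xZ B k n).add (h.continuous.comp continuous_fst)))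
    · show -1 ≤ ((uF (F ω)) : ℝ) * (xZ B k n (zZ βN B F ω) + h ω)
      rw [xZ_zZ hN hB hBb]
      rcases le_coe_of_sub_le (hGtop _) (hh ω hω) with hb | ⟨a, ha, hac⟩
      · have : F ω = ⊥ := hb
        rw [this, uF_bot]; norm_num
      · have hFa : F ω = (a : EReal) := ha
        rw [hFa, uF_coe]
        have hm0 : 0 ≤ max (-a) 0 := le_max_right _ _
        rw [one_div, inv_mul_eq_div, le_div_iff₀ (by linarith)]
        linarith [le_max_left (-a) 0]
  · intro j hj A hA
    have := hsup ⟨j, hj⟩ A hA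
    convert this using 3 with ζ
    simp only [sZ]
    rw [← seqP_succ ζ.1 ⟨j, hj⟩, ← seqP_castSucc ζ.1 ⟨j, hj⟩]
  · intro k h hh w hwc hw01 hwρ hw0 hR
    obtain ⟨H, hH⟩ := mix_bcf κ B k h w hwc hw01 hR
    obtain ⟨D, hD, hDg⟩ := mix_dyn hPsub hN hB F hκ k w hwc hw01 hwρ
    have := hhv H D hD fun ω hω => by
      rw [hDg ω hω, hH]
      rcases le_coe_of_sub_le (hGtop _) (hh ω hω) with hb | ⟨a, ha, hac⟩
      · have : F ω = ⊥ := hb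
        rw [this]; exact bot_le
      · have hFa : F ω = (a : EReal) := ha
        have hT : G (tailCoords ω) ≤ ((tZ κ n (zZ βN B F ω) : ℝ) : EReal) :=
          le_tZ_n hG (zZ βN B F ω) (hPsub hω)
        rw [ha, EReal.coe_le_coe_iff] at hT
        rw [hFa, EReal.coe_le_coe_iff]
        rw [← xZ_zZ hN hB hBb F] at hac
        have hab := abel_mix κ B k (zZ βN B F ω) (fun i => w i (zZ βN B F ω)) (hw0 _) n
        beta_reduce at hab
        have h1 := hw01 n (zZ βN B F ω)
        have h2 : a - xZ B k n (zZ βN B F ω) ≤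
            max (min (h (zZ βN B F ω).1) (tZ κ n (zZ βN B F ω) - xZ B k n (zZ βN B F ω))) (-‖h‖) :=
          le_max_of_le_left (le_min hac (by linarith))
        have h3 := mul_le_mul_of_nonneg_left h2 h1.1
        have h4 : 0 ≤ (1 - w n (zZ βN B F ω)) * (tZ κ n (zZ βN B F ω) - a) :=
          mul_nonneg (by linarith [h1.2]) (by linarith)
        nlinarith
    rw [integral_congr_ae (Eventually.of_forall hH)] at this
    exact this

end PartTwoC
end FileI3

section FileI4
section PartTwoD
variable {n : ℕ}
open scoped BoundedContinuousFunction

lemma integrable_sZ {P : Set (Path n)} {κ v : ℝ} {B : ℕ → ℝ} {βN : ℕ → Dyn n}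
    {G : (Fin n → ℝ) → EReal} {Q : Measure (ZZ n)} (hQ : QProp P κ v B βN G Q) (j : ℕ) :
    Integrable (fun ζ => sZ j ζ) Q := by
  unfold sZ seqP
  by_cases h : j < n + 1
  · simp only [h, dif_pos]; exact hQ.int _
  · simp only [h, dif_neg, not_false_eq_true]; exact integrable_zero _ _ _

lemma sup_zero {P : Set (Path n)} {κ v : ℝ} {B : ℕ → ℝ} {βN : ℕ → Dyn n}
    {G : (Fin n → ℝ) → EReal} {Q : Measure (ZZ n)} (hQ : QProp P κ v B βN G Q) {j : ℕ} (hj : j < n)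
    {A : Set (ZZ n)} (hA : MeasurableSet A)
    (h : ∀ᵐ ζ ∂Q, rhoZ j ζ ∈ A → 0 ≤ sZ (j + 1) ζ - sZ j ζ) :
    ∀ᵐ ζ ∂Q, rhoZ j ζ ∈ A → sZ (j + 1) ζ - sZ j ζ = 0 := by
  have hm : MeasurableSet {ζ : ZZ n | rhoZ j ζ ∈ A} := (continuous_rhoZ j).measurable hA
  have heq : (fun ζ : ZZ n => A.indicator (fun _ => (1 : ℝ)) (rhoZ j ζ) * (sZ (j + 1) ζ - sZ j ζ)) =
      {ζ : ZZ n | rhoZ j ζ ∈ A}.indicator (fun ζ => sZ (j + 1) ζ - sZ j ζ) := by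
    funext ζ
    by_cases hζ : rhoZ j ζ ∈ A
    · rw [Set.indicator_of_mem hζ, Set.indicator_of_mem (by exact hζ), one_mul]
    · rw [Set.indicator_of_notMem hζ, Set.indicator_of_notMem (by exact hζ), zero_mul]
  have hInteg : Integrable (fun ζ : ZZ n => A.indicator (fun _ => (1 : ℝ)) (rhoZ j ζ) * (sZ (j + 1) ζ - sZ j ζ)) Q := by
    rw [heq]
    exact ((integrable_sZ hQ (j + 1)).sub (integrable_sZ hQ j)).indicator hm
  have hnn : 0 ≤ᵐ[Q] (fun ζ : ZZ n => A.indicator (fun _ => (1 : ℝ)) (rhoZ j ζ) * (sZ (j + 1) ζ - sZ j ζ)) := by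
    filter_upwards [h] with ζ hζ
    by_cases hA' : rhoZ j ζ ∈ A
    · simp only [Set.indicator_of_mem hA', one_mul]; exact hζ hA'
    · simp only [Set.indicator_of_notMem hA', zero_mul]; exact le_rfl
  have h0 := (integral_eq_zero_iff_of_nonneg_ae hnn hInteg).1
    (le_antisymm (hQ.sup j hj A hA) (integral_nonneg_of_ae hnn))
  filter_upwards [h0] with ζ hζ hA'
  simpa [Set.indicator_of_mem hA'] using hζ

lemma bddBelow_iff_nat (f : ℕ → ℝ) : BddBelow (range f) ↔ ∃ N : ℕ, ∀ k, -(N : ℝ) ≤ f k := by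
  constructor
  · rintro ⟨c, hc⟩
    obtain ⟨N, hN⟩ := exists_nat_ge (-c)
    exact ⟨N, fun k => by linarith [hc (mem_range_self k)]⟩
  · rintro ⟨N, hN⟩
    exact ⟨-(N : ℝ), by rintro _ ⟨k, rfl⟩; exact hN k⟩

lemma bddAbove_iff_nat (f : ℕ → ℝ) : BddAbove (range f) ↔ ∃ N : ℕ, ∀ k, f k ≤ N := by
  constructor
  · rintro ⟨c, hc⟩
    obtain ⟨N, hN⟩ := exists_nat_ge c
    exact ⟨N, fun k => by linarith [hc (mem_range_self k)]⟩
  · rintro ⟨N, hN⟩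
    exact ⟨(N : ℝ), by rintro _ ⟨k, rfl⟩; exact hN k⟩

lemma meas_bddBelow {f : ℕ → ZZ n → ℝ} (hf : ∀ k, Continuous (f k)) :
    MeasurableSet {ζ | BddBelow (range fun k => f k ζ)} := by
  simp only [bddBelow_iff_nat, setOf_exists, setOf_forall]
  exact MeasurableSet.iUnion fun N => MeasurableSet.iInter fun k =>
    measurableSet_le measurable_const (hf k).measurable

lemma meas_bddAbove {f : ℕ → ZZ n → ℝ} (hf : ∀ k, Continuous (f k)) :
    MeasurableSet {ζ | BddAbove (range fun k => f k ζ)} := by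
  simp only [bddAbove_iff_nat, setOf_exists, setOf_forall]
  exact MeasurableSet.iUnion fun N => MeasurableSet.iInter fun k =>
    measurableSet_le (hf k).measurable measurable_const

lemma xZ_succ (B : ℕ → ℝ) (k j : ℕ) (ζ : ZZ n) :
    xZ B k (j + 1) ζ = xZ B k j ζ + yZ B k j ζ * (sZ (j + 1) ζ - sZ j ζ) := by
  unfold xZ; rw [Finset.sum_range_succ]

lemma noArb_n {P : Set (Path n)} {κ v : ℝ} {B : ℕ → ℝ} {βN : ℕ → Dyn n}
    {G : (Fin n → ℝ) → EReal} {Q : Measure (ZZ n)} (hQ : QProp P κ v B βN G Q)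
    (hr : ∀ k, ∃ h : ℕ → Path n →ᵇ ℝ,
      (∀ r, ∀ ω ∈ P, G (tailCoords ω) - (((βN k).gains ω : ℝ) : EReal) ≤ ((h r ω : ℝ) : EReal)) ∧
      ∀ ω ∈ P, Tendsto (fun r => ((h r ω : ℝ) : EReal)) atTop
        (𝓝 (G (tailCoords ω) - (((βN k).gains ω : ℝ) : EReal))))
    (f : Path n → EReal) (hft : ∀ ω, f ω ≠ ⊤)
    (hlim : ∀ ω ∈ P, Tendsto (fun N => G (tailCoords ω) - (((βN N).gains ω : ℝ) : EReal)) atTop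
            (𝓝 (f ω))) :
    ∀ᵐ ζ ∂Q, BddBelow (range fun k => xZ B k n ζ) := by
  choose h h1 h2 using hr
  have hall : ∀ᵐ ζ ∂Q, ∀ k r, -1 ≤ (ζ.2.2 : ℝ) * (xZ B k n ζ + h k r ζ.1) :=
    ae_all_iff.2 fun k => ae_all_iff.2 fun r => hQ.low k (h k r) (h1 k r)
  filter_upwards [hall, hQ.upos, hQ.mem] with ζ hζ hu hP
  have hge : ∀ k, ((-1 / (ζ.2.2 : ℝ) - xZ B k n ζ : ℝ) : EReal) ≤
      G (tailCoords ζ.1) - (((βN k).gains ζ.1 : ℝ) : EReal) := by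
    intro k
    refine ge_of_tendsto (h2 k ζ.1 hP) (Eventually.of_forall fun r => EReal.coe_le_coe_iff.2 ?_)
    have := hζ k r
    rw [← div_le_iff₀' hu] at this
    linarith
  obtain ⟨c, hc, -⟩ := EReal.lt_iff_exists_real_btwn.1 (lt_top_iff_ne_top.2 (hft ζ.1))
  have hev := (hlim ζ.1 hP).eventually (gt_mem_nhds hc)
  refine Filter.IsBoundedUnder.bddBelow_range (f := fun k => xZ B k n ζ) ⟨-1 / (ζ.2.2 : ℝ) - c, ?_⟩
  rw [eventually_map]
  filter_upwards [hev] with k hk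
  have := (hge k).trans hk.le
  rw [EReal.coe_le_coe_iff] at this
  linarith

lemma noArb_below {P : Set (Path n)} {κ v : ℝ} {B : ℕ → ℝ} (hB : ∀ k, 0 < B k) {βN : ℕ → Dyn n}
    {G : (Fin n → ℝ) → EReal} {Q : Measure (ZZ n)} (hQ : QProp P κ v B βN G Q)
    (hn : ∀ᵐ ζ ∂Q, BddBelow (range fun k => xZ B k n ζ)) :
    ∀ m j, j + m = n → ∀ᵐ ζ ∂Q, BddBelow (range fun k => xZ B k j ζ) := by
  intro m
  induction m with
  | zero => intro j hj; rw [add_zero] at hj; rw [hj]; exact hn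
  | succ m ih =>
    intro j hj
    have hb := ih (j + 1) (by omega)
    have hAm : MeasurableSet {ζ : ZZ n | ¬ BddBelow (range fun k => xZ B k j ζ)} :=
      (meas_bddBelow fun k => continuous_xZ B k j).compl
    have hcon : ∀ ζ : ZZ n, BddBelow (range fun k => xZ B k (j + 1) ζ) →
        ¬ BddBelow (range fun k => xZ B k j ζ) → 0 < sZ (j + 1) ζ - sZ j ζ := by
      rintro ζ ⟨c, hc⟩ hA
      by_contra hneg
      refine hA ⟨c, ?_⟩
      rintro _ ⟨k, rfl⟩
      have h1 : c ≤ xZ B k (j + 1) ζ := hc (mem_range_self k)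
      rw [xZ_succ] at h1
      have h2 := mul_nonpos_of_nonneg_of_nonpos (yZ_nonneg hB k j ζ) (not_lt.1 hneg)
      show c ≤ xZ B k j ζ
      linarith
    have hiff : ∀ ζ : ZZ n, rhoZ j ζ ∈ {ζ : ZZ n | ¬ BddBelow (range fun k => xZ B k j ζ)} ↔
        ¬ BddBelow (range fun k => xZ B k j ζ) := by
      intro ζ; simp only [mem_setOf_eq, xZ_rho B _ (le_refl j)]
    have hz := sup_zero hQ (j := j) (by omega) hAm (by
      filter_upwards [hb] with ζ hζ hA
      exact (hcon ζ hζ ((hiff ζ).1 hA)).le)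
    filter_upwards [hb, hz] with ζ h1 h2
    by_contra h3
    exact (hcon ζ h1 h3).ne' (h2 ((hiff ζ).2 h3))

lemma noArb {P : Set (Path n)} {κ v : ℝ} {B : ℕ → ℝ} (hB : ∀ k, 0 < B k) {βN : ℕ → Dyn n}
    {G : (Fin n → ℝ) → EReal} {Q : Measure (ZZ n)} (hQ : QProp P κ v B βN G Q)
    (hn : ∀ᵐ ζ ∂Q, BddBelow (range fun k => xZ B k n ζ)) :
    ∀ j < n, ∀ᵐ ζ ∂Q, BddAbove (range fun k => yZ B k j ζ) ∨ sZ (j + 1) ζ - sZ j ζ = 0 := by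
  have step : ∀ j < n, (∀ᵐ ζ ∂Q, BddAbove (range fun k => xZ B k j ζ)) →
      ∀ᵐ ζ ∂Q, BddAbove (range fun k => yZ B k j ζ) ∨ sZ (j + 1) ζ - sZ j ζ = 0 := by
    intro j hj ha
    have hb := noArb_below hB hQ hn (n - (j + 1)) (j + 1) (by omega)
    have hAm : MeasurableSet {ζ : ZZ n | ¬ BddAbove (range fun k => yZ B k j ζ)} :=
      (meas_bddAbove fun k => continuous_yZ B k j).compl
    have hiff : ∀ ζ : ZZ n, rhoZ j ζ ∈ {ζ : ZZ n | ¬ BddAbove (range fun k => yZ B k j ζ)} ↔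
        ¬ BddAbove (range fun k => yZ B k j ζ) := by
      intro ζ; simp only [mem_setOf_eq, yZ_rho B _ (le_refl j)]
    have hz := sup_zero hQ hj hAm (by
      filter_upwards [hb, ha] with ζ hζ hζ2 hA
      replace hA := (hiff ζ).1 hA
      obtain ⟨c, hc⟩ := hζ
      obtain ⟨d, hd⟩ := hζ2
      by_contra hneg
      refine hA ⟨(d - c) / (-(sZ (j + 1) ζ - sZ j ζ)), ?_⟩
      rintro _ ⟨k, rfl⟩
      have h1 : c ≤ xZ B k (j + 1) ζ := hc (mem_range_self k)
      have h2 : xZ B k j ζ ≤ d := hd (mem_range_self k)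
      rw [xZ_succ] at h1
      show yZ B k j ζ ≤ _
      rw [le_div_iff₀ (by linarith [not_le.1 hneg])]
      linarith)
    filter_upwards [hz] with ζ hζ
    by_cases h : BddAbove (range fun k => yZ B k j ζ)
    · exact Or.inl h
    · exact Or.inr (hζ ((hiff ζ).2 h))
  have hab : ∀ j ≤ n, ∀ᵐ ζ ∂Q, BddAbove (range fun k => xZ B k j ζ) := by
    intro j
    induction j with
    | zero => intro _; exact Eventually.of_forall fun ζ => ⟨0, by rintro _ ⟨k, rfl⟩; simp [xZ]⟩
    | succ j ih =>
      intro hj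
      have h1 := ih (by omega)
      filter_upwards [h1, step j (by omega) h1] with ζ ha hs
      obtain ⟨d, hd⟩ := ha
      rcases hs with ⟨Y, hY⟩ | hs
      · refine ⟨d + Y * |sZ (j + 1) ζ - sZ j ζ|, ?_⟩
        rintro _ ⟨k, rfl⟩
        have h2 : xZ B k j ζ ≤ d := hd (mem_range_self k)
        have h3 : yZ B k j ζ ≤ Y := hY (mem_range_self k)
        show xZ B k (j + 1) ζ ≤ _
        rw [xZ_succ]
        have h4 := mul_le_mul_of_nonneg_left (le_abs_self (sZ (j + 1) ζ - sZ j ζ)) (yZ_nonneg hB k j ζ)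
        have h5 := mul_le_mul_of_nonneg_right h3 (abs_nonneg (sZ (j + 1) ζ - sZ j ζ))
        linarith
      · refine ⟨d, ?_⟩
        rintro _ ⟨k, rfl⟩
        have h2 : xZ B k j ζ ≤ d := hd (mem_range_self k)
        show xZ B k (j + 1) ζ ≤ _
        rw [xZ_succ, hs, mul_zero, add_zero]; exact h2
  exact fun j hj => step j hj (hab j hj.le)

end PartTwoD
end FileI4

section FileI5
section PartTwoE
variable {n : ℕ}
open scoped BoundedContinuousFunction

def aZ (B M : ℕ → ℝ) (j : ℕ) : Set (ZZ n) :=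
  {ζ | BddAbove (range fun k => yZ B k j ζ) ∧ ∃ k, M j < yZ B k j ζ}

def eZ (κ : ℝ) (M : ℕ → ℝ) (j : ℕ) (ζ : ZZ n) : ℝ :=
  tZ κ j ζ + ∑ i ∈ Finset.range j, M i * sZ i ζ

lemma meas_aZ (B M : ℕ → ℝ) (j : ℕ) : MeasurableSet (aZ B M j : Set (ZZ n)) := by
  have : (aZ B M j : Set (ZZ n)) = {ζ | BddAbove (range fun k => yZ B k j ζ)} ∩
      ⋃ k, {ζ | M j < yZ B k j ζ} := by
    ext ζ; simp [aZ]
  rw [this]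
  refine (meas_bddAbove fun k => continuous_yZ B k j).inter ?_
  exact MeasurableSet.iUnion fun k => measurableSet_lt measurable_const (continuous_yZ B k j).measurable

lemma aZ_rho (B M : ℕ → ℝ) (j : ℕ) (ζ : ZZ n) : rhoZ j ζ ∈ aZ B M j ↔ ζ ∈ aZ B M j := by
  simp only [aZ, mem_setOf_eq, yZ_rho B _ (le_refl j)]

lemma sZ_nonneg {s₀ : ℝ} {ζ : ZZ n} (h : ζ.1 ∈ Omega n s₀) (i : ℕ) : 0 ≤ sZ i ζ := by
  unfold sZ seqP
  split_ifs
  · exact h.2 _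
  · exact le_rfl

lemma continuous_eZ (κ : ℝ) (M : ℕ → ℝ) (j : ℕ) : Continuous (eZ κ M j : ZZ n → ℝ) := by
  unfold eZ
  exact (continuous_tZ κ j).add (continuous_finset_sum _ fun i _ => continuous_const.mul (continuous_sZ i))

section
variable {P : Set (Path n)} {κ v : ℝ} {B : ℕ → ℝ} {βN : ℕ → Dyn n}
    {G : (Fin n → ℝ) → EReal} {Q : Measure (ZZ n)}

lemma integrable_tZ (hQ : QProp P κ v B βN G Q) (j : ℕ) : Integrable (fun ζ => tZ κ j ζ) Q := by
  haveI := hQ.prob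
  unfold tZ
  exact (((integrable_const _).add (integrable_finset_sum _ fun i _ => integrable_sZ hQ (i + 1))).add
    ((integrable_sZ hQ j).const_mul _)).const_mul _

lemma integrable_eZ (hQ : QProp P κ v B βN G Q) (M : ℕ → ℝ) (j : ℕ) : Integrable (fun ζ => eZ κ M j ζ) Q := by
  unfold eZ
  exact (integrable_tZ hQ j).add (integrable_finset_sum _ fun i _ => (integrable_sZ hQ i).const_mul _)

lemma integrable_xZ (hB : ∀ k, 0 < B k) (hQ : QProp P κ v B βN G Q) (k j : ℕ) :
    Integrable (fun ζ => xZ B k j ζ) Q := by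
  unfold xZ
  refine integrable_finset_sum _ fun i _ => ?_
  refine Integrable.bdd_mul (c := B k) ((integrable_sZ hQ (i + 1)).sub (integrable_sZ hQ i))
    (continuous_yZ B k i).aestronglyMeasurable (Eventually.of_forall fun ζ => ?_)
  rw [Real.norm_eq_abs, abs_of_nonneg (yZ_nonneg hB k i ζ)]
  exact yZ_le hB k i ζ

/-- cut-off weights -/
def vZ (φ : ℕ → ℕ → ZZ n →ᵇ ℝ) (m i : ℕ) (ζ : ZZ n) : ℝ :=
  1 - max 0 (min 1 ((m : ℝ) + 2 - ‖(rhoZ i ζ).1‖)) * φ i m (rhoZ i ζ)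

def wZ (φ : ℕ → ℕ → ZZ n →ᵇ ℝ) (m i : ℕ) (ζ : ZZ n) : ℝ := ∏ l ∈ Finset.range i, vZ φ m l ζ

lemma continuous_vZ (φ : ℕ → ℕ → ZZ n →ᵇ ℝ) (m i : ℕ) : Continuous (vZ φ m i) := by
  unfold vZ
  have h1 := continuous_rhoZ (n := n) i
  have h2 : Continuous fun ζ : ZZ n => (rhoZ i ζ).1 := continuous_fst.comp h1
  have h3 : Continuous fun ζ : ZZ n => φ i m (rhoZ i ζ) := (φ i m).continuous.comp h1
  fun_prop

lemma vZ_mem {φ : ℕ → ℕ → ZZ n →ᵇ ℝ} (hφ : ∀ i m x, 0 ≤ φ i m x ∧ φ i m x ≤ 1) (m i : ℕ) (ζ : ZZ n) :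
    vZ φ m i ζ ∈ Icc (0 : ℝ) 1 := by
  unfold vZ
  have h1 := hφ i m (rhoZ i ζ)
  set c := max 0 (min 1 ((m : ℝ) + 2 - ‖(rhoZ i ζ).1‖))
  have h2 : 0 ≤ c := le_max_left _ _
  have h3 : c ≤ 1 := max_le zero_le_one (min_le_left _ _)
  constructor
  · nlinarith [h1.1, h1.2]
  · nlinarith [h1.1, h1.2]

lemma wZ_mem {φ : ℕ → ℕ → ZZ n →ᵇ ℝ} (hφ : ∀ i m x, 0 ≤ φ i m x ∧ φ i m x ≤ 1) (m i : ℕ) (ζ : ZZ n) :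
    wZ φ m i ζ ∈ Icc (0 : ℝ) 1 :=
  ⟨Finset.prod_nonneg fun l _ => (vZ_mem hφ m l ζ).1,
    Finset.prod_le_one (fun l _ => (vZ_mem hφ m l ζ).1) fun l _ => (vZ_mem hφ m l ζ).2⟩

lemma wZ_rho (φ : ℕ → ℕ → ZZ n →ᵇ ℝ) (m i : ℕ) (ζ : ZZ n) :
    wZ φ m (i + 1) (rhoZ i ζ) = wZ φ m (i + 1) ζ := by
  unfold wZ
  refine Finset.prod_congr rfl fun l hl => ?_
  have := Finset.mem_range.1 hl
  unfold vZ
  rw [rhoZ_rhoZ (by omega)]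

lemma wZ_diff (φ : ℕ → ℕ → ZZ n →ᵇ ℝ) (m j : ℕ) (ζ : ZZ n) (h : wZ φ m j ζ - wZ φ m (j + 1) ζ ≠ 0) :
    ‖(rhoZ j ζ).1‖ ≤ (m : ℝ) + 2 := by
  by_contra hc
  apply h
  have : vZ φ m j ζ = 1 := by
    unfold vZ
    rw [max_eq_left ((min_le_right _ _).trans (by linarith [not_le.1 hc]))]
    ring
  unfold wZ
  rw [Finset.prod_range_succ, this]; ring

def WZ (B M : ℕ → ℝ) (i : ℕ) (ζ : ZZ n) : ℝ := ∏ l ∈ Finset.range i, (1 - (aZ B M l).indicator (fun _ => (1 : ℝ)) ζ)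

lemma WZ_eq (B M : ℕ → ℝ) (i : ℕ) (ζ : ZZ n) :
    WZ B M i ζ = if ∀ j < i, ζ ∉ aZ B M j then 1 else 0 := by
  unfold WZ
  have h : ∀ l, (1 - (aZ B M l).indicator (fun _ => (1 : ℝ)) ζ) = if ζ ∉ aZ B M l then 1 else 0 := by
    intro l
    by_cases hl : ζ ∈ aZ B M l <;> simp [hl]
  simp only [h, Finset.prod_ite_zero, Finset.mem_range, Finset.prod_const_one]

lemma sub_xZ_le {s₀ : ℝ} (hB : ∀ k, 0 < B k) {M : ℕ → ℝ} (hM : ∀ i, 0 ≤ M i) {ζ : ZZ n} (hζ : ζ.1 ∈ Omega n s₀)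
    (hno : ∀ i < n, BddAbove (range fun k => yZ B k i ζ) ∨ sZ (i + 1) ζ - sZ i ζ = 0) {j : ℕ} (hj : j ≤ n)
    (hA : ∀ i < j, ζ ∉ aZ B M i) (k : ℕ) : tZ κ j ζ - xZ B k j ζ ≤ eZ κ M j ζ := by
  unfold eZ xZ
  have : -∑ i ∈ Finset.range j, yZ B k i ζ * (sZ (i + 1) ζ - sZ i ζ) ≤ ∑ i ∈ Finset.range j, M i * sZ i ζ := by
    rw [← Finset.sum_neg_distrib]
    refine Finset.sum_le_sum fun i hi => ?_
    have hi := Finset.mem_range.1 hi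
    have hs := sZ_nonneg hζ i
    have hs' := sZ_nonneg hζ (i + 1)
    have hy := yZ_nonneg hB k i ζ
    rcases hno i (by omega) with h | h
    · have hle : yZ B k i ζ ≤ M i := by
        by_contra hc
        exact hA i hi ⟨h, k, not_le.1 hc⟩
      have h1 := mul_le_mul_of_nonneg_right hle hs
      have h2 := mul_nonneg hy hs'
      nlinarith
    · rw [h, mul_zero, neg_zero]; exact mul_nonneg (hM i) hs
  linarith

lemma integrable_cut (hQ : QProp P κ v B βN G Q) (M : ℕ → ℝ) (h : Path n →ᵇ ℝ) :
    Integrable (fun ζ : ZZ n => if ∀ j < n, ζ ∉ aZ B M j then min (h ζ.1) (eZ κ M n ζ) else 0) Q := by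
  haveI := hQ.prob
  have hNm : MeasurableSet {ζ : ZZ n | ∀ j < n, ζ ∉ aZ B M j} := by
    simp only [setOf_forall]
    exact MeasurableSet.iInter fun j => MeasurableSet.iInter fun _ => (meas_aZ B M j).compl
  have := (((h.compContinuous ⟨_, continuous_fst⟩ : ZZ n →ᵇ ℝ).integrable Q).inf (integrable_eZ hQ M n)).indicator hNm
  refine this.congr (Eventually.of_forall fun ζ => ?_)
  beta_reduce
  by_cases hζ : ∀ j < n, ζ ∉ aZ B M j
  · rw [if_pos hζ, indicator_of_mem (by exact hζ)]; rfl
  · rw [if_neg hζ, indicator_of_notMem (by exact hζ)]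

lemma mixlim {s₀ : ℝ} (hPsub : P ⊆ Omega n s₀) (hκ : 0 ≤ κ) (hB : ∀ k, 0 < B k) (hQ : QProp P κ v B βN G Q)
    (hno : ∀ j < n, ∀ᵐ ζ ∂Q, BddAbove (range fun k => yZ B k j ζ) ∨ sZ (j + 1) ζ - sZ j ζ = 0)
    {M : ℕ → ℝ} (hM : ∀ i, 0 ≤ M i) (k : ℕ) (h : Path n →ᵇ ℝ)
    (hh : ∀ ω ∈ P, G (tailCoords ω) - (((βN k).gains ω : ℝ) : EReal) ≤ ((h ω : ℝ) : EReal)) :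
    v ≤ ∫ ζ, (∑ j ∈ Finset.range n, (aZ B M j).indicator (eZ κ M j) ζ +
      if ∀ j < n, ζ ∉ aZ B M j then min (h ζ.1) (eZ κ M n ζ) else 0) ∂Q := by
  haveI := hQ.prob
  have hno' : ∀ᵐ ζ ∂Q, ∀ j < n, BddAbove (range fun k => yZ B k j ζ) ∨ sZ (j + 1) ζ - sZ j ζ = 0 := by
    rw [ae_all_iff]; intro j
    by_cases hj : j < n
    · filter_upwards [hno j hj] with ζ hζ _; exact hζ
    · exact Eventually.of_forall fun ζ h => absurd h hj
  have hex : ∀ i, ∃ φ : ℕ → ZZ n →ᵇ ℝ, (∀ m x, 0 ≤ φ m x ∧ φ m x ≤ 1) ∧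
      ∀ᵐ ζ ∂Q, Tendsto (fun m => φ m (rhoZ i ζ)) atTop (𝓝 ((aZ B M i).indicator (fun _ => 1) ζ)) := by
    intro i
    obtain ⟨φ, h1, h2⟩ := approx_indicator (Q.map (rhoZ i)) (aZ B M i) (meas_aZ B M i)
    refine ⟨φ, h1, ?_⟩
    filter_upwards [ae_of_ae_map (continuous_rhoZ i).measurable.aemeasurable h2] with ζ hζ
    have : (aZ B M i).indicator (fun _ => (1:ℝ)) (rhoZ i ζ) = (aZ B M i).indicator (fun _ => 1) ζ := by
      by_cases hm : ζ ∈ aZ B M i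
      · rw [indicator_of_mem hm, indicator_of_mem ((aZ_rho B M i ζ).2 hm)]
      · rw [indicator_of_notMem hm, indicator_of_notMem (fun h => hm ((aZ_rho B M i ζ).1 h))]
    rw [← this]; exact hζ
  choose φ hφ hφt using hex
  have hwt : ∀ᵐ ζ ∂Q, ∀ i, Tendsto (fun m => wZ φ m i ζ) atTop (𝓝 (WZ B M i ζ)) := by
    filter_upwards [ae_all_iff.2 hφt] with ζ hζ i
    refine tendsto_finset_prod _ fun l _ => tendsto_const_nhds.sub ?_
    have hχ : Tendsto (fun m : ℕ => max 0 (min 1 ((m : ℝ) + 2 - ‖(rhoZ l ζ).1‖))) atTop (𝓝 1) := by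
      refine tendsto_const_nhds.congr' ?_
      obtain ⟨N, hN⟩ := exists_nat_ge ‖(rhoZ l ζ).1‖
      filter_upwards [eventually_ge_atTop N] with m hm
      have : (N : ℝ) ≤ m := by exact_mod_cast hm
      rw [min_eq_left (by linarith), max_eq_right zero_le_one]
    simpa using hχ.mul (hζ l)
  set t : ZZ n → ℝ := fun ζ => max (min (h ζ.1) (tZ κ n ζ - xZ B k n ζ)) (-‖h‖) with ht
  have htc : Continuous t := ((h.continuous.comp continuous_fst).min
    ((continuous_tZ κ n).sub (continuous_xZ B k n))).max continuous_const
  have htb : ∀ ζ, |t ζ| ≤ ‖h‖ := fun ζ => by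
    rw [abs_le]
    refine ⟨le_max_right _ _, max_le ((min_le_left _ _).trans ((le_abs_self _).trans ?_)) ?_⟩
    · exact h.norm_coe_le_norm ζ.1
    · linarith [norm_nonneg h]
  have hvm : ∀ m, v ≤ ∫ ζ, (∑ j ∈ Finset.range n, (wZ φ m j ζ - wZ φ m (j + 1) ζ) * (tZ κ j ζ - xZ B k j ζ)
      + wZ φ m n ζ * t ζ) ∂Q := fun m =>
    hQ.mix k h hh (wZ φ m) (fun i => continuous_finset_prod _ fun l _ => continuous_vZ φ m l)
      (fun i ζ => wZ_mem hφ m i ζ) (fun i ζ => wZ_rho φ m i ζ) (fun ζ => by simp [wZ])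
      (fun j _ => ⟨m + 2, fun ζ hζ => wZ_diff φ m j ζ hζ⟩)
  have hwc : ∀ m i, Continuous (wZ φ m i) := fun m i => continuous_finset_prod _ fun l _ => continuous_vZ φ m l
  have hlim : Tendsto (fun m => ∫ ζ, (∑ j ∈ Finset.range n, (wZ φ m j ζ - wZ φ m (j + 1) ζ) * (tZ κ j ζ - xZ B k j ζ)
      + wZ φ m n ζ * t ζ) ∂Q) atTop (𝓝 (∫ ζ, (∑ j ∈ Finset.range n, (WZ B M j ζ - WZ B M (j + 1) ζ) *
        (tZ κ j ζ - xZ B k j ζ) + WZ B M n ζ * t ζ) ∂Q)) := by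
    refine tendsto_integral_of_dominated_convergence
      (fun ζ => ∑ j ∈ Finset.range n, |tZ κ j ζ - xZ B k j ζ| + ‖h‖) (fun m => ?_) ?_ (fun m => ?_) ?_
    · refine Continuous.aestronglyMeasurable ?_
      exact (continuous_finset_sum _ fun j _ => ((hwc m j).sub (hwc m (j + 1))).mul
        ((continuous_tZ κ j).sub (continuous_xZ B k j))).add ((hwc m n).mul htc)
    · exact (integrable_finset_sum _ fun j _ => ((integrable_tZ hQ j).sub (integrable_xZ hB hQ k j)).abs).add
        (integrable_const _)
    · refine Eventually.of_forall fun ζ => ?_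
      rw [Real.norm_eq_abs]
      refine (abs_add_le _ _).trans (add_le_add ((Finset.abs_sum_le_sum_abs _ _).trans
        (Finset.sum_le_sum fun j hj => ?_)) ?_)
      · rw [abs_mul]
        refine mul_le_of_le_one_left (abs_nonneg _) ?_
        have h1 := wZ_mem hφ m j ζ
        have h2 := wZ_mem hφ m (j + 1) ζ
        rw [abs_le]; constructor <;> linarith [h1.1, h1.2, h2.1, h2.2]
      · rw [abs_mul, abs_of_nonneg (wZ_mem hφ m n ζ).1]
        exact (mul_le_of_le_one_left (abs_nonneg _) (wZ_mem hφ m n ζ).2).trans (htb ζ)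
    · filter_upwards [hwt] with ζ hζ
      exact (tendsto_finset_sum _ fun j _ => ((hζ j).sub (hζ (j + 1))).mul_const _).add ((hζ n).mul_const _)
  have hvl := ge_of_tendsto hlim (Eventually.of_forall hvm)
  refine hvl.trans (integral_mono_ae ?_ ?_ ?_)
  · have hWm : ∀ i, Measurable (WZ B M i : ZZ n → ℝ) := fun i => Finset.measurable_prod _ fun l _ =>
      measurable_const.sub (measurable_const.indicator (meas_aZ B M l))
    have hWb : ∀ i (ζ : ZZ n), 0 ≤ WZ B M i ζ ∧ WZ B M i ζ ≤ 1 := fun i ζ => by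
      rw [WZ_eq]; split_ifs <;> simp
    refine Integrable.add (integrable_finset_sum _ fun j _ => ?_) ?_
    · refine Integrable.bdd_mul (c := 1) ((integrable_tZ hQ j).sub (integrable_xZ hB hQ k j))
        ((hWm j).sub (hWm (j + 1))).aestronglyMeasurable (Eventually.of_forall fun ζ => ?_)
      rw [Real.norm_eq_abs, abs_le]
      constructor <;> linarith [(hWb j ζ).1, (hWb j ζ).2, (hWb (j+1) ζ).1, (hWb (j+1) ζ).2]
    · refine Integrable.of_bound (C := ‖h‖) ((hWm n).mul htc.measurable).aestronglyMeasurable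
        (Eventually.of_forall fun ζ => ?_)
      rw [Real.norm_eq_abs, abs_mul, abs_of_nonneg (hWb n ζ).1]
      exact (mul_le_of_le_one_left (abs_nonneg _) (hWb n ζ).2).trans (htb ζ)
  · refine Integrable.add (integrable_finset_sum _ fun j _ => (integrable_eZ hQ M j).indicator (meas_aZ B M j)) ?_
    exact integrable_cut hQ M h
  · filter_upwards [hQ.mem, hno'] with ζ hP hn'
    have hΩ := hPsub hP
    have he0 : ∀ j ≤ n, 0 ≤ eZ κ M j ζ := fun j hj =>
      add_nonneg (tZ_nonneg hκ (sZ_nonneg hΩ) hj)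
        (Finset.sum_nonneg fun i _ => mul_nonneg (hM i) (sZ_nonneg hΩ i))
    refine add_le_add (Finset.sum_le_sum fun j hj => ?_) ?_
    · have hj := Finset.mem_range.1 hj
      have hW : WZ B M (j + 1) ζ = WZ B M j ζ * (1 - (aZ B M j).indicator (fun _ => (1 : ℝ)) ζ) := by
        unfold WZ; rw [Finset.prod_range_succ]
      rw [hW]
      by_cases hA : ζ ∈ aZ B M j
      · rw [indicator_of_mem hA, indicator_of_mem hA, WZ_eq]
        split_ifs with hc
        · have := sub_xZ_le (κ := κ) hB hM hΩ hn' hj.le hc k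
          linarith
        · have := he0 j hj.le
          linarith
      · rw [indicator_of_notMem hA, indicator_of_notMem hA]
        simp
    · rw [WZ_eq]
      split_ifs with hc
      · rw [one_mul]
        refine max_le (min_le_min le_rfl (sub_xZ_le (κ := κ) hB hM hΩ hn' le_rfl hc k)) (le_min ?_ ?_)
        · have := h.norm_coe_le_norm ζ.1
          rw [Real.norm_eq_abs] at this
          linarith [neg_abs_le (h ζ.1)]
        · linarith [norm_nonneg h, he0 n le_rfl]
      · rw [zero_mul]
end
end PartTwoE
end FileI5

section FileI6
section PartTwoF
variable {n : ℕ}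
open scoped BoundedContinuousFunction
variable {P : Set (Path n)} {κ v : ℝ} {B : ℕ → ℝ} {βN : ℕ → Dyn n}
    {G : (Fin n → ℝ) → EReal} {Q : Measure (ZZ n)}

lemma aZ_congr {M M' : ℕ → ℝ} {j : ℕ} (h : M j = M' j) : (aZ B M j : Set (ZZ n)) = aZ B M' j := by
  unfold aZ; rw [h]

lemma eZ_congr {M M' : ℕ → ℝ} {j : ℕ} (h : ∀ i < j, M i = M' i) : (eZ κ M j : ZZ n → ℝ) = eZ κ M' j := by
  funext ζ
  unfold eZ
  congr 1
  exact Finset.sum_congr rfl fun i hi => by rw [h i (Finset.mem_range.1 hi)]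

lemma aZ_eventually (ζ : ZZ n) (j : ℕ) (M : ℕ → ℕ → ℝ) (hM : ∀ l : ℕ, (l : ℝ) ≤ M l j) :
    ∀ᶠ l in atTop, ζ ∉ aZ B (M l) j := by
  by_cases hb : BddAbove (range fun k => yZ B k j ζ)
  · obtain ⟨N, hN⟩ := (bddAbove_iff_nat _).1 hb
    filter_upwards [eventually_ge_atTop N] with l hl hmem
    obtain ⟨-, k, hk⟩ := hmem
    have h1 : (N : ℝ) ≤ l := by exact_mod_cast hl
    linarith [hN k, hM l]
  · exact Eventually.of_forall fun l hmem => hb hmem.1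

lemma choose_one (j : ℕ) (e : ZZ n → ℝ) (he : Integrable e Q) (c0 : ℝ) {ε : ℝ} (hε : 0 < ε) :
    ∃ c, c0 ≤ c ∧ ∀ M : ℕ → ℝ, M j = c → ∫ ζ, (aZ B M j).indicator e ζ ∂Q ≤ ε := by
  have hlim : Tendsto (fun l : ℕ => ∫ ζ, (aZ B (fun _ => max c0 (l : ℝ)) j).indicator e ζ ∂Q) atTop (𝓝 (∫ ζ, (0 : ℝ) ∂Q)) := by
    refine tendsto_integral_of_dominated_convergence (fun ζ => |e ζ|) (fun l => ?_) he.abs (fun l => ?_) ?_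
    · exact (he.indicator (meas_aZ B _ j)).aestronglyMeasurable
    · refine Eventually.of_forall fun ζ => ?_
      exact norm_indicator_le_norm_self e ζ
    · refine Eventually.of_forall fun ζ => tendsto_const_nhds.congr' ?_
      filter_upwards [aZ_eventually (B := B) ζ j (fun l _ => max c0 (l : ℝ)) (fun l => le_max_right _ _)] with l hl
      rw [indicator_of_notMem hl]
  rw [integral_zero] at hlim
  obtain ⟨l, hl⟩ := (hlim.eventually (gt_mem_nhds hε)).exists
  refine ⟨max c0 l, le_max_left _ _, fun M hM => ?_⟩
  rw [aZ_congr (M' := fun _ => max c0 (l : ℝ)) hM]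
  exact hl.le

lemma choose_M (hQ : QProp P κ v B βN G Q) (c0 : ℝ) {ε : ℝ} (hε : 0 < ε) (m : ℕ) :
    ∃ M : ℕ → ℝ, (∀ i, c0 ≤ M i) ∧ ∀ j < m, ∫ ζ, (aZ B M j).indicator (eZ κ M j) ζ ∂Q ≤ ε := by
  induction m with
  | zero => exact ⟨fun _ => c0, fun _ => le_rfl, fun j hj => absurd hj (Nat.not_lt_zero j)⟩
  | succ m ih =>
    obtain ⟨M, hM1, hM2⟩ := ih
    obtain ⟨c, hc, hc2⟩ := choose_one (B := B) (Q := Q) m (eZ κ M m) (integrable_eZ hQ M m) c0 hε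
    refine ⟨Function.update M m c, fun i => ?_, fun j hj => ?_⟩
    · by_cases hi : i = m
      · rw [hi, Function.update_self]; exact hc
      · rw [Function.update_of_ne hi]; exact hM1 i
    · have he : (eZ κ (Function.update M m c) j : ZZ n → ℝ) = eZ κ M j :=
        eZ_congr fun i hi => Function.update_of_ne (by omega) _ _
      rw [he]
      by_cases hjm : j = m
      · subst hjm
        exact hc2 _ (Function.update_self _ _ _)
      · rw [aZ_congr (M' := M) (Function.update_of_ne hjm _ _)]
        exact hM2 j (by omega)

lemma min_coe_tendsto {α : Type*} {l : Filter α} {g : α → EReal} {a : EReal} (d : EReal) (h : Tendsto g l (𝓝 a)) :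
    Tendsto (fun x => min (g x) d) l (𝓝 (min a d)) := h.min tendsto_const_nhds

/-- fixed truncation level: pass to the limit in the approximations of the payoff and in `k` -/
lemma level {s₀ : ℝ} (hPsub : P ⊆ Omega n s₀) (hκ : 0 ≤ κ) (hB : ∀ k, 0 < B k) (hQ : QProp P κ v B βN G Q)
    (hno : ∀ j < n, ∀ᵐ ζ ∂Q, BddAbove (range fun k => yZ B k j ζ) ∨ sZ (j + 1) ζ - sZ j ζ = 0)
    (hr : ∀ k, ∃ h : ℕ → Path n →ᵇ ℝ,
      (∀ r, ∀ ω ∈ P, G (tailCoords ω) - (((βN k).gains ω : ℝ) : EReal) ≤ ((h r ω : ℝ) : EReal)) ∧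
      ∀ ω ∈ P, Tendsto (fun r => ((h r ω : ℝ) : EReal)) atTop
        (𝓝 (G (tailCoords ω) - (((βN k).gains ω : ℝ) : EReal))))
    (f : Path n → EReal)
    (hlim : ∀ ω ∈ P, Tendsto (fun N => G (tailCoords ω) - (((βN N).gains ω : ℝ) : EReal)) atTop
            (𝓝 (f ω)))
    (c0 : ℝ) (hc0 : 0 ≤ c0) {ε : ℝ} (hε : 0 < ε) :
    ∃ M : ℕ → ℝ, (∀ i, c0 ≤ M i) ∧ ∃ g : ZZ n → ℝ, Integrable g Q ∧ v - ε ≤ ∫ ζ, g ζ ∂Q ∧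
      ∀ᵐ ζ ∂Q, ((g ζ : ℝ) : EReal) = if ∀ j < n, ζ ∉ aZ B M j then min (f ζ.1) ((eZ κ M n ζ : ℝ) : EReal) else 0 := by
  haveI := hQ.prob
  obtain ⟨M, hM1, hM2⟩ := choose_M hQ c0 (ε := ε / (n + 1)) (by positivity) n
  refine ⟨M, hM1, ?_⟩
  have hM0 : ∀ i, 0 ≤ M i := fun i => hc0.trans (hM1 i)
  have hbound : ∀ k (h : Path n →ᵇ ℝ),
      (∀ ω ∈ P, G (tailCoords ω) - (((βN k).gains ω : ℝ) : EReal) ≤ ((h ω : ℝ) : EReal)) →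
      v - ε ≤ ∫ ζ, (if ∀ j < n, ζ ∉ aZ B M j then min (h ζ.1) (eZ κ M n ζ) else 0) ∂Q := by
    intro k h hh
    have h1 := mixlim hPsub hκ hB hQ hno hM0 k h hh
    rw [integral_add (integrable_finset_sum _ fun j _ => (integrable_eZ hQ M j).indicator (meas_aZ B M j))
      (integrable_cut hQ M h), integral_finset_sum _ fun j _ => (integrable_eZ hQ M j).indicator (meas_aZ B M j)] at h1
    have h2 : ∑ j ∈ Finset.range n, ∫ ζ, (aZ B M j).indicator (eZ κ M j) ζ ∂Q ≤ n * (ε / (n + 1)) := by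
      have := Finset.sum_le_sum (s := Finset.range n) fun j hj => hM2 j (Finset.mem_range.1 hj)
      simpa using this
    have h3 : n * (ε / ((n : ℝ) + 1)) ≤ ε := by
      rw [mul_div_assoc', div_le_iff₀ (by positivity)]
      nlinarith
    linarith
  choose h h1 h2 using hr
  have hk : ∀ k, ∃ g : ZZ n → ℝ, Integrable g Q ∧
      (∀ᵐ ζ ∂Q, (if ∀ j < n, ζ ∉ aZ B M j then min (G (tailCoords ζ.1) - (((βN k).gains ζ.1 : ℝ) : EReal))
        ((eZ κ M n ζ : ℝ) : EReal) else 0) = ((g ζ : ℝ) : EReal)) ∧ v - ε ≤ ∫ ζ, g ζ ∂Q := by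
    intro k
    refine fatouE (g := fun r (ζ : ZZ n) => if ∀ j < n, ζ ∉ aZ B M j then min (h k r ζ.1) (eZ κ M n ζ) else 0)
      (d := fun ζ => |eZ κ M n ζ|)
      (fun r => integrable_cut hQ M (h k r)) (integrable_eZ hQ M n).abs
      (fun r => Eventually.of_forall fun ζ => ?_) ?_ (fun r => hbound k (h k r) (h1 k r))
    · beta_reduce
      split_ifs
      · exact (min_le_right _ _).trans (le_abs_self _)
      · exact abs_nonneg _
    · filter_upwards [hQ.mem] with ζ hζ
      by_cases hc : ∀ j < n, ζ ∉ aZ B M j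
      · have hcm : ∀ a b : ℝ, ((min a b : ℝ) : EReal) = min (a : EReal) (b : EReal) :=
          fun a b => EReal.coe_strictMono.monotone.map_min
        simp only [if_pos hc, hcm]
        exact min_coe_tendsto _ (h2 k ζ.1 hζ)
      · simp only [if_neg hc, EReal.coe_zero]
        exact tendsto_const_nhds
  choose g hg1 hg2 hg3 using hk
  obtain ⟨g', h1', h2', h3'⟩ := fatouE (g := g) (d := fun ζ => |eZ κ M n ζ|)
    (f := fun ζ : ZZ n => if ∀ j < n, ζ ∉ aZ B M j then min (f ζ.1) ((eZ κ M n ζ : ℝ) : EReal) else 0)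
    hg1 (integrable_eZ hQ M n).abs
    (fun k => by
      filter_upwards [hg2 k] with ζ hζ
      rw [← EReal.coe_le_coe_iff, ← hζ]
      split_ifs
      · exact (min_le_right _ _).trans (EReal.coe_le_coe_iff.2 (le_abs_self _))
      · exact EReal.coe_nonneg.2 (abs_nonneg _))
    (by
      filter_upwards [hQ.mem, ae_all_iff.2 hg2] with ζ hζ hall
      simp only [← hall]
      by_cases hc : ∀ j < n, ζ ∉ aZ B M j
      · simp only [if_pos hc]
        exact min_coe_tendsto _ (hlim ζ.1 hζ)
      · simp only [if_neg hc]
        exact tendsto_const_nhds) hg3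
  exact ⟨g', h1', h3', by filter_upwards [h2'] with ζ hζ using hζ.symm⟩

lemma conclude {s₀ : ℝ} (hPsub : P ⊆ Omega n s₀) (hκ : 0 ≤ κ) (hB : ∀ k, 0 < B k) (hQ : QProp P κ v B βN G Q)
    (hr : ∀ k, ∃ h : ℕ → Path n →ᵇ ℝ,
      (∀ r, ∀ ω ∈ P, G (tailCoords ω) - (((βN k).gains ω : ℝ) : EReal) ≤ ((h r ω : ℝ) : EReal)) ∧
      ∀ ω ∈ P, Tendsto (fun r => ((h r ω : ℝ) : EReal)) atTop
        (𝓝 (G (tailCoords ω) - (((βN k).gains ω : ℝ) : EReal))))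
    (f : Path n → EReal) (hft : ∀ ω, f ω ≠ ⊤)
    (hlim : ∀ ω ∈ P, Tendsto (fun N => G (tailCoords ω) - (((βN N).gains ω : ℝ) : EReal)) atTop
            (𝓝 (f ω)))
    (hfD : ∀ ζ : ZZ n, ζ.1 ∈ P → f ζ.1 ≤ ((eZ κ (fun _ => κ * n) n ζ : ℝ) : EReal)) :
    ∃ g : ZZ n → ℝ, Integrable g Q ∧ (∀ᵐ ζ ∂Q, f ζ.1 = ((g ζ : ℝ) : EReal)) ∧ v ≤ ∫ ζ, g ζ ∂Q := by
  haveI := hQ.prob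
  have hno := noArb hB hQ (noArb_n hQ hr f hft hlim)
  have hκn : 0 ≤ κ * n := by positivity
  choose M hM g hg1 hg2 hg3 using fun l : ℕ => level hPsub hκ hB hQ hno hr f hlim (max (l : ℝ) (κ * n))
    (le_max_of_le_right hκn) (ε := 1 / ((l : ℝ) + 1)) (by positivity)
  have hg3' : ∀ l, ∀ᵐ ζ ∂Q, ((g l ζ : ℝ) : EReal) = if ∀ j < n, ζ ∉ aZ B (M l) j then f ζ.1 else 0 := by
    intro l
    filter_upwards [hg3 l, hQ.mem] with ζ hζ hP
    rw [hζ, min_eq_left]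
    refine (hfD ζ hP).trans (EReal.coe_le_coe_iff.2 ?_)
    unfold eZ
    refine add_le_add le_rfl (Finset.sum_le_sum fun i _ => ?_)
    exact mul_le_mul_of_nonneg_right ((le_max_right _ _).trans (hM l i)) (sZ_nonneg (hPsub hP) i)
  refine fatouE (g := fun l ζ => g l ζ + 1 / ((l : ℝ) + 1)) (d := fun ζ => |eZ κ (fun _ => κ * n) n ζ| + 1)
    (fun l => (hg1 l).add (integrable_const _)) ((integrable_eZ hQ _ n).abs.add (integrable_const _))
    (fun l => ?_) ?_ (fun l => ?_)
  · filter_upwards [hg3' l, hQ.mem] with ζ hζ hP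
    refine add_le_add ?_ ?_
    · rw [← EReal.coe_le_coe_iff, hζ]
      split_ifs
      · exact (hfD ζ hP).trans (EReal.coe_le_coe_iff.2 (le_abs_self _))
      · exact EReal.coe_nonneg.2 (abs_nonneg _)
    · rw [div_le_one (by positivity)]
      have : (0 : ℝ) ≤ l := Nat.cast_nonneg l
      linarith
  · filter_upwards [ae_all_iff.2 hg3'] with ζ hζ
    have hev : ∀ᶠ l in atTop, ∀ j < n, ζ ∉ aZ B (M l) j := by
      have : ∀ᶠ l in atTop, ∀ j ∈ Finset.range n, ζ ∉ aZ B (M l) j :=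
        (Finset.eventually_all _).2 fun j _ =>
          aZ_eventually ζ j M fun l => (le_max_left _ _).trans (hM l j)
      filter_upwards [this] with l hl j hj
      exact hl j (Finset.mem_range.2 hj)
    obtain ⟨l0, hl0⟩ := hev.exists
    have hfl : f ζ.1 = ((g l0 ζ : ℝ) : EReal) := by
      have := hζ l0
      rw [if_pos hl0] at this
      exact this.symm
    rw [hfl]
    refine (continuous_coe_real_ereal.tendsto _).comp ?_
    have ht : Tendsto (fun l : ℕ => g l0 ζ + 1 / ((l : ℝ) + 1)) atTop (𝓝 (g l0 ζ + 0)) :=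
      tendsto_const_nhds.add tendsto_one_div_add_atTop_nhds_zero_nat
    rw [add_zero] at ht
    refine ht.congr' ?_
    filter_upwards [hev] with l hl
    have := hζ l
    rw [if_pos hl, hfl, EReal.coe_eq_coe_iff] at this
    rw [this]
  · have h2 := hg2 l
    rw [integral_add (hg1 l) (integrable_const _)]
    simp only [integral_const, probReal_univ, one_smul]
    linarith

end PartTwoF
end FileI6

section FileJ
lemma gbeta_le {n : ℕ} {s₀ : ℝ} {P : Set (Path n)} (hPsub : P ⊆ Omega n s₀)
    {G : (Fin n → ℝ) → EReal} {K : ℝ}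
    (hG : ∀ s : Fin n → ℝ, (∀ i, 0 ≤ s i) → G s ≤ ((K * (1 + ∑ i, s i) : ℝ) : EReal))
    {β : (i : Fin (n + 1)) → (Fin i → ℝ) → ℝ} (hβ : IsBetaFamily s₀ P G β)
    (ζ : ZZ n) (hζ : ζ.1 ∈ P) :
    G (tailCoords ζ.1) - ((gainsOf β ζ.1 : ℝ) : EReal) ≤
      ((eZ (max K 0) (fun _ => max K 0 * n) n ζ : ℝ) : EReal) := by
  have hΩ := hPsub hζ
  have h1 := le_tZ_n hG ζ hΩ
  have h2 : -gainsOf β ζ.1 ≤ ∑ i ∈ Finset.range n, (max K 0 * n) * sZ i ζ := by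
    rw [← Fin.sum_univ_eq_sum_range (fun i => (max K 0 * n) * sZ i ζ) n]
    unfold gainsOf
    rw [← Finset.sum_neg_distrib]
    refine Finset.sum_le_sum fun j _ => ?_
    have hs : ∀ k, 0 ≤ restr j ζ.1 k := fun k => hΩ.2 _
    have b0 := beta_nonneg hβ j _ hs
    have b1 := beta_le hPsub hG hβ j _ hs
    have e1 : sZ (j : ℕ) ζ = ζ.1 j.castSucc := seqP_castSucc ζ.1 j
    rw [e1]
    have p0 := hΩ.2 j.succ
    have p1 := hΩ.2 j.castSucc
    have m1 := mul_nonneg b0 p0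
    have m2 := mul_le_mul_of_nonneg_right b1 p1
    rw [mul_sub]
    linarith
  unfold eZ
  refine (EReal.sub_le_sub h1 le_rfl).trans ?_
  rw [← EReal.coe_sub]
  exact EReal.coe_le_coe_iff.2 (by linarith)

lemma aemeasurable_limit {n : ℕ} {Q : Measure (Path n)} {f : Path n → EReal} {g : ℕ → Path n → EReal}
    (hg : ∀ k, AEMeasurable (g k) Q) (h : ∀ᵐ ω ∂Q, Tendsto (fun k => g k ω) atTop (𝓝 (f ω))) :
    AEMeasurable f Q := aemeasurable_of_tendsto_metrizable_ae atTop hg h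

lemma ae_Omega {n : ℕ} {s₀ : ℝ} {μ : Fin n → Measure ℝ} {P : Set (Path n)} {Q : Measure (Path n)}
    (hQ : Q ∈ MSetP s₀ μ P) : ∀ᵐ ω ∂Q, ω ∈ Omega n s₀ := by
  haveI := hQ.1.1.1
  exact ae_of_measure_one (isClosed_Omega n s₀) hQ.1.1.2.1

lemma part2_le {n : ℕ} {s₀ : ℝ}
    (P : Set (Path n)) (hPsub : P ⊆ Omega n s₀) (hPclosed : IsClosed P)
    (μ : Fin n → Measure ℝ) (hprob : ∀ i, IsProbabilityMeasure (μ i))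
    (hsupp : ∀ i, μ i (Set.Iio 0) = 0) (hmom : ∀ i, Integrable (fun x => x) (μ i))
    (G : (Fin n → ℝ) → EReal) (hGtop : ∀ s, G s ≠ ⊤)
    (K : ℝ) (hG : ∀ s : Fin n → ℝ, (∀ i, 0 ≤ s i) → G s ≤ ((K * (1 + ∑ i, s i) : ℝ) : EReal))
    (β : (i : Fin (n + 1)) → (Fin i → ℝ) → ℝ) (hβ : IsBetaFamily s₀ P G β)
    (βN : ℕ → Dyn n) (hN : ∀ N, (βN N).Nonneg)
    (husc : ∀ N, UpperSemicontinuousOn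
          (fun ω => G (tailCoords ω) - (((βN N).gains ω : ℝ) : EReal)) (Omega n s₀))
    (hC : ∀ N, ∃ C : ℝ, ∀ ω ∈ P,
          G (tailCoords ω) - (((βN N).gains ω : ℝ) : EReal) ≤ (C : EReal))
    (hlim : ∀ ω ∈ Omega n s₀,
          Tendsto (fun N => G (tailCoords ω) - (((βN N).gains ω : ℝ) : EReal)) atTop
            (nhds (G (tailCoords ω) - ((gainsOf β ω : ℝ) : EReal))))
    (hmeas : ∀ Q ∈ MSetP s₀ μ P,
      AEMeasurable (fun ω => G (tailCoords ω) - ((gainsOf β ω : ℝ) : EReal)) Q) :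
    V Static.putPayoff (fun i K' => ∫ x, max (K' - x) 0 ∂(μ i)) P (fun ω => G (tailCoords ω)) ≤
    ⨆ Q ∈ MSetP s₀ μ P, eexpE Q (fun ω => G (tailCoords ω) - ((gainsOf β ω : ℝ) : EReal)) := by
  refine V_le_of_forall (V_ne_top hPsub hG _) fun v hv => ?_
  obtain ⟨B, Q, hB, hQ, hmem⟩ := extQ P hPsub hPclosed μ hprob hsupp hmom G hGtop K hG βN hN v hv
  obtain ⟨g, hg1, hg2, hg3⟩ := conclude hPsub (le_max_right _ _) hB hQ (fun k => by
      obtain ⟨C, hCk⟩ := hC k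
      obtain ⟨h, h1, -, h3⟩ := usc_approx P _ ((husc k).mono hPsub) (max C 0) (le_max_right _ _)
        (fun ω hω => (hCk ω hω).trans (EReal.coe_le_coe_iff.2 (le_max_left _ _)))
      exact ⟨h, h1, h3⟩)
    (fun ω => G (tailCoords ω) - ((gainsOf β ω : ℝ) : EReal))
    (fun ω => by
      have := hGtop (tailCoords ω)
      induction hx : G (tailCoords ω) using EReal.rec with
      | bot => simp
      | coe x => rw [← EReal.coe_sub]; exact EReal.coe_ne_top _
      | top => exact absurd hx this)
    (fun ω hω => hlim ω (hPsub hω))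
    (fun ζ hζ => gbeta_le hPsub hG hβ ζ hζ)
  refine le_iSup₂_of_le _ hmem ?_
  exact le_eexpE_map continuous_fst.measurable (hmeas _ hmem) hg1 hg2 hg3
end FileJ

/-- Theorem 4.5, duality gap characterisation for puts with `n`
marginals: under Assumption A, for `G` upper semi-continuous of linear growth and
`(β_i)` the recursively defined family, if `G_β` is upper semi-continuous and
bounded from above then the put-based superhedging price equals
`sup_{ℙ ∈ M⁻_{μ,𝔓}} E_ℙ[G_β]`; more generally the same holds if `G_β` is a
pointwise limit of payoffs `G_{β^{(N)}}` associated to admissible dynamic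
strategies, each upper semi-continuous and bounded from above on `𝔓`. -/
theorem duality_gap_puts_multi
    {n : ℕ} (hn : 1 ≤ n) {s₀ : ℝ} (hs₀ : 0 < s₀)
    (P : Set (Path n)) (hPsub : P ⊆ Omega n s₀) (hPclosed : IsClosed P)
    (μ : Fin n → Measure ℝ) (hprob : ∀ i, IsProbabilityMeasure (μ i))
    (hsupp : ∀ i, μ i (Set.Iio 0) = 0) (hmom : ∀ i, Integrable (fun x => x) (μ i))
    (hA : AssumptionA s₀ μ)
    (G : (Fin n → ℝ) → EReal) (hGtop : ∀ s, G s ≠ ⊤)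
    (hGusc : UpperSemicontinuousOn G {s | ∀ i, 0 ≤ s i})
    (K : ℝ) (hG : ∀ s : Fin n → ℝ, (∀ i, 0 ≤ s i) → G s ≤ ((K * (1 + ∑ i, s i) : ℝ) : EReal))
    (β : (i : Fin (n + 1)) → (Fin i → ℝ) → ℝ) (hβ : IsBetaFamily s₀ P G β) :
    ((UpperSemicontinuousOn
        (fun ω => G (tailCoords ω) - ((gainsOf β ω : ℝ) : EReal)) (Omega n s₀) ∧
      (∃ C : ℝ, ∀ ω ∈ Omega n s₀,
        G (tailCoords ω) - ((gainsOf β ω : ℝ) : EReal) ≤ (C : EReal))) →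
      V Static.putPayoff (fun i K' => ∫ x, max (K' - x) 0 ∂(μ i)) P
          (fun ω => G (tailCoords ω)) =
        ⨆ Q ∈ MSetP s₀ μ P,
          eexpE Q (fun ω => G (tailCoords ω) - ((gainsOf β ω : ℝ) : EReal))) ∧
    ((∃ βN : ℕ → Dyn n, (∀ N, (βN N).Nonneg) ∧
        (∀ N, UpperSemicontinuousOn
          (fun ω => G (tailCoords ω) - (((βN N).gains ω : ℝ) : EReal)) (Omega n s₀)) ∧
        (∀ N, ∃ C : ℝ, ∀ ω ∈ P,
          G (tailCoords ω) - (((βN N).gains ω : ℝ) : EReal) ≤ (C : EReal)) ∧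
        (∀ ω ∈ Omega n s₀,
          Tendsto (fun N => G (tailCoords ω) - (((βN N).gains ω : ℝ) : EReal)) atTop
            (nhds (G (tailCoords ω) - ((gainsOf β ω : ℝ) : EReal))))) →
      V Static.putPayoff (fun i K' => ∫ x, max (K' - x) 0 ∂(μ i)) P
          (fun ω => G (tailCoords ω)) =
        ⨆ Q ∈ MSetP s₀ μ P,
          eexpE Q (fun ω => G (tailCoords ω) - ((gainsOf β ω : ℝ) : EReal))) := by
  refine ⟨?_, ?_⟩
  · rintro ⟨husc, C, hC⟩
    refine le_antisymm (part1_le P hPsub hPclosed μ hprob hsupp hmom G hGtop hGusc K hG β hβ husc C hC)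
      (weak_duality hPsub hPclosed hprob hmom hGtop hG hβ fun Q hQ => ?_)
    exact aemeasurable_of_usc (isClosed_Omega n s₀) (ae_Omega hQ) husc
  · rintro ⟨βN, hN, husc, hC, hlim⟩
    have hmeas : ∀ Q ∈ MSetP s₀ μ P,
        AEMeasurable (fun ω => G (tailCoords ω) - ((gainsOf β ω : ℝ) : EReal)) Q := by
      intro Q hQ
      refine aemeasurable_limit
        (fun k => aemeasurable_of_usc (isClosed_Omega n s₀) (ae_Omega hQ) (husc k)) ?_
      filter_upwards [ae_Omega hQ] with ω hω using hlim ω hω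
    exact le_antisymm (part2_le P hPsub hPclosed μ hprob hsupp hmom G hGtop K hG β hβ βN hN husc hC hlim hmeas)
      (weak_duality hPsub hPclosed hprob hmom hGtop hG hβ hmeas)

end RobustFin
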